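/- For every integer n ≥ 0, the coefficient identity holds: NT(1,5,5n+4) − NT(4,5,5n+4) + 2·M_ω(2,5,5n+4) − 2·M_ω(3,5,5n+4) = −5·c(n), where c(n) is the coefficient of q^n in the power series (q^5;q^5)_∞^4 / (q;q)_∞; equivalently, as an identity of power series in q (valid for |q|<1), ∑_{n≥0} (NT(1,5,5n+4) − NT(4,5,5n+4) + 2·M_ω(2,5,5n+4) − 2·M_ω(3,5,5n+4)) q^n = −5 (q^5;q^5)_∞^4 / (q;q)_∞. -/

import Mathlib

/-!
Common definitions: for a partition `π` of `n`,
`numParts` is the number of parts, `largestPart` the largest part,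
`omegaOnes` the number of parts equal to 1, `rank` and `crank` the
Dyson rank and Andrews–Garvan crank.  `NT m j n` is the total number of
parts over partitions of `n` with rank ≡ m (mod j), and `Mw m j n` is
the total number of ones over partitions of `n` with crank ≡ m (mod j).
`poch a q = (a; q)_∞ = ∏_{n ≥ 0} (1 - a qⁿ)`.
-/

namespace Beck

/-- number of parts of a partition -/
def numParts {n : ℕ} (π : n.Partition) : ℕ := Multiset.card π.parts

/-- largest part of a partition (0 for the empty partition) -/
def largestPart {n : ℕ} (π : n.Partition) : ℕ := π.parts.sup

/-- number of ones in a partition -/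
def omegaOnes {n : ℕ} (π : n.Partition) : ℕ := π.parts.count 1

/-- number of parts strictly larger than the number of ones -/
def muParts {n : ℕ} (π : n.Partition) : ℕ :=
  Multiset.card (π.parts.filter fun x => omegaOnes π < x)

/-- Dyson's rank: largest part minus number of parts -/
def rank {n : ℕ} (π : n.Partition) : ℤ :=
  (largestPart π : ℤ) - (numParts π : ℤ)

/-- the Andrews–Garvan crank -/
def crank {n : ℕ} (π : n.Partition) : ℤ :=
  if omegaOnes π = 0 then (largestPart π : ℤ)
  else (muParts π : ℤ) - (omegaOnes π : ℤ)

/-- `NT m j n`: total number of parts in partitions of `n` with rank ≡ m (mod j) -/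
def NT (m j n : ℕ) : ℤ :=
  ∑ π : n.Partition,
    if rank π % (j : ℤ) = (m : ℤ) % (j : ℤ) then (numParts π : ℤ) else 0

/-- `Mw m j n`: total number of ones in partitions of `n` with crank ≡ m (mod j) -/
def Mw (m j n : ℕ) : ℤ :=
  ∑ π : n.Partition,
    if crank π % (j : ℤ) = (m : ℤ) % (j : ℤ) then (omegaOnes π : ℤ) else 0

/-- `(a; q)_∞ = ∏_{n ≥ 0} (1 - a qⁿ)` -/
noncomputable def poch (a q : ℂ) : ℂ := ∏' n : ℕ, (1 - a * q ^ n)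

open Filter Topology

/-! ### Infinite products -/

lemma exists_norm_prod_one_add_le {ι : Type*} {f : ι → ℂ} (hf : Summable fun i => ‖f i‖) :
    ∃ C : ℝ, 0 < C ∧ ∀ s : Finset ι, ‖∏ i ∈ s, (1 + f i)‖ ≤ C := by
  refine ⟨Real.exp (∑' i, ‖f i‖), Real.exp_pos _, fun s => ?_⟩
  calc ‖∏ i ∈ s, (1 + f i)‖ ≤ ∏ i ∈ s, Real.exp ‖f i‖ := by
        rw [norm_prod]
        refine Finset.prod_le_prod (fun _ _ => norm_nonneg _) fun i _ => ?_
        calc ‖1 + f i‖ ≤ ‖(1 : ℂ)‖ + ‖f i‖ := norm_add_le _ _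
          _ = ‖f i‖ + 1 := by rw [norm_one, add_comm]
          _ ≤ _ := Real.add_one_le_exp _
    _ = Real.exp (∑ i ∈ s, ‖f i‖) := (Real.exp_sum _ _).symm
    _ ≤ _ := Real.exp_le_exp.2 (hf.sum_le_tsum s fun _ _ => norm_nonneg _)

section poch

variable {q : ℂ} (hq : ‖q‖ < 1) (a : ℂ)
include hq

lemma summable_norm_neg_mul_pow : Summable fun n : ℕ => ‖-(a * q ^ n)‖ := by
  simp only [norm_neg, norm_mul, norm_pow]
  exact (summable_geometric_of_lt_one (norm_nonneg _) hq).mul_left _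

lemma multipliable_poch : Multipliable fun n : ℕ => 1 - a * q ^ n := by
  simpa [sub_eq_add_neg] using multipliable_one_add_of_summable (summable_norm_neg_mul_pow hq a)

lemma tendsto_poch :
    Tendsto (fun N => ∏ k ∈ Finset.range N, (1 - a * q ^ k)) atTop (𝓝 (poch a q)) :=
  (multipliable_poch hq a).hasProd.tendsto_prod_nat

lemma poch_succ : poch a q = (1 - a) * poch (a * q) q := by
  refine tendsto_nhds_unique ((tendsto_add_atTop_iff_nat 1).2 (tendsto_poch hq a)) ?_
  refine ((tendsto_poch hq (a * q)).const_mul (1 - a)).congr fun N => ?_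
  rw [Finset.prod_range_succ', mul_comm]
  congr 1
  · exact Finset.prod_congr rfl fun k _ => by ring
  · simp

lemma poch_eq_prod_mul (m : ℕ) :
    poch a q = (∏ k ∈ Finset.range m, (1 - a * q ^ k)) * poch (a * q ^ m) q := by
  induction m with
  | zero => simp
  | succ m ih =>
    rw [ih, poch_succ hq (a * q ^ m), Finset.prod_range_succ, pow_succ]
    ring_nf

variable {a} in
lemma poch_ne_zero (h : ∀ n : ℕ, a * q ^ n ≠ 1) : poch a q ≠ 0 := by
  have := tprod_one_add_ne_zero_of_summable (f := fun n : ℕ => -(a * q ^ n))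
    (fun n => by rw [← sub_eq_add_neg, sub_ne_zero]; exact (h n).symm)
    (summable_norm_neg_mul_pow hq a)
  simpa [poch, sub_eq_add_neg] using this

variable {a} in
lemma poch_ne_zero_of_norm_lt (h : ‖a‖ < 1) : poch a q ≠ 0 := by
  refine poch_ne_zero hq fun n hn => ?_
  have : ‖a * q ^ n‖ < 1 := by
    rw [norm_mul, norm_pow]
    exact mul_lt_one_of_nonneg_of_lt_one_left (norm_nonneg _) h (pow_le_one₀ (norm_nonneg _) hq.le)
  rw [hn, norm_one] at this
  exact lt_irrefl _ this

lemma differentiable_poch : Differentiable ℂ fun a => poch a q := by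
  intro a
  have h := Summable.hasProdLocallyUniformlyOn_nat_one_add (f :=
      fun (n : ℕ) (x : ℂ) => -(x * q ^ n))
    (K := Metric.ball (0 : ℂ) (‖a‖ + 1)) Metric.isOpen_ball
    (u := fun n => (‖a‖ + 1) * ‖q‖ ^ n)
    ((summable_geometric_of_lt_one (norm_nonneg _) hq).mul_left _)
    (.of_forall fun n x hx => by
      rw [norm_neg, norm_mul, norm_pow]
      have : ‖x‖ < ‖a‖ + 1 := by simpa using hx
      gcongr) (fun n => by fun_prop)
  have hd : DifferentiableOn ℂ (fun x => ∏' i : ℕ, (1 + -(x * q ^ i))) (Metric.ball 0 (‖a‖ + 1)) :=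
    h.differentiableOn (.of_forall fun _ => by
      simpa [Finset.prod_fn] using DifferentiableOn.finsetProd (fun _ _ => by fun_prop))
      Metric.isOpen_ball
  have := hd.differentiableAt (x := a) (Metric.isOpen_ball.mem_nhds (by simp))
  simpa [poch, sub_eq_add_neg] using this

lemma exists_norm_prod_le :
    ∃ C : ℝ, 0 < C ∧ ∀ s : Finset ℕ, ‖∏ k ∈ s, (1 - a * q ^ k)‖ ≤ C := by
  simpa [sub_eq_add_neg] using exists_norm_prod_one_add_le (summable_norm_neg_mul_pow hq a)

variable {a} in
lemma exists_norm_prod_inv_le (h : ∀ n : ℕ, a * q ^ n ≠ 1) :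
    ∃ C : ℝ, 0 < C ∧ ∀ s : Finset ℕ, ‖(∏ k ∈ s, (1 - a * q ^ k))⁻¹‖ ≤ C := by
  have h1 : ∀ n : ℕ, 1 - a * q ^ n ≠ 0 := fun n => sub_ne_zero.2 (h n).symm
  have hlim : Tendsto (fun n : ℕ => ‖(1 - a * q ^ n)⁻¹‖) atTop (𝓝 ‖(1 - a * 0)⁻¹‖) :=
    ((((tendsto_pow_atTop_nhds_zero_of_norm_lt_one hq).const_mul a).const_sub 1).inv₀
      (by simp)).norm
  obtain ⟨B, hB⟩ := hlim.bddAbove_range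
  have hs : Summable fun n : ℕ => ‖a * q ^ n * (1 - a * q ^ n)⁻¹‖ := by
    refine Summable.of_nonneg_of_le (fun _ => norm_nonneg _) (fun n => ?_)
      ((summable_norm_neg_mul_pow hq a).mul_right B)
    rw [norm_mul, norm_neg]
    exact mul_le_mul_of_nonneg_left (hB ⟨n, rfl⟩) (norm_nonneg _)
  obtain ⟨C, hC, h2⟩ := exists_norm_prod_one_add_le hs
  refine ⟨C, hC, fun s => ?_⟩
  rw [← Finset.prod_inv_distrib]
  convert h2 s using 3 with k hk
  have := h1 k
  field_simp
  ring

lemma poch_split (m : ℕ) (hm : m ≠ 0) :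
    poch a q = ∏ r ∈ Finset.range m, poch (a * q ^ r) (q ^ m) := by
  have hqm : ‖q ^ m‖ < 1 := by rw [norm_pow]; exact pow_lt_one₀ (norm_nonneg _) hq hm
  have h1 := (tendsto_poch hq a).comp (tendsto_id.atTop_mul_const' (Nat.pos_of_ne_zero hm))
  have h2 := tendsto_finsetProd (Finset.range m) fun r _ => tendsto_poch hqm (a * q ^ r)
  refine tendsto_nhds_unique h1 (h2.congr fun N => ?_)
  simp only [Function.comp, id]
  rw [Finset.prod_comm]
  induction N with
  | zero => simp
  | succ N ih =>
    rw [Finset.prod_range_succ, ih, Nat.add_mul, one_mul, Finset.prod_range_add]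
    congr 1
    refine Finset.prod_congr rfl fun r _ => ?_
    ring

lemma prod_poch_root {ζ : ℂ} (h5 : ζ ^ 5 = 1) (hs : 1 + ζ + ζ ^ 2 + ζ ^ 3 + ζ ^ 4 = 0) :
    poch a q * poch (ζ * a) q * poch (ζ ^ 2 * a) q * poch (ζ ^ 3 * a) q * poch (ζ ^ 4 * a) q =
      poch (a ^ 5) (q ^ 5) := by
  have hqm : ‖q ^ 5‖ < 1 := by rw [norm_pow]; exact pow_lt_one₀ (norm_nonneg _) hq (by norm_num)
  refine tendsto_nhds_unique
    (((((tendsto_poch hq a).mul (tendsto_poch hq (ζ * a))).mul (tendsto_poch hq (ζ ^ 2 * a))).mul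
      (tendsto_poch hq (ζ ^ 3 * a))).mul (tendsto_poch hq (ζ ^ 4 * a)))
    ((tendsto_poch hqm (a ^ 5)).congr fun N => ?_)
  simp only [← Finset.prod_mul_distrib]
  refine Finset.prod_congr rfl fun k _ => ?_
  generalize hx : a * q ^ k = x
  have h1 : (1 - ζ * x) * (1 - ζ ^ 4 * x) = 1 - (ζ + ζ ^ 4) * x + x ^ 2 := by
    linear_combination x ^ 2 * h5
  have h2 : (1 - ζ ^ 2 * x) * (1 - ζ ^ 3 * x) = 1 + (1 + ζ + ζ ^ 4) * x + x ^ 2 := by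
    linear_combination x ^ 2 * h5 - x * hs
  have h3 : (ζ + ζ ^ 4) * (1 + ζ + ζ ^ 4) = 1 := by
    linear_combination (ζ ^ 3 + 2) * h5 + hs
  calc 1 - a ^ 5 * (q ^ 5) ^ k = 1 - x ^ 5 := by rw [← hx]; ring
    _ = (1 - x) * ((1 - ζ * x) * (1 - ζ ^ 4 * x)) * ((1 - ζ ^ 2 * x) * (1 - ζ ^ 3 * x)) := by
      rw [h1, h2]
      linear_combination (1 - x) * x ^ 2 * h3
    _ = _ := by rw [← hx]; ring

end poch

lemma _root_.HasSum.of_eq {ι : Type*} {f g : ι → ℂ} {a b : ℂ} (h : HasSum f a) (hf : ∀ i, g i = f i)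
    (hab : b = a) : HasSum g b := by
  rw [hab, funext hf]
  exact h

/-! ### Summability of theta-type series -/

lemma summable_pow_mul_zpow_sq {r B : ℝ} (hr0 : 0 < r) (hr : r < 1) (hB : 0 < B) (k : ℕ) :
    Summable fun n : ℤ => (|n| ^ k : ℝ) * (r ^ (n ^ 2) * B ^ |n|) := by
  have hT : 0 < -Real.log r / Real.pi := div_pos (neg_pos.2 (Real.log_neg hr0 hr)) Real.pi_pos
  refine (summable_pow_mul_jacobiTheta₂_term_bound (Real.log B / (2 * Real.pi)) hT k).congr
    fun n => ?_
  congr 1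
  rw [← Real.rpow_intCast, ← Real.rpow_intCast, Real.rpow_def_of_pos hr0, Real.rpow_def_of_pos hB,
    ← Real.exp_add]
  congr 1
  have := Real.pi_ne_zero
  push_cast
  field_simp
  ring

lemma zpow_le_max_zpow_abs {y : ℝ} (hy : 0 < y) (n : ℤ) : y ^ n ≤ max y y⁻¹ ^ |n| := by
  obtain ⟨m, rfl | rfl⟩ := n.eq_nat_or_neg
  · rw [abs_of_nonneg (Int.natCast_nonneg m), zpow_natCast, zpow_natCast]
    exact pow_le_pow_left₀ hy.le (le_max_left _ _) m
  · rw [abs_neg, abs_of_nonneg (Int.natCast_nonneg m), zpow_neg, ← inv_zpow, zpow_natCast,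
      zpow_natCast]
    exact pow_le_pow_left₀ (inv_nonneg.2 hy.le) (le_max_right _ _) m

lemma summable_norm_zpow_sq_mul {w x : ℂ} (hw0 : w ≠ 0) (hw : ‖w‖ < 1) (hx : x ≠ 0) :
    Summable fun n : ℤ => ‖w ^ (n ^ 2) * x ^ n‖ := by
  have hw' : 0 < ‖w‖ := norm_pos_iff.2 hw0
  have hx' : 0 < ‖x‖ := norm_pos_iff.2 hx
  refine Summable.of_nonneg_of_le (fun _ => norm_nonneg _) (fun n => ?_)
    (summable_pow_mul_zpow_sq hw' hw (lt_max_of_lt_left hx' : 0 < max ‖x‖ ‖x‖⁻¹) 0)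
  rw [pow_zero, one_mul, norm_mul, norm_zpow, norm_zpow]
  exact mul_le_mul_of_nonneg_left (zpow_le_max_zpow_abs hx' n) (zpow_nonneg (norm_nonneg _) _)

lemma summable_norm_theta_term {w x : ℂ} (hw0 : w ≠ 0) (hw : ‖w‖ < 1) (hx : x ≠ 0) :
    Summable fun n : ℤ => ‖(-1) ^ n * w ^ (n * (n - 1)) * x ^ n‖ := by
  refine (summable_norm_zpow_sq_mul hw0 hw (mul_ne_zero (neg_ne_zero.2 (inv_ne_zero hw0)) hx)).congr
    fun n => ?_
  rw [show n * (n - 1) = n ^ 2 - n by ring, zpow_sub₀ hw0, mul_zpow, ← neg_one_mul, mul_zpow,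
    inv_zpow]
  congr 1
  ring

/-! ### The theta function and Jacobi's triple product -/

/-- The theta function `(x, p/x, p; p)_∞`. -/
noncomputable def th (x p : ℂ) : ℂ := poch x p * poch (p / x) p * poch p p

section th

variable {p : ℂ} (hp : ‖p‖ < 1)

lemma th_div (hp0 : p ≠ 0) (x : ℂ) : th (p / x) p = th x p := by
  rw [th, th, div_div_cancel₀ hp0, mul_comm (poch (p / x) p)]

include hp

lemma th_mul (hp0 : p ≠ 0) {x : ℂ} (hx : x ≠ 0) : th (p * x) p = -x⁻¹ * th x p := by
  have h2 : poch x⁻¹ p = (1 - x⁻¹) * poch (p / x) p := by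
    rw [poch_succ hp, mul_comm x⁻¹ p, ← div_eq_mul_inv]
  rw [th, th, show p / (p * x) = x⁻¹ by field_simp, h2, poch_succ hp x, mul_comm p x]
  field_simp
  ring

lemma th_inv (hp0 : p ≠ 0) {x : ℂ} (hx : x ≠ 0) : th x⁻¹ p = -x⁻¹ * th x p := by
  rw [← th_div hp0, div_inv_eq_mul, th_mul hp hp0 hx]

lemma th_one : th 1 p = 0 := by
  rw [th, poch_succ hp]
  simp

lemma th_ne_zero (hp0 : p ≠ 0) {x : ℂ} (hx : x ≠ 0) (h : ∀ n : ℤ, x * p ^ n ≠ 1) : th x p ≠ 0 := by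
  refine mul_ne_zero (mul_ne_zero (poch_ne_zero hp fun n => ?_) (poch_ne_zero hp fun n => ?_))
    (poch_ne_zero_of_norm_lt hp hp)
  · exact_mod_cast h n
  · intro hn
    apply h (-(n + 1 : ℤ))
    have : p ^ (n + 1) = x := by rw [pow_succ]; field_simp at hn; linear_combination hn
    rw [zpow_neg, ← this]
    exact mul_inv_cancel₀ (pow_ne_zero _ hp0)

lemma differentiableAt_th {x : ℂ} (hx : x ≠ 0) : DifferentiableAt ℂ (fun x => th x p) x := by
  unfold th
  have h1 := differentiable_poch hp x
  have h2 : DifferentiableAt ℂ (fun x => poch (p / x) p) x :=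
    (differentiable_poch hp (p / x)).comp x (f := fun x => p / x)
      (by fun_prop (disch := assumption))
  exact (h1.mul h2).mul_const _

end th

/-- The reciprocal of `(p; p)_k`, extended by `0` to negative `k`. -/
private noncomputable def invPoch (p : ℂ) (k : ℤ) : ℂ :=
  if k < 0 then 0 else (∏ i ∈ Finset.range k.toNat, (1 - p * p ^ i))⁻¹

lemma one_sub_mul_pow_ne_zero {q x : ℂ} (hq : ‖q‖ < 1) (hx : ‖x‖ < 1) (i : ℕ) :
    1 - x * q ^ i ≠ 0 := fun h => by
  have h1 : ‖x * q ^ i‖ < 1 := by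
    rw [norm_mul, norm_pow]
    exact mul_lt_one_of_nonneg_of_lt_one_left (norm_nonneg _) hx (pow_le_one₀ (norm_nonneg _) hq.le)
  rw [← sub_eq_zero.1 h, norm_one] at h1
  exact h1.false

private lemma invPoch_sub_one {p : ℂ} (hp0 : p ≠ 0) (hp : ‖p‖ < 1) (k : ℤ) :
    invPoch p (k - 1) = (1 - p ^ k) * invPoch p k := by
  rcases lt_trichotomy k 0 with hk | rfl | hk
  · simp [invPoch, hk, show k - 1 < 0 by lia]
  · simp [invPoch]
  · obtain ⟨m, rfl⟩ : ∃ m : ℕ, k = m + 1 := ⟨(k - 1).toNat, by lia⟩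
    have := one_sub_mul_pow_ne_zero hp hp m
    rw [invPoch, invPoch, if_neg (by lia), if_neg (by lia)]
    rw [show ((m : ℤ) + 1 - 1).toNat = m by lia, show ((m : ℤ) + 1).toNat = m + 1 by lia,
      Finset.prod_range_succ, mul_inv, show p ^ ((m : ℤ) + 1) = p * p ^ m by
        rw [zpow_add₀ hp0]; simp [mul_comm]]
    field_simp

private lemma hasSum_finite_triple {w x : ℂ} (hw0 : w ≠ 0) (hw : ‖w ^ 2‖ < 1) (hx : x ≠ 0) (N : ℕ) :
    HasSum (fun n : ℤ => (∏ i ∈ Finset.range (2 * N), (1 - w ^ 2 * (w ^ 2) ^ i)) *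
        invPoch (w ^ 2) (N + n) * invPoch (w ^ 2) (N - n) * ((-1) ^ n * w ^ (n * (n - 1)) * x ^ n))
      ((∏ k ∈ Finset.range N, (1 - x * (w ^ 2) ^ k)) *
        ∏ k ∈ Finset.range N, (1 - w ^ 2 / x * (w ^ 2) ^ k)) := by
  have hp0 : w ^ 2 ≠ 0 := pow_ne_zero _ hw0
  induction N with
  | zero =>
    refine (hasSum_single (0 : ℤ) fun n hn => ?_).of_eq (fun _ => rfl) ?_
    · rcases lt_or_gt_of_ne hn with h | h
      · simp [invPoch, h]
      · simp [invPoch, h]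
    · simp [invPoch]
  | succ N ih =>
    set D := ∏ i ∈ Finset.range (2 * N), (1 - w ^ 2 * (w ^ 2) ^ i) with hD
    set T := (∏ k ∈ Finset.range N, (1 - x * (w ^ 2) ^ k)) *
        ∏ k ∈ Finset.range N, (1 - w ^ 2 / x * (w ^ 2) ^ k) with hT
    have h1 := ih.mul_left (1 + w ^ (4 * N + 2))
    have h2 := ((Equiv.subRight (1 : ℤ)).hasSum_iff.2 ih).mul_left (-(x * w ^ (2 * N)))
    have h3 := ((Equiv.addRight (1 : ℤ)).hasSum_iff.2 ih).mul_left (-(w ^ (2 * N + 2) / x))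
    refine ((h1.add h2).add h3).of_eq (fun n => ?_) ?_
    · simp only [Function.comp, Equiv.subRight_apply, Equiv.coe_addRight]
      have e1 := invPoch_sub_one hp0 hw (N + 1 + n)
      have e2 := invPoch_sub_one hp0 hw (N + 1 - n)
      have e3 := invPoch_sub_one hp0 hw (N + n)
      have e4 := invPoch_sub_one hp0 hw (N - n)
      rw [show (N : ℤ) + 1 + n - 1 = N + n by ring] at e1
      rw [show (N : ℤ) + 1 - n - 1 = N - n by ring] at e2
      rw [show ((N + 1 : ℕ) : ℤ) + n = N + 1 + n by push_cast; ring,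
        show ((N + 1 : ℕ) : ℤ) - n = N + 1 - n by push_cast; ring,
        show (N : ℤ) + (n - 1) = N + n - 1 by ring, show (N : ℤ) - (n - 1) = N + 1 - n by ring,
        show (N : ℤ) + (n + 1) = N + 1 + n by ring, show (N : ℤ) - (n + 1) = N - n - 1 by ring,
        e3, e4, e1, e2]
      rw [show 2 * (N + 1) = 2 * N + 1 + 1 by ring, Finset.prod_range_succ, Finset.prod_range_succ,
        ← hD]
      generalize invPoch (w ^ 2) (N + 1 + n) = a
      generalize invPoch (w ^ 2) (N + 1 - n) = b
      have f1 : (w ^ 2) ^ ((N : ℤ) + 1 + n) = w ^ (2 * N + 2) * (w ^ n) ^ 2 := by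
        rw [zpow_add₀ hp0, zpow_add₀ hp0, ← zpow_natCast w (2 * N + 2), ← zpow_natCast w 2,
          ← zpow_mul, ← zpow_mul, ← zpow_mul, ← zpow_natCast, ← zpow_mul, ← zpow_add₀ hw0,
          ← zpow_add₀ hw0, ← zpow_add₀ hw0]
        congr 1; push_cast; ring
      have f2 : (w ^ 2) ^ ((N : ℤ) + 1 - n) = w ^ (2 * N + 2) * (w ^ n)⁻¹ ^ 2 := by
        rw [← zpow_neg, zpow_sub₀ hp0, zpow_add₀ hp0, ← zpow_natCast w (2 * N + 2),
          ← zpow_natCast w 2, ← zpow_mul, ← zpow_mul, ← zpow_mul, ← zpow_natCast, ← zpow_mul,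
          ← zpow_add₀ hw0, ← zpow_sub₀ hw0, ← zpow_add₀ hw0]
        congr 1; push_cast; ring
      have f3 : (w ^ 2) ^ ((N : ℤ) + n) = w ^ (2 * N) * (w ^ n) ^ 2 := by
        rw [zpow_add₀ hp0, ← zpow_natCast w (2 * N), ← zpow_natCast w 2, ← zpow_mul, ← zpow_mul,
          ← zpow_natCast, ← zpow_mul, ← zpow_add₀ hw0, ← zpow_add₀ hw0]
        congr 1; push_cast; ring
      have f4 : (w ^ 2) ^ ((N : ℤ) - n) = w ^ (2 * N) * (w ^ n)⁻¹ ^ 2 := by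
        rw [← zpow_neg, zpow_sub₀ hp0, ← zpow_natCast w (2 * N), ← zpow_natCast w 2, ← zpow_mul,
          ← zpow_mul, ← zpow_natCast, ← zpow_mul, ← zpow_sub₀ hw0, ← zpow_add₀ hw0]
        congr 1; push_cast; ring
      have g1 : w ^ ((n - 1) * (n - 1 - 1)) = w ^ (n * (n - 1)) * (w ^ n)⁻¹ ^ 2 * w ^ 2 := by
        rw [← zpow_neg, ← zpow_natCast w 2, ← zpow_natCast _ 2, ← zpow_mul, ← zpow_add₀ hw0,
          ← zpow_add₀ hw0]
        congr 1; push_cast; ring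
      have g2 : w ^ ((n + 1) * (n + 1 - 1)) = w ^ (n * (n - 1)) * (w ^ n) ^ 2 := by
        rw [← zpow_natCast _ 2, ← zpow_mul, ← zpow_add₀ hw0]
        congr 1; push_cast; ring
      have g3 : (-1 : ℂ) ^ (n - 1) = -(-1) ^ n := by
        rw [zpow_sub₀ (by norm_num)]; simp [div_neg]
      have g4 : (-1 : ℂ) ^ (n + 1) = -(-1) ^ n := by
        rw [zpow_add₀ (by norm_num)]; simp
      have g5 : x ^ (n - 1) = x ^ n / x := by rw [zpow_sub₀ hx]; simp
      have g6 : x ^ (n + 1) = x ^ n * x := by rw [zpow_add₀ hx]; simp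
      have hwn : w ^ n ≠ 0 := zpow_ne_zero _ hw0
      rw [f1, f2, f3, f4, g1, g2, g3, g4, g5, g6]
      generalize w ^ n = v at *
      generalize w ^ (n * (n - 1)) = c
      generalize x ^ n = y
      generalize (-1 : ℂ) ^ n = s
      field_simp
      ring
    · rw [Finset.prod_range_succ, Finset.prod_range_succ, hT]
      field_simp
      ring

private lemma norm_invPoch_le {p : ℂ} (hp : ‖p‖ < 1) : ∃ C : ℝ, 0 < C ∧ ∀ k, ‖invPoch p k‖ ≤ C := by
  obtain ⟨C, hC, h⟩ := exists_norm_prod_inv_le (a := p) hp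
    (fun n => (sub_ne_zero.1 (one_sub_mul_pow_ne_zero hp hp n)).symm)
  refine ⟨C, hC, fun k => ?_⟩
  unfold invPoch
  split_ifs
  · simpa using hC.le
  · exact h _

private lemma tendsto_invPoch {p : ℂ} (hp : ‖p‖ < 1) {f : ℕ → ℤ} (hf : Tendsto f atTop atTop) :
    Tendsto (fun N => invPoch p (f N)) atTop (𝓝 (poch p p)⁻¹) := by
  have h1 := ((tendsto_poch hp p).inv₀ (poch_ne_zero_of_norm_lt hp hp)).comp
    ((tendsto_atTop_atTop_of_monotone (fun a b hab => Int.toNat_le_toNat hab)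
      fun b => ⟨(b : ℤ), (Int.toNat_natCast b).ge⟩).comp hf)
  refine h1.congr' ?_
  filter_upwards [hf.eventually_ge_atTop 0] with N hN
  simp [invPoch, hN]

/-- Jacobi's triple product identity. -/
theorem hasSum_th {w x : ℂ} (hw0 : w ≠ 0) (hw : ‖w‖ < 1) (hx : x ≠ 0) :
    HasSum (fun n : ℤ => (-1) ^ n * w ^ (n * (n - 1)) * x ^ n) (th x (w ^ 2)) := by
  have hp : ‖w ^ 2‖ < 1 := by rw [norm_pow]; exact pow_lt_one₀ (norm_nonneg _) hw (by simp)
  have hs := summable_norm_theta_term hw0 hw hx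
  have hE := poch_ne_zero_of_norm_lt hp hp
  obtain ⟨C, hC, hC'⟩ := norm_invPoch_le hp
  obtain ⟨B, hB, hB'⟩ := exists_norm_prod_le hp (w ^ 2)
  have hcast : Tendsto (fun N : ℕ => (N : ℤ)) atTop atTop := tendsto_natCast_atTop_atTop
  have h1 : Tendsto (fun N : ℕ => ∑' n : ℤ,
      (∏ i ∈ Finset.range (2 * N), (1 - w ^ 2 * (w ^ 2) ^ i)) *
        invPoch (w ^ 2) (N + n) * invPoch (w ^ 2) (N - n) * ((-1) ^ n * w ^ (n * (n - 1)) * x ^ n))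
      atTop (𝓝 (∑' n : ℤ, poch (w ^ 2) (w ^ 2) * (poch (w ^ 2) (w ^ 2))⁻¹ *
        (poch (w ^ 2) (w ^ 2))⁻¹ * ((-1) ^ n * w ^ (n * (n - 1)) * x ^ n))) := by
    refine tendsto_tsum_of_dominated_convergence (hs.mul_left (B * C * C)) (fun n => ?_)
      (.of_forall fun N n => ?_)
    · refine (((tendsto_poch hp _).comp (tendsto_id.const_mul_atTop' two_pos)).mul
        (tendsto_invPoch hp (tendsto_atTop_add_const_right _ n hcast))).mul
        (tendsto_invPoch hp ?_) |>.mul_const _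
      simpa [sub_eq_add_neg] using tendsto_atTop_add_const_right _ (-n) hcast
    · rw [norm_mul, norm_mul, norm_mul]
      gcongr
      exacts [hB' _, hC' _, hC' _]
  have h2 := (tendsto_poch hp x).mul (tendsto_poch hp (w ^ 2 / x))
  have h3 := tendsto_nhds_unique
    (h1.congr fun N => (hasSum_finite_triple hw0 hp hx N).tsum_eq) h2
  rw [mul_inv_cancel₀ hE, one_mul, tsum_mul_left] at h3
  refine hs.of_norm.hasSum.of_eq (fun _ => rfl) ?_
  rw [th, ← h3]
  field_simp

/-! ### Dissection of theta functions modulo 5 -/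

lemma hasSum_of_hasSum_mod_five {f : ℤ → ℂ} {a : Fin 5 → ℂ}
    (h : ∀ r : Fin 5, HasSum (fun m : ℤ => f (5 * m + (r : ℕ))) (a r)) : HasSum f (∑ r, a r) := by
  have key : ∀ r : Fin 5, HasSum (fun n : ℤ => if n % 5 = (r : ℕ) then f n else 0) (a r) := by
    intro r
    have hinj : Function.Injective fun m : ℤ => 5 * m + ((r : ℕ) : ℤ) := fun x y hxy => by
      simpa using hxy
    refine (hinj.hasSum_iff fun n hn => ?_).1 ((h r).of_eq (fun m => ?_) rfl)
    · rw [if_neg]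
      rintro h5
      exact hn ⟨n / 5, by simp only; lia⟩
    · simp only [Function.comp]
      rw [if_pos]
      have := r.2
      lia
  refine (hasSum_sum fun r _ => key r).of_eq (fun n => ?_) rfl
  obtain ⟨r, hr⟩ : ∃ r : Fin 5, n % 5 = (r : ℕ) := ⟨⟨(n % 5).toNat, by lia⟩, by simp only; lia⟩
  rw [Finset.sum_eq_single r, if_pos hr]
  · intro b _ hb
    rw [if_neg]
    rintro h5
    exact hb (Fin.ext (by lia))
  · simp

lemma th_dissect {s x : ℂ} (hs0 : s ≠ 0) (hs : ‖s‖ < 1) (hx : x ≠ 0) :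
    th x (s ^ 2) = th (x ^ 5 * s ^ 20) (s ^ 50) - x * th (x ^ 5 * s ^ 30) (s ^ 50)
      + x ^ 2 * s ^ 2 * th (x ^ 5 * s ^ 40) (s ^ 50) - x ^ 3 * s ^ 6 * th (x ^ 5 * s ^ 50) (s ^ 50)
      + x ^ 4 * s ^ 12 * th (x ^ 5 * s ^ 60) (s ^ 50) := by
  have hw0 : s ^ 25 ≠ 0 := pow_ne_zero _ hs0
  have hw : ‖s ^ 25‖ < 1 := by rw [norm_pow]; exact pow_lt_one₀ (norm_nonneg _) hs (by simp)
  have h : ∀ r : Fin 5, HasSum (fun m : ℤ => (-1) ^ (5 * m + (r : ℕ)) *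
      s ^ ((5 * m + (r : ℕ)) * (5 * m + (r : ℕ) - 1)) * x ^ (5 * m + (r : ℕ)))
      ((-x) ^ (r : ℕ) * s ^ ((r : ℤ) * (r - 1)) *
        th (x ^ 5 * s ^ (20 + 10 * (r : ℕ))) ((s ^ 25) ^ 2)) := by
    intro r
    refine ((hasSum_th hw0 hw (x := x ^ 5 * s ^ (20 + 10 * (r : ℕ)))
      (mul_ne_zero (pow_ne_zero _ hx) (pow_ne_zero _ hs0))).mul_left
        ((-x) ^ (r : ℕ) * s ^ ((r : ℤ) * (r - 1)))).of_eq (fun m => ?_) rfl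
    generalize (r : ℕ) = k
    have e1 : (-1 : ℂ) ^ (5 * m + k : ℤ) = (-1) ^ m * (-1) ^ k := by
      rw [zpow_add₀ (by norm_num), zpow_mul, zpow_natCast]
      norm_num
    have e2 : s ^ ((5 * m + k) * (5 * m + k - 1) : ℤ) = s ^ ((k : ℤ) * (k - 1)) *
        ((s ^ 25) ^ (m * (m - 1)) * (s ^ (20 + 10 * k)) ^ m) := by
      simp only [← zpow_natCast, ← zpow_mul, ← zpow_add₀ hs0]
      congr 1
      push_cast
      ring
    have e3 : x ^ (5 * m + k : ℤ) = (x ^ 5) ^ m * x ^ k := by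
      rw [zpow_add₀ hx, zpow_mul, zpow_natCast]
      norm_cast
    rw [e1, e2, e3, mul_zpow, neg_pow x]
    ring
  rw [(hasSum_th hs0 hs hx).unique (hasSum_of_hasSum_mod_five h)]
  simp only [Fin.sum_univ_five, ← pow_mul]
  norm_num
  ring

/-! ### Weierstrass' three-term relation -/

private noncomputable def thEven (w y : ℂ) : ℂ := ∑' k : ℤ, w ^ (2 * k ^ 2) * y ^ (2 * k)

private noncomputable def thOdd (w y : ℂ) : ℂ :=
  ∑' k : ℤ, w ^ (2 * k ^ 2 + 2 * k) * y ^ (2 * k + 1)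

private lemma summable_norm_thEven {w y : ℂ} (hw0 : w ≠ 0) (hw : ‖w‖ < 1) (hy : y ≠ 0) :
    Summable fun k : ℤ => ‖w ^ (2 * k ^ 2) * y ^ (2 * k)‖ := by
  have hp : ‖w ^ 2‖ < 1 := by rw [norm_pow]; exact pow_lt_one₀ (norm_nonneg _) hw (by simp)
  refine (summable_norm_zpow_sq_mul (pow_ne_zero 2 hw0) hp (pow_ne_zero 2 hy)).congr fun k => ?_
  rw [zpow_mul, zpow_mul y]
  norm_cast

private lemma summable_norm_thOdd {w y : ℂ} (hw0 : w ≠ 0) (hw : ‖w‖ < 1) (hy : y ≠ 0) :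
    Summable fun k : ℤ => ‖w ^ (2 * k ^ 2 + 2 * k) * y ^ (2 * k + 1)‖ := by
  have hwy : w * y ≠ 0 := mul_ne_zero hw0 hy
  refine ((summable_norm_thEven hw0 hw hwy).mul_right ‖y‖).congr fun k => ?_
  rw [← norm_mul, zpow_add₀ hw0, mul_zpow, zpow_add₀ hy, zpow_one]
  congr 1
  ring

private lemma theta_term_mul_even {w x y : ℂ} (hw0 : w ≠ 0) (hx : x ≠ 0) (hy : y ≠ 0) (k l : ℤ) :
    x⁻¹ * ((-1) ^ (k + 1 + l) * w ^ ((k + 1 + l) * (k + 1 + l - 1)) * (x * y) ^ (k + 1 + l) *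
      ((-1) ^ (k + 1 - l) * w ^ ((k + 1 - l) * (k + 1 - l - 1)) * (x / y) ^ (k + 1 - l))) =
    w ^ (2 * k ^ 2 + 2 * k) * x ^ (2 * k + 1) * (w ^ (2 * l ^ 2) * y ^ (2 * l)) := by
  have e1 : (-1 : ℂ) ^ (k + 1 + l) * (-1) ^ (k + 1 - l) = 1 := by
    rw [← zpow_add₀ (by norm_num), show k + 1 + l + (k + 1 - l) = 2 * (k + 1) by ring, zpow_mul]
    norm_num
  have e2 : w ^ ((k + 1 + l) * (k + 1 + l - 1)) * w ^ ((k + 1 - l) * (k + 1 - l - 1)) =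
      w ^ (2 * k ^ 2 + 2 * k) * w ^ (2 * l ^ 2) := by
    rw [← zpow_add₀ hw0, ← zpow_add₀ hw0]
    congr 1
    ring
  have e3 : x⁻¹ * ((x * y) ^ (k + 1 + l) * (x / y) ^ (k + 1 - l)) =
      x ^ (2 * k + 1) * y ^ (2 * l) := by
    rw [mul_zpow, div_zpow, ← zpow_neg_one, div_eq_mul_inv, ← zpow_neg y]
    calc _ = (x ^ (-1 : ℤ) * x ^ (k + 1 + l) * x ^ (k + 1 - l)) *
        (y ^ (k + 1 + l) * y ^ (-(k + 1 - l))) := by ring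
      _ = _ := by
        rw [← zpow_add₀ hx, ← zpow_add₀ hx, ← zpow_add₀ hy]
        congr 2 <;> ring
  calc _ = ((-1 : ℂ) ^ (k + 1 + l) * (-1) ^ (k + 1 - l)) *
        (w ^ ((k + 1 + l) * (k + 1 + l - 1)) * w ^ ((k + 1 - l) * (k + 1 - l - 1))) *
        (x⁻¹ * ((x * y) ^ (k + 1 + l) * (x / y) ^ (k + 1 - l))) := by ring
    _ = _ := by rw [e1, e2, e3]; ring

private lemma theta_term_mul_odd {w x y : ℂ} (hw0 : w ≠ 0) (hx : x ≠ 0) (hy : y ≠ 0) (k l : ℤ) :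
    x⁻¹ * ((-1) ^ (k + l + 1) * w ^ ((k + l + 1) * (k + l + 1 - 1)) * (x * y) ^ (k + l + 1) *
      ((-1) ^ (k - l) * w ^ ((k - l) * (k - l - 1)) * (x / y) ^ (k - l))) =
    -(w ^ (2 * k ^ 2) * x ^ (2 * k) * (w ^ (2 * l ^ 2 + 2 * l) * y ^ (2 * l + 1))) := by
  have e1 : (-1 : ℂ) ^ (k + l + 1) * (-1) ^ (k - l) = -1 := by
    rw [← zpow_add₀ (by norm_num), show k + l + 1 + (k - l) = 2 * k + 1 by ring,
      zpow_add₀ (by norm_num), zpow_mul]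
    norm_num
  have e2 : w ^ ((k + l + 1) * (k + l + 1 - 1)) * w ^ ((k - l) * (k - l - 1)) =
      w ^ (2 * k ^ 2) * w ^ (2 * l ^ 2 + 2 * l) := by
    rw [← zpow_add₀ hw0, ← zpow_add₀ hw0]
    congr 1
    ring
  have e3 : x⁻¹ * ((x * y) ^ (k + l + 1) * (x / y) ^ (k - l)) =
      x ^ (2 * k) * y ^ (2 * l + 1) := by
    rw [mul_zpow, div_zpow, ← zpow_neg_one, div_eq_mul_inv, ← zpow_neg y]
    calc _ = (x ^ (-1 : ℤ) * x ^ (k + l + 1) * x ^ (k - l)) *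
        (y ^ (k + l + 1) * y ^ (-(k - l))) := by ring
      _ = _ := by
        rw [← zpow_add₀ hx, ← zpow_add₀ hx, ← zpow_add₀ hy]
        congr 2 <;> ring
  calc _ = ((-1 : ℂ) ^ (k + l + 1) * (-1) ^ (k - l)) *
        (w ^ ((k + l + 1) * (k + l + 1 - 1)) * w ^ ((k - l) * (k - l - 1))) *
        (x⁻¹ * ((x * y) ^ (k + l + 1) * (x / y) ^ (k - l))) := by ring
    _ = _ := by rw [e1, e2, e3]; ring

private lemma hasSum_of_parity {F : ℤ × ℤ → ℂ} {a b : ℂ}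
    (ha : HasSum (fun z : ℤ × ℤ => F (z.1 + 1 + z.2, z.1 + 1 - z.2)) a)
    (hb : HasSum (fun z : ℤ × ℤ => F (z.1 + z.2 + 1, z.1 - z.2)) b) : HasSum F (a + b) := by
  have i1 : Function.Injective fun z : ℤ × ℤ => (z.1 + 1 + z.2, z.1 + 1 - z.2) := by
    rintro ⟨a, b⟩ ⟨c, d⟩ hz
    simp only [Prod.mk.injEq] at hz ⊢
    lia
  have i2 : Function.Injective fun z : ℤ × ℤ => (z.1 + z.2 + 1, z.1 - z.2) := by
    rintro ⟨a, b⟩ ⟨c, d⟩ hz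
    simp only [Prod.mk.injEq] at hz ⊢
    lia
  have hc : IsCompl (Set.range fun z : ℤ × ℤ => (z.1 + 1 + z.2, z.1 + 1 - z.2))
      (Set.range fun z : ℤ × ℤ => (z.1 + z.2 + 1, z.1 - z.2)) := by
    refine ⟨Set.disjoint_left.2 ?_, codisjoint_iff.2 (Set.eq_univ_of_forall ?_)⟩
    · rintro _ ⟨⟨a, b⟩, rfl⟩ ⟨⟨c, d⟩, hz⟩
      simp only [Prod.mk.injEq] at hz
      lia
    · rintro ⟨a, b⟩
      rcases Int.even_or_odd' (a + b) with ⟨c, hc | hc⟩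
      · exact Or.inl ⟨(c - 1, a - c), by simp only [Prod.mk.injEq]; lia⟩
      · exact Or.inr ⟨(c, a - c - 1), by simp only [Prod.mk.injEq]; lia⟩
  have h1 := i1.hasSum_range_iff.2 ha
  have h2 := i2.hasSum_range_iff.2 hb
  exact h1.add_isCompl hc h2

private lemma hasSum_mul_of_summable_norm {f g : ℤ → ℂ} {a b : ℂ} (hf : Summable fun n => ‖f n‖)
    (hg : Summable fun n => ‖g n‖) (ha : HasSum f a) (hb : HasSum g b) :
    HasSum (fun z : ℤ × ℤ => f z.1 * g z.2) (a * b) :=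
  ha.mul hb (summable_mul_of_summable_norm hf hg)

private lemma th_mul_th_eq {w x y : ℂ} (hw0 : w ≠ 0) (hw : ‖w‖ < 1) (hx : x ≠ 0) (hy : y ≠ 0) :
    x⁻¹ * (th (x * y) (w ^ 2) * th (x / y) (w ^ 2)) =
      thOdd w x * thEven w y - thEven w x * thOdd w y := by
  have hxy := mul_ne_zero hx hy
  have hxy' := div_ne_zero hx hy
  have h := (hasSum_mul_of_summable_norm (summable_norm_theta_term hw0 hw hxy)
    (summable_norm_theta_term hw0 hw hxy') (hasSum_th hw0 hw hxy)
    (hasSum_th hw0 hw hxy')).mul_left x⁻¹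
  have he := hasSum_mul_of_summable_norm (summable_norm_thOdd hw0 hw hx)
    (summable_norm_thEven hw0 hw hy) (summable_norm_thOdd hw0 hw hx).of_norm.hasSum
    (summable_norm_thEven hw0 hw hy).of_norm.hasSum
  have ho := (hasSum_mul_of_summable_norm (summable_norm_thEven hw0 hw hx)
    (summable_norm_thOdd hw0 hw hy) (summable_norm_thEven hw0 hw hx).of_norm.hasSum
    (summable_norm_thOdd hw0 hw hy).of_norm.hasSum).neg
  rw [sub_eq_add_neg]
  refine h.unique (hasSum_of_parity (he.of_eq (fun z => ?_) rfl) (ho.of_eq (fun z => ?_) rfl))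
  · rw [theta_term_mul_even hw0 hx hy]
  · rw [theta_term_mul_odd hw0 hx hy]

/-- Weierstrass' three-term relation for the theta function. -/
theorem th_weierstrass {w x y u v : ℂ} (hw0 : w ≠ 0) (hw : ‖w‖ < 1) (hx : x ≠ 0) (hy : y ≠ 0)
    (hu : u ≠ 0) (hv : v ≠ 0) :
    x⁻¹ * (th (x * y) (w ^ 2) * th (x / y) (w ^ 2)) *
        (u⁻¹ * (th (u * v) (w ^ 2) * th (u / v) (w ^ 2))) =
      x⁻¹ * (th (x * u) (w ^ 2) * th (x / u) (w ^ 2)) *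
        (y⁻¹ * (th (y * v) (w ^ 2) * th (y / v) (w ^ 2))) -
      x⁻¹ * (th (x * v) (w ^ 2) * th (x / v) (w ^ 2)) *
        (y⁻¹ * (th (y * u) (w ^ 2) * th (y / u) (w ^ 2))) := by
  rw [th_mul_th_eq hw0 hw hx hy, th_mul_th_eq hw0 hw hu hv, th_mul_th_eq hw0 hw hx hu,
    th_mul_th_eq hw0 hw hy hv, th_mul_th_eq hw0 hw hx hv, th_mul_th_eq hw0 hw hy hu]
  ring

/-! ### Logarithmic derivatives of theta functions -/

/-- The derivation `x d/dx` applied to the theta function. -/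
noncomputable def dth (x p : ℂ) : ℂ := x * deriv (fun x => th x p) x

section dth

variable {p : ℂ} (hp : ‖p‖ < 1)
include hp

lemma hasDerivAt_th {x : ℂ} (hx : x ≠ 0) : HasDerivAt (fun x => th x p) (dth x p / x) x := by
  rw [dth, mul_div_cancel_left₀ _ hx]
  exact (differentiableAt_th hp hx).hasDerivAt

lemma hasDerivAt_th_mul {c x : ℂ} (hc : c ≠ 0) (hx : x ≠ 0) :
    HasDerivAt (fun x => th (x * c) p) (dth (x * c) p / x) x := by
  refine ((hasDerivAt_th hp (mul_ne_zero hx hc)).comp x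
    ((hasDerivAt_id x).mul_const c)).congr_deriv ?_
  field_simp

lemma hasDerivAt_th_div {c x : ℂ} (hc : c ≠ 0) (hx : x ≠ 0) :
    HasDerivAt (fun x => th (c / x) p) (-dth (c / x) p / x) x := by
  refine ((hasDerivAt_th hp (div_ne_zero hc hx)).comp x
    ((hasDerivAt_inv hx).const_mul c)).congr_deriv ?_
  field_simp

lemma dth_div (hp0 : p ≠ 0) {x : ℂ} (hx : x ≠ 0) : dth (p / x) p = -dth x p := by
  have h := (hasDerivAt_th_div hp hp0 hx).unique
    ((hasDerivAt_th hp hx).congr_of_eventuallyEq (Eventually.of_forall fun y => th_div hp0 y))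
  field_simp at h
  linear_combination -h

lemma dth_inv (hp0 : p ≠ 0) {x : ℂ} (hx : x ≠ 0) : dth x⁻¹ p = x⁻¹ * (dth x p - th x p) := by
  have h := (hasDerivAt_th_div hp one_ne_zero hx).unique
    ((((hasDerivAt_inv hx).neg).mul (hasDerivAt_th hp hx)).congr_of_eventuallyEq
      ((eventually_ne_nhds hx).mono fun y hy => by
        simpa using th_inv hp hp0 hy))
  rw [one_div] at h
  simp only [Pi.neg_apply] at h
  field_simp at h ⊢
  linear_combination -h

lemma dth_mul (hp0 : p ≠ 0) {x : ℂ} (hx : x ≠ 0) :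
    dth (p * x) p = x⁻¹ * (th x p - dth x p) := by
  have h := (hasDerivAt_th_mul hp hp0 hx).unique
    ((((hasDerivAt_inv hx).neg).mul (hasDerivAt_th hp hx)).congr_of_eventuallyEq
      ((eventually_ne_nhds hx).mono fun y hy => by
        simpa [mul_comm y] using th_mul hp hp0 hy))
  rw [mul_comm x] at h
  simp only [Pi.neg_apply] at h
  field_simp at h ⊢
  linear_combination h

lemma dth_one : dth 1 p = -poch p p ^ 3 := by
  have hd : DifferentiableAt ℂ (fun x => poch (x * p) p * poch (p / x) p * poch p p) 1 :=
    ((((differentiable_poch hp).comp (differentiable_id.mul_const p)) 1).mul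
      ((differentiable_poch hp).differentiableAt.comp (1 : ℂ)
        ((differentiableAt_const p).div differentiableAt_id one_ne_zero))).mul_const _
  have h := (hasDerivAt_th hp one_ne_zero).unique
    ((((hasDerivAt_id (1 : ℂ)).const_sub 1).mul hd.hasDerivAt).congr_of_eventuallyEq
      (Eventually.of_forall fun y => by
        simp only [th, poch_succ hp y, id, Pi.mul_apply]
        ring))
  simp only [id, sub_self, zero_mul, add_zero, div_one, one_mul] at h
  rw [h]
  ring

/-- The differentiated three-term relation. -/
lemma dth_weierstrass (hp0 : p ≠ 0) {x u : ℂ} (hx : x ≠ 0) (hu : u ≠ 0) :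
    poch p p ^ 3 * x * th (x ^ 2) p * th u p ^ 2 =
      u * (2 * th (x * u) p * th (x / u) p * th x p * dth x p -
        th x p ^ 2 * (dth (x * u) p * th (x / u) p + th (x * u) p * dth (x / u) p)) := by
  obtain ⟨w, rfl⟩ : ∃ w, w ^ 2 = p := IsAlgClosed.exists_pow_nat_eq p (by norm_num)
  have hw0 : w ≠ 0 := by rintro rfl; simp at hp0
  have hw : ‖w‖ < 1 := by
    rw [norm_pow] at hp
    exact (pow_lt_one_iff_of_nonneg (norm_nonneg _) two_ne_zero).1 hp
  have key : ∀ᶠ y in 𝓝 x, y * (th (y * x) (w ^ 2) * th (x / y) (w ^ 2)) * th u (w ^ 2) ^ 2 =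
      u * (th (x * u) (w ^ 2) * th (x / u) (w ^ 2) * th y (w ^ 2) ^ 2 -
        th x (w ^ 2) ^ 2 * (th (y * u) (w ^ 2) * th (y / u) (w ^ 2))) := by
    filter_upwards [eventually_ne_nhds hx] with y hy
    have h := th_weierstrass hw0 hw hx hy hu one_ne_zero
    simp only [mul_one, div_one] at h
    field_simp at h
    rw [mul_comm y x]
    linear_combination h
  have h1 := (((hasDerivAt_id x).mul ((hasDerivAt_th_mul hp hx hx).mul
    (hasDerivAt_th_div hp hx hx))).mul_const (th u (w ^ 2) ^ 2)).congr_of_eventuallyEq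
    (key.mono fun y hy => hy.symm)
  have h2 := ((((hasDerivAt_th hp hx).pow 2).const_mul (th (x * u) (w ^ 2) * th (x / u)
      (w ^ 2))).sub
    (((hasDerivAt_th_mul hp hu hx).mul
      (hasDerivAt_th_mul hp (inv_ne_zero hu) hx)).const_mul (th x (w ^ 2) ^ 2))).const_mul u
  have h := h1.unique (h2.congr_of_eventuallyEq (Eventually.of_forall fun y => by
    simp only [Pi.sub_apply, Pi.mul_apply, Pi.pow_apply, div_eq_mul_inv]))
  simp only [div_self hx, dth_one hp, th_one hp, id, Pi.mul_apply, ← div_eq_mul_inv] at h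
  field_simp at h
  norm_num at h
  linear_combination h

end dth

/-! ### Theta functions at powers of a fifth root of the nome -/

section quintic

variable {Q : ℂ} (hQ0 : Q ≠ 0) (hQ : ‖Q‖ < 1)

include hQ in
lemma norm_pow_five_lt_one : ‖Q ^ 5‖ < 1 := by
  rw [norm_pow]
  exact pow_lt_one₀ (norm_nonneg _) hQ (by simp)

include hQ0 in
lemma th_pow_three : th (Q ^ 3) (Q ^ 5) = th (Q ^ 2) (Q ^ 5) := by
  rw [← th_div (pow_ne_zero 5 hQ0)]
  congr 1
  field_simp

include hQ0 in
lemma th_pow_four : th (Q ^ 4) (Q ^ 5) = th Q (Q ^ 5) := by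
  rw [← th_div (pow_ne_zero 5 hQ0)]
  congr 1
  field_simp

include hQ0 hQ

omit hQ0 in
lemma zpow_ne_one_of_ne_zero {n : ℤ} (hn : n ≠ 0) : Q ^ n ≠ 1 := by
  intro h
  have h' := congrArg norm h
  rw [norm_zpow, norm_one, zpow_eq_one_iff_right₀ (norm_nonneg _) hQ.ne] at h'
  exact hn h'

lemma th_pow_ne_zero {k : ℤ} (hk : ¬ 5 ∣ k) : th (Q ^ k) (Q ^ 5) ≠ 0 := by
  refine th_ne_zero (norm_pow_five_lt_one hQ) (pow_ne_zero 5 hQ0) (zpow_ne_zero _ hQ0) fun n => ?_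
  rw [← zpow_natCast, ← zpow_mul, ← zpow_add₀ hQ0]
  refine zpow_ne_one_of_ne_zero hQ ?_
  push_cast
  lia

lemma th_self_ne_zero : th Q (Q ^ 5) ≠ 0 := by
  simpa using th_pow_ne_zero hQ0 hQ (k := 1) (by norm_num)

lemma th_sq_ne_zero : th (Q ^ 2) (Q ^ 5) ≠ 0 := by
  exact_mod_cast th_pow_ne_zero hQ0 hQ (k := 2) (by norm_num)

lemma th_mul_th_sq :
    th Q (Q ^ 5) * th (Q ^ 2) (Q ^ 5) = poch Q Q * poch (Q ^ 5) (Q ^ 5) := by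
  rw [poch_split hQ Q 5 (by norm_num)]
  simp only [Finset.prod_range_succ, Finset.prod_range_zero, th]
  rw [show Q ^ 5 / Q = Q * Q ^ 3 by field_simp, show Q ^ 5 / Q ^ 2 = Q * Q ^ 2 by field_simp]
  ring_nf

lemma dth_pow_three : dth (Q ^ 3) (Q ^ 5) = -dth (Q ^ 2) (Q ^ 5) := by
  rw [← dth_div (norm_pow_five_lt_one hQ) (pow_ne_zero 5 hQ0) (pow_ne_zero 2 hQ0)]
  congr 1
  field_simp

lemma dth_pow_four : dth (Q ^ 4) (Q ^ 5) = -dth Q (Q ^ 5) := by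
  rw [← dth_div (norm_pow_five_lt_one hQ) (pow_ne_zero 5 hQ0) hQ0]
  congr 1
  field_simp

/-- The logarithmic derivative `x θ'(x) / θ(x)` at `x = Q ^ k`. -/
noncomputable def ell (k : ℕ) (Q : ℂ) : ℂ := dth (Q ^ k) (Q ^ 5) / th (Q ^ k) (Q ^ 5)

lemma three_mul_ell_one : 3 * ell 1 Q + ell 2 Q - 1 =
    -(poch (Q ^ 5) (Q ^ 5) ^ 3 * th (Q ^ 2) (Q ^ 5) ^ 2 / th Q (Q ^ 5) ^ 3) := by
  have hp := norm_pow_five_lt_one hQ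
  have hp0 := pow_ne_zero 5 hQ0
  have h1 := th_self_ne_zero hQ0 hQ
  have h2 := th_sq_ne_zero hQ0 hQ
  have h := dth_weierstrass hp hp0 hQ0 (inv_ne_zero (pow_ne_zero 2 hQ0))
  rw [show Q * (Q ^ 2)⁻¹ = Q⁻¹ by field_simp, show Q / (Q ^ 2)⁻¹ = Q ^ 3 by field_simp,
    th_inv hp hp0 hQ0, th_inv hp hp0 (pow_ne_zero 2 hQ0), dth_inv hp hp0 hQ0,
    th_pow_three hQ0, dth_pow_three hQ0 hQ] at h
  simp only [ell, pow_one]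
  generalize th Q (Q ^ 5) = a at *
  generalize th (Q ^ 2) (Q ^ 5) = b at *
  field_simp at h ⊢
  linear_combination h

lemma three_mul_ell_two : 3 * ell 2 Q - ell 1 Q =
    Q * (poch (Q ^ 5) (Q ^ 5) ^ 3 * th Q (Q ^ 5) ^ 2 / th (Q ^ 2) (Q ^ 5) ^ 3) := by
  have hp := norm_pow_five_lt_one hQ
  have hp0 := pow_ne_zero 5 hQ0
  have h1 := th_self_ne_zero hQ0 hQ
  have h2 := th_sq_ne_zero hQ0 hQ
  have h := dth_weierstrass hp hp0 (pow_ne_zero 2 hQ0) (inv_ne_zero (pow_ne_zero 4 hQ0))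
  rw [show Q ^ 2 * (Q ^ 4)⁻¹ = (Q ^ 2)⁻¹ by field_simp, show Q ^ 2 / (Q ^ 4)⁻¹ = Q ^ 5 * Q by
    field_simp,
    ← pow_mul, th_inv hp hp0 (pow_ne_zero 4 hQ0), th_inv hp hp0 (pow_ne_zero 2 hQ0),
    dth_inv hp hp0 (pow_ne_zero 2 hQ0), th_mul hp hp0 hQ0, dth_mul hp hp0 hQ0, th_pow_four hQ0] at h
  simp only [ell, pow_one]
  generalize th Q (Q ^ 5) = a at *
  generalize th (Q ^ 2) (Q ^ 5) = b at *
  generalize poch (Q ^ 5) (Q ^ 5) = c at *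
  field_simp at h ⊢
  linear_combination -h

end quintic

/-! ### Partial fractions of reciprocals of products of theta functions -/

lemma pow_eq_sum_partial_fraction {ι : Type*} [DecidableEq ι] {s : Finset ι} {b : ι → ℂ}
    (hb : ∀ i ∈ s, b i ≠ 0) (hinj : Set.InjOn b s) {m : ℕ} (hm : m < s.card) {y : ℂ}
    (hy : ∀ i ∈ s, 1 - y * b i ≠ 0) :
    y ^ m * (∏ i ∈ s, (1 - y * b i))⁻¹ =
      ∑ j ∈ s, (b j)⁻¹ ^ m * (∏ l ∈ s.erase j, (1 - b l / b j))⁻¹ * (1 - y * b j)⁻¹ := by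
  have hinj' : Set.InjOn (fun i => (b i)⁻¹) s := fun i hi j hj h => hinj hi hj (inv_injective h)
  have h := congrArg (Polynomial.eval y) (Lagrange.eq_interpolate (f := Polynomial.X ^ m) hinj'
    (by rw [Polynomial.degree_X_pow]; exact_mod_cast hm))
  simp only [Polynomial.eval_pow, Polynomial.eval_X, Lagrange.interpolate_apply,
    Polynomial.eval_finsetSum, Polynomial.eval_mul, Polynomial.eval_C, Lagrange.basis,
    Polynomial.eval_prod, Lagrange.basisDivisor, Polynomial.eval_sub] at h
  rw [h, Finset.sum_mul]
  refine Finset.sum_congr rfl fun j hj => ?_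
  have hbj := hb j hj
  have hpr : ∏ l ∈ s.erase j, (1 - y * b l) ≠ 0 :=
    Finset.prod_ne_zero_iff.2 fun l hl => hy l (Finset.mem_of_mem_erase hl)
  have e : ∏ l ∈ s.erase j, (((b j)⁻¹ - (b l)⁻¹)⁻¹ * (y - (b l)⁻¹)) =
      (∏ l ∈ s.erase j, (1 - b l / b j))⁻¹ * ∏ l ∈ s.erase j, (1 - y * b l) := by
    rw [← Finset.prod_inv_distrib, ← Finset.prod_mul_distrib]
    refine Finset.prod_congr rfl fun l hl => ?_
    have hbl := hb l (Finset.mem_of_mem_erase hl)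
    rw [show (b j)⁻¹ - (b l)⁻¹ = -((1 - b l / b j) * (b l)⁻¹) by field_simp; ring,
      show y - (b l)⁻¹ = -((1 - y * b l) * (b l)⁻¹) by field_simp; ring, inv_neg, mul_inv, inv_inv]
    field_simp
  rw [e, ← Finset.mul_prod_erase s _ hj, mul_inv]
  have := hy j hj
  field_simp

section

variable {w : ℂ} (hw0 : w ≠ 0)
include hw0

lemma prod_one_sub_mul_zpow_neg {z : ℂ} (hz : z ≠ 0) (r : ℕ) :
    ∏ k ∈ Finset.range r, (1 - z * (w ^ 2) ^ ((k : ℤ) - r)) =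
      (-z) ^ r * (w ^ (r * (r + 1)))⁻¹ * ∏ k ∈ Finset.range r, (1 - w ^ 2 / z * (w ^ 2) ^ k) := by
  have hp0 : w ^ 2 ≠ 0 := pow_ne_zero _ hw0
  induction r with
  | zero => simp
  | succ r ih =>
    rw [Finset.prod_range_succ', Finset.prod_range_succ]
    simp only [Nat.cast_add, Nat.cast_one, add_sub_add_right_eq_sub]
    rw [ih, Nat.cast_zero, zero_sub, zpow_neg,
      show (w ^ 2) ^ ((r : ℤ) + 1) = (w ^ 2) ^ (r + 1) by norm_cast,
      show (r + 1) * (r + 1 + 1) = r * (r + 1) + 2 * (r + 1) by ring, pow_add w, pow_mul w 2]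
    generalize ∏ k ∈ Finset.range r, (1 - w ^ 2 / z * (w ^ 2) ^ k) = A
    have := pow_ne_zero (r + 1) hp0
    rw [pow_succ (w ^ 2)] at this ⊢
    field_simp
    ring

lemma prod_one_sub_mul_zpow {z : ℂ} (hz : z ≠ 0) {r n : ℕ} (hr : r ≤ n) :
    ∏ k ∈ Finset.range n, (1 - z * (w ^ 2) ^ ((k : ℤ) - r)) =
      (-z) ^ r * (w ^ (r * (r + 1)))⁻¹ * ((∏ k ∈ Finset.range (n - r), (1 - z * (w ^ 2) ^ k)) *
        ∏ k ∈ Finset.range r, (1 - w ^ 2 / z * (w ^ 2) ^ k)) := by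
  obtain ⟨m, rfl⟩ := Nat.exists_eq_add_of_le hr
  rw [Finset.prod_range_add, prod_one_sub_mul_zpow_neg hw0 hz, Nat.add_sub_cancel_left]
  simp only [Nat.cast_add, add_sub_cancel_left, zpow_natCast]
  ring

lemma prod_erase_one_sub_zpow {r n : ℕ} (hr : r < n) :
    ∏ k ∈ (Finset.range n).erase r, (1 - (w ^ 2) ^ ((k : ℤ) - r)) =
      (-1) ^ r * (w ^ (r * (r + 1)))⁻¹ *
        ((∏ k ∈ Finset.range (n - r - 1), (1 - w ^ 2 * (w ^ 2) ^ k)) *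
        ∏ k ∈ Finset.range r, (1 - w ^ 2 * (w ^ 2) ^ k)) := by
  obtain ⟨m, rfl⟩ := Nat.exists_eq_add_of_lt hr
  have h1 := prod_one_sub_mul_zpow_neg hw0 one_ne_zero r
  simp only [one_mul, div_one] at h1
  have h : ∏ k ∈ (Finset.range (r + m + 1)).erase r, (1 - (w ^ 2) ^ ((k : ℤ) - r)) =
      ∏ k ∈ Finset.range (r + (m + 1)), if k = r then 1 else (1 - (w ^ 2) ^ ((k : ℤ) - r)) := by
    rw [← add_assoc, ← Finset.mul_prod_erase (Finset.range (r + m + 1)) _ (Finset.mem_range.2 hr),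
      if_pos rfl, one_mul]
    exact Finset.prod_congr rfl fun k hk => (if_neg (Finset.ne_of_mem_erase hk)).symm
  rw [h, Finset.prod_range_add, Finset.prod_range_succ' _ m, show r + m + 1 - r - 1 = m by lia,
    mul_comm (∏ k ∈ Finset.range m, (1 - w ^ 2 * (w ^ 2) ^ k)), ← mul_assoc ((-1) ^ r * _), ← h1]
  congr 1
  · refine Finset.prod_congr rfl fun k hk => ?_
    rw [if_neg (Finset.mem_range.1 hk).ne]
  · simp only [add_zero, if_true, mul_one]
    refine Finset.prod_congr rfl fun k _ => ?_
    rw [if_neg (by lia), ← pow_succ']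
    push_cast
    rw [show (r : ℤ) + (k + 1) - r = (k + 1 : ℕ) by push_cast; ring, zpow_natCast]

end

private noncomputable def invProd (a b p : ℂ) (m r : ℕ) : ℂ :=
  ((∏ k ∈ Finset.range m, (1 - a * p ^ k)) * ∏ k ∈ Finset.range r, (1 - b * p ^ k))⁻¹

private lemma prod_erase_product {ι : Type*} [Fintype ι] [DecidableEq ι] (i : ι) {n r : ℕ}
    (hr : r < n) (f : ι → ℕ → ℂ) :
    ∏ z ∈ (Finset.univ ×ˢ Finset.range n).erase (i, r), f z.1 z.2 =
      ∏ l, if l = i then ∏ k ∈ (Finset.range n).erase r, f l k else ∏ k ∈ Finset.range n,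
          f l k := by
  have h : ∏ z ∈ (Finset.univ ×ˢ Finset.range n).erase (i, r), f z.1 z.2 =
      ∏ z ∈ Finset.univ ×ˢ Finset.range n, if z = (i, r) then 1 else f z.1 z.2 := by
    rw [← Finset.mul_prod_erase (Finset.univ ×ˢ Finset.range n) _ (a := (i, r)) (by simpa using hr),
      if_pos rfl, one_mul]
    exact Finset.prod_congr rfl fun k hk => (if_neg (Finset.ne_of_mem_erase hk)).symm
  rw [h, Finset.prod_product]
  refine Finset.prod_congr rfl fun l _ => ?_
  split_ifs with hl
  · subst hl
    rw [← Finset.mul_prod_erase (Finset.range n) _ (Finset.mem_range.2 hr), if_pos rfl, one_mul]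
    refine Finset.prod_congr rfl fun k hk => if_neg fun h' => Finset.ne_of_mem_erase hk ?_
    exact congrArg Prod.snd h'
  · exact Finset.prod_congr rfl fun k _ => if_neg fun h' => hl (congrArg Prod.fst h')

section

variable {ι : Type*} [Fintype ι] [DecidableEq ι] {w y : ℂ} {x : ι → ℂ} (hw0 : w ≠ 0) (hw : ‖w‖ < 1)
  (hx : ∀ i, x i ≠ 0)
include hw0 hx

omit [Fintype ι] in
private lemma partial_fraction_factor (i l : ι) {N r : ℕ} (hr : r < 2 * N) :
    (-x l) ^ N * (w ^ (N * (N + 1)))⁻¹ * ((x i * (w ^ 2) ^ ((r : ℤ) - N))⁻¹ ^ N *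
      (if l = i then ∏ k ∈ (Finset.range (2 * N)).erase r,
        (1 - x l * (w ^ 2) ^ ((k : ℤ) - N) / (x i * (w ^ 2) ^ ((r : ℤ) - N)))
      else ∏ k ∈ Finset.range (2 * N),
        (1 - x l * (w ^ 2) ^ ((k : ℤ) - N) / (x i * (w ^ 2) ^ ((r : ℤ) - N))))⁻¹) =
    (-(x i / x l)) ^ ((r : ℤ) - N) * w ^ (((r : ℤ) - N) * ((r : ℤ) - N + 1)) *
      (if l = i then invProd (w ^ 2) (w ^ 2) (w ^ 2) (2 * N - r - 1) r
      else invProd (x l / x i) (w ^ 2 / (x l / x i)) (w ^ 2) (2 * N - r) r) := by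
  have hp0 : w ^ 2 ≠ 0 := pow_ne_zero _ hw0
  have hxi := hx i
  have hxl := hx l
  have e : ∀ k : ℕ, x l * (w ^ 2) ^ ((k : ℤ) - N) / (x i * (w ^ 2) ^ ((r : ℤ) - N)) =
      x l / x i * (w ^ 2) ^ ((k : ℤ) - r) := fun k => by
    rw [show (k : ℤ) - N = (k - r) + (r - N) by ring, zpow_add₀ hp0]
    have := zpow_ne_zero ((r : ℤ) - N) hp0
    field_simp
  have main : (-x l) ^ N * (w ^ (N * (N + 1)))⁻¹ * ((x i * (w ^ 2) ^ ((r : ℤ) - N))⁻¹ ^ N *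
      ((-(x l / x i)) ^ r * (w ^ (r * (r + 1)))⁻¹)⁻¹) =
      (-(x i / x l)) ^ ((r : ℤ) - N) * w ^ (((r : ℤ) - N) * ((r : ℤ) - N + 1)) := by
    have e1 : ((w ^ 2) ^ ((r : ℤ) - N)) ^ N = w ^ (2 * N * ((r : ℤ) - N)) := by
      rw [← zpow_natCast w 2, ← zpow_mul, ← zpow_natCast, ← zpow_mul]
      congr 1
      push_cast
      ring
    have e2 : w ^ (((r : ℤ) - N) * ((r : ℤ) - N + 1)) = w ^ (r * (r + 1)) * (w ^ (N * (N + 1)))⁻¹ *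
        (w ^ (2 * N * ((r : ℤ) - N)))⁻¹ := by
      rw [← zpow_natCast, ← zpow_natCast, ← zpow_neg, ← zpow_neg, ← zpow_add₀ hw0, ← zpow_add₀ hw0]
      congr 1
      push_cast
      ring
    have hn : -(x i / x l) ≠ 0 := neg_ne_zero.2 (div_ne_zero hxi hxl)
    rw [inv_pow, mul_pow, e1, e2, zpow_sub₀ hn, zpow_natCast, zpow_natCast]
    have := zpow_ne_zero (2 * N * ((r : ℤ) - N)) hw0
    have hN := pow_ne_zero N hxi
    have hN' := pow_ne_zero N hxl
    have hr' := pow_ne_zero r hxi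
    have hr'' := pow_ne_zero r hxl
    rw [neg_pow (x l), neg_pow (x l / x i), neg_pow (x i / x l), neg_pow (x i / x l) N,
      div_pow, div_pow, div_pow]
    have h1 : ((-1 : ℂ) ^ N) ^ 2 = 1 := by rw [← pow_mul, mul_comm, pow_mul]; norm_num
    have h2 : ((-1 : ℂ) ^ r) ^ 2 = 1 := by rw [← pow_mul, mul_comm, pow_mul]; norm_num
    have h3 : (-1 : ℂ) ^ N ≠ 0 := pow_ne_zero _ (by norm_num)
    have h4 : (-1 : ℂ) ^ r ≠ 0 := pow_ne_zero _ (by norm_num)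
    field_simp
    rw [h1, h2]
  simp only [e]
  split_ifs with hli
  · subst hli
    rw [div_self hxl] at *
    simp only [one_mul] at *
    rw [prod_erase_one_sub_zpow hw0 hr, mul_inv ((-1) ^ r * _), invProd, ← main]
    ring
  · rw [prod_one_sub_mul_zpow hw0 (div_ne_zero hxl hxi) hr.le, mul_inv ((-(x l / x i)) ^ r * _),
      invProd, ← main]
    ring

include hw

private lemma partial_fraction_finite [Nonempty ι]
    (hx' : ∀ i j, i ≠ j → ∀ n : ℤ, x j / x i * (w ^ 2) ^ n ≠ 1) (hy0 : y ≠ 0)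
    (hy : ∀ i, ∀ n : ℤ, y * x i * (w ^ 2) ^ n ≠ 1) {N : ℕ} (hN : 0 < N) :
    ∏ i, invProd (x i * y) (w ^ 2 / (x i * y)) (w ^ 2) N N =
      ∑ i, ∑ r ∈ Finset.range (2 * N),
        (∏ l, (-(x i / x l)) ^ ((r : ℤ) - N) * w ^ (((r : ℤ) - N) * ((r : ℤ) - N + 1))) *
        (1 - y * x i * (w ^ 2) ^ ((r : ℤ) - N))⁻¹ *
        ∏ l, (if l = i then invProd (w ^ 2) (w ^ 2) (w ^ 2) (2 * N - r - 1) r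
          else invProd (x l / x i) (w ^ 2 / (x l / x i)) (w ^ 2) (2 * N - r) r) := by
  have hp0 : w ^ 2 ≠ 0 := pow_ne_zero _ hw0
  have hp : ‖w ^ 2‖ < 1 := by rw [norm_pow]; exact pow_lt_one₀ (norm_nonneg _) hw (by simp)
  set b : ι × ℕ → ℂ := fun z => x z.1 * (w ^ 2) ^ ((z.2 : ℤ) - N) with hbdef
  have hb : ∀ z, b z ≠ 0 := fun z => mul_ne_zero (hx _) (zpow_ne_zero _ hp0)
  have hinj : Function.Injective b := by
    rintro ⟨i, k⟩ ⟨j, l⟩ h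
    simp only [hbdef] at h
    have h1 : x j / x i * (w ^ 2) ^ ((l : ℤ) - k) = 1 := by
      rw [show (l : ℤ) - k = (l - N) - (k - N) by ring, zpow_sub₀ hp0]
      have h2 := zpow_ne_zero ((k : ℤ) - N) hp0
      have h3 := hx i
      field_simp
      exact h.symm
    by_cases hij : i = j
    · subst hij
      rw [div_self (hx i), one_mul] at h1
      have := mt (zpow_ne_one_of_ne_zero hp) (not_not.2 h1)
      exact Prod.ext rfl (by push Not at this; lia)
    · exact absurd h1 (hx' i j hij _)
  have hcard : N * Fintype.card ι < (Finset.univ ×ˢ Finset.range (2 * N) : Finset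
      (ι × ℕ)).card := by
    have := Fintype.card_pos (α := ι)
    rw [Finset.card_product, Finset.card_range, Finset.card_univ]
    nlinarith [Nat.mul_pos hN this]
  have h := pow_eq_sum_partial_fraction (fun z _ => hb z)
    (hinj.injOn (s := ((Finset.univ ×ˢ Finset.range (2 * N) : Finset (ι × ℕ)) : Set _)))
    hcard (y := y) (fun z _ => sub_ne_zero.2 (by simpa [hbdef, mul_assoc] using (hy z.1 _).symm))
  have hpc : ∀ c : ℂ, c ^ (N * Fintype.card ι) = ∏ _i : ι, c ^ N := fun c => by
    rw [pow_mul, Finset.prod_const, Finset.card_univ]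
  have hK : ∏ i, invProd (x i * y) (w ^ 2 / (x i * y)) (w ^ 2) N N =
      (∏ i, (-x i) ^ N * (w ^ (N * (N + 1)))⁻¹) * (y ^ (N * Fintype.card ι) *
        (∏ z ∈ Finset.univ ×ˢ Finset.range (2 * N), (1 - y * b z))⁻¹) := by
    rw [Finset.prod_product, hpc, ← Finset.prod_inv_distrib, ← Finset.prod_mul_distrib,
      ← Finset.prod_mul_distrib]
    refine Finset.prod_congr rfl fun i _ => ?_
    have e : ∏ k ∈ Finset.range (2 * N), (1 - y * b (i, k)) =
        ∏ k ∈ Finset.range (2 * N), (1 - x i * y * (w ^ 2) ^ ((k : ℤ) - N)) :=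
      Finset.prod_congr rfl fun k _ => by simp only [hbdef]; ring
    rw [e, prod_one_sub_mul_zpow hw0 (mul_ne_zero (hx i) hy0) (by lia), two_mul,
      Nat.add_sub_cancel, mul_inv ((-(x i * y)) ^ N * _), invProd, neg_mul_eq_neg_mul, mul_pow]
    have := pow_ne_zero N (neg_ne_zero.2 (hx i))
    field_simp
  rw [hK, h, Finset.mul_sum, Finset.sum_product]
  refine Finset.sum_congr rfl fun i _ => Finset.sum_congr rfl fun r hr => ?_
  rw [hpc, prod_erase_product i (Finset.mem_range.1 hr) fun l k => 1 - b (l, k) / b (i, r)]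
  have key := Finset.prod_congr rfl fun l (_ : l ∈ Finset.univ) =>
    partial_fraction_factor hw0 hx i l (Finset.mem_range.1 hr)
  simp only [hbdef, Finset.prod_mul_distrib, Finset.prod_inv_distrib] at key ⊢
  rw [mul_assoc y]
  linear_combination (1 - y * (x i * (w ^ 2) ^ ((r : ℤ) - N)))⁻¹ * key

end

section

variable {p a b : ℂ} (hp : ‖p‖ < 1)
include hp

private lemma norm_invProd_le (ha : ∀ n : ℕ, a * p ^ n ≠ 1) (hb : ∀ n : ℕ, b * p ^ n ≠ 1) :
    ∃ C : ℝ, 0 < C ∧ ∀ m r, ‖invProd a b p m r‖ ≤ C := by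
  obtain ⟨A, hA, hA'⟩ := exists_norm_prod_inv_le hp ha
  obtain ⟨B, hB, hB'⟩ := exists_norm_prod_inv_le hp hb
  refine ⟨A * B, mul_pos hA hB, fun m r => ?_⟩
  rw [invProd, mul_inv, norm_mul]
  exact mul_le_mul (hA' _) (hB' _) (norm_nonneg _) hA.le

private lemma tendsto_invProd (ha : ∀ n : ℕ, a * p ^ n ≠ 1) (hb : ∀ n : ℕ, b * p ^ n ≠ 1)
    {f g : ℕ → ℕ} (hf : Tendsto f atTop atTop) (hg : Tendsto g atTop atTop) :
    Tendsto (fun N => invProd a b p (f N) (g N)) atTop (𝓝 (poch a p * poch b p)⁻¹) :=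
  (((tendsto_poch hp a).comp hf).mul ((tendsto_poch hp b).comp hg)).inv₀
    (mul_ne_zero (poch_ne_zero hp ha) (poch_ne_zero hp hb))

lemma exists_norm_one_sub_zpow_inv_le (hp0 : p ≠ 0) (ha0 : a ≠ 0) (ha : ∀ n : ℤ, a * p ^ n ≠ 1) :
    ∃ C : ℝ, 0 < C ∧ ∀ n : ℤ, ‖(1 - a * p ^ n)⁻¹‖ ≤ C := by
  obtain ⟨A, hA, hA'⟩ := exists_norm_prod_inv_le hp (a := a) fun n => by simpa using ha n
  obtain ⟨B, hB, hB'⟩ := exists_norm_prod_inv_le hp (a := a⁻¹) fun n h => by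
    apply ha (-n)
    rw [zpow_neg, zpow_natCast]
    field_simp at h ⊢
    exact h.symm
  refine ⟨A + ‖a⁻¹‖ * B, by positivity, fun n => ?_⟩
  rcases Int.eq_nat_or_neg n with ⟨m, rfl | rfl⟩
  · have := hA' {m}
    rw [Finset.prod_singleton] at this
    rw [zpow_natCast]
    exact this.trans (le_add_of_nonneg_right (by positivity))
  · have := hB' {m}
    rw [Finset.prod_singleton] at this
    have hpm := pow_ne_zero m hp0
    have h1 : 1 - a⁻¹ * p ^ m ≠ 0 := fun h => by
      apply ha (-m)
      rw [zpow_neg, zpow_natCast]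
      field_simp at h ⊢
      linear_combination h
    have h2 : a - p ^ m ≠ 0 := fun h => h1 (by field_simp; linear_combination h)
    have h3 : p ^ m - a ≠ 0 := by rw [← neg_sub]; exact neg_ne_zero.2 h2
    have e : (1 - a * p ^ (-m : ℤ))⁻¹ = -(a⁻¹ * p ^ m * (1 - a⁻¹ * p ^ m)⁻¹) := by
      rw [zpow_neg, zpow_natCast]
      field_simp
      ring
    rw [e, norm_neg, norm_mul, norm_mul, norm_pow]
    calc _ ≤ ‖a⁻¹‖ * 1 * B := by
          gcongr
          exact pow_le_one₀ (norm_nonneg _) hp.le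
      _ ≤ _ := by rw [mul_one]; exact le_add_of_nonneg_left hA.le

lemma summable_norm_appell {W B : ℂ} (hp0 : p ≠ 0) (ha0 : a ≠ 0) (ha : ∀ n : ℤ, a * p ^ n ≠ 1)
    (hW0 : W ≠ 0) (hW : ‖W‖ < 1) (hB : B ≠ 0) :
    Summable fun n : ℤ => ‖W ^ (n ^ 2) * B ^ n * (1 - a * p ^ n)⁻¹‖ := by
  obtain ⟨C, hC, hC'⟩ := exists_norm_one_sub_zpow_inv_le hp hp0 ha0 ha
  refine Summable.of_nonneg_of_le (fun _ => norm_nonneg _) (fun n => ?_)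
    ((summable_norm_zpow_sq_mul hW0 hW hB).mul_right C)
  rw [norm_mul]
  exact mul_le_mul_of_nonneg_left (hC' n) (norm_nonneg _)

end

section

variable {ι : Type*} [Fintype ι] [DecidableEq ι] [Nonempty ι] {w y : ℂ} {x : ι → ℂ} (hw0 : w ≠ 0)
  (hw : ‖w‖ < 1) (hx : ∀ i, x i ≠ 0)
  (hx' : ∀ i j, i ≠ j → ∀ n : ℤ, x j / x i * (w ^ 2) ^ n ≠ 1) (hy0 : y ≠ 0)
  (hy : ∀ i, ∀ n : ℤ, y * x i * (w ^ 2) ^ n ≠ 1)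
include hw0 hw hx hx' hy0 hy

private lemma tendsto_partial_fraction (i : ι) :
    Tendsto (fun N : ℕ => ∑ r ∈ Finset.range (2 * N),
        (∏ l, (-(x i / x l)) ^ ((r : ℤ) - N) * w ^ (((r : ℤ) - N) * ((r : ℤ) - N + 1))) *
        (1 - y * x i * (w ^ 2) ^ ((r : ℤ) - N))⁻¹ *
        ∏ l, (if l = i then invProd (w ^ 2) (w ^ 2) (w ^ 2) (2 * N - r - 1) r
          else invProd (x l / x i) (w ^ 2 / (x l / x i)) (w ^ 2) (2 * N - r) r)) atTop
      (𝓝 (∑' n : ℤ, (∏ l, (-(x i / x l)) ^ n * w ^ (n * (n + 1))) *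
        (1 - y * x i * (w ^ 2) ^ n)⁻¹ *
        ∏ l, (if l = i then (poch (w ^ 2) (w ^ 2) * poch (w ^ 2) (w ^ 2))⁻¹
          else (poch (x l / x i) (w ^ 2) * poch (w ^ 2 / (x l / x i)) (w ^ 2))⁻¹))) := by
  have hp0 : w ^ 2 ≠ 0 := pow_ne_zero _ hw0
  have hp : ‖w ^ 2‖ < 1 := by rw [norm_pow]; exact pow_lt_one₀ (norm_nonneg _) hw (by simp)
  have hne : ∀ n : ℕ, w ^ 2 * (w ^ 2) ^ n ≠ 1 := fun n => by
    have := zpow_ne_one_of_ne_zero hp (n := n + 1) (by lia)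
    rw [← pow_succ']
    exact_mod_cast this
  have hne1 : ∀ l, l ≠ i → ∀ n : ℕ, x l / x i * (w ^ 2) ^ n ≠ 1 := fun l hl n => by
    simpa using hx' i l hl.symm n
  have hne2 : ∀ l, l ≠ i → ∀ n : ℕ, w ^ 2 / (x l / x i) * (w ^ 2) ^ n ≠ 1 := fun l hl n h => by
    apply hx' i l hl.symm (-(n + 1 : ℤ))
    have hxi := hx i
    have hxl := hx l
    have := pow_ne_zero (n + 1) hp0
    rw [zpow_neg, show (w ^ 2) ^ (n + 1 : ℤ) = (w ^ 2) ^ (n + 1) by norm_cast]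
    rw [pow_succ] at this ⊢
    field_simp at h ⊢
    exact h.symm
  have hbd : ∀ l, ∃ C : ℝ, 0 < C ∧ ∀ m r, ‖if l = i then invProd (w ^ 2) (w ^ 2) (w ^ 2) (m - 1) r
      else invProd (x l / x i) (w ^ 2 / (x l / x i)) (w ^ 2) m r‖ ≤ C := fun l => by
    split_ifs with h
    · obtain ⟨C, hC, h'⟩ := norm_invProd_le hp hne hne
      exact ⟨C, hC, fun m r => h' _ _⟩
    · exact norm_invProd_le hp (hne1 l h) (hne2 l h)
  choose C hC hC' using hbd
  let g : ℕ → ℤ → ℂ := fun N n => ∏ l, if l = i then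
    invProd (w ^ 2) (w ^ 2) (w ^ 2) (2 * N - (n + N).toNat - 1) (n + N).toNat
    else invProd (x l / x i) (w ^ 2 / (x l / x i)) (w ^ 2) (2 * N - (n + N).toNat) (n + N).toNat
  let c : ℤ → ℂ := fun n => (∏ l, (-(x i / x l)) ^ n * w ^ (n * (n + 1))) *
    (1 - y * x i * (w ^ 2) ^ n)⁻¹
  have hc : Summable fun n => ‖c n‖ := by
    have hcard : Fintype.card ι ≠ 0 := Fintype.card_ne_zero
    have hB : (∏ l, -(x i / x l)) * w ^ Fintype.card ι ≠ 0 :=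
      mul_ne_zero (Finset.prod_ne_zero_iff.2 fun l _ => neg_ne_zero.2 (div_ne_zero (hx i) (hx l)))
        (pow_ne_zero _ hw0)
    refine (summable_norm_appell hp hp0 (mul_ne_zero hy0 (hx i)) (hy i) (W := w ^ Fintype.card ι)
      (pow_ne_zero _ hw0) (by rw [norm_pow]; exact pow_lt_one₀ (norm_nonneg _) hw hcard) hB).congr
      fun n => ?_
    simp only [c]
    congr 2
    rw [Finset.prod_mul_distrib, Finset.prod_const, Finset.card_univ, Finset.prod_zpow, mul_zpow,
      show n * (n + 1) = n ^ 2 + n by ring, zpow_add₀ hw0, mul_pow, ← zpow_natCast,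
      ← zpow_natCast, ← zpow_natCast, ← zpow_mul, ← zpow_mul, ← zpow_mul, ← zpow_mul,
      mul_comm (n ^ 2), mul_comm n]
    ring
  have hsum : ∀ N : ℕ, ∑' n : ℤ, (if n ∈ Finset.Ico (-N : ℤ) N then c n * g N n else 0) =
      ∑ r ∈ Finset.range (2 * N), c ((r : ℤ) - N) * g N ((r : ℤ) - N) := fun N => by
    rw [tsum_eq_sum (s := Finset.Ico (-N : ℤ) N) fun n hn => if_neg hn]
    refine Finset.sum_nbij' (fun n => (n + N).toNat) (fun r => (r : ℤ) - N) ?_ ?_ ?_ ?_ ?_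
    · intro n hn
      rw [Finset.mem_Ico] at hn
      rw [Finset.mem_range]
      lia
    · intro n hn
      rw [Finset.mem_range] at hn
      rw [Finset.mem_Ico]
      lia
    · intro n hn
      rw [Finset.mem_Ico] at hn
      lia
    · intro n hn
      lia
    · intro n hn
      rw [if_pos hn]
      rw [Finset.mem_Ico] at hn
      rw [Int.toNat_of_nonneg (by lia), add_sub_cancel_right]
  have hlim : Tendsto (fun N : ℕ => ∑' n : ℤ, if n ∈ Finset.Ico (-N : ℤ) N then c n * g N n else 0)
      atTop (𝓝 (∑' n : ℤ, c n * ∏ l, (if l = i then (poch (w ^ 2) (w ^ 2) * poch (w ^ 2) (w ^ 2))⁻¹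
          else (poch (x l / x i) (w ^ 2) * poch (w ^ 2 / (x l / x i)) (w ^ 2))⁻¹))) := by
    refine tendsto_tsum_of_dominated_convergence (hc.mul_right (∏ l, C l)) (fun n => ?_)
      (.of_forall fun N n => ?_)
    · have h1 : Tendsto (fun N : ℕ => (n + N).toNat) atTop atTop :=
        tendsto_atTop_atTop.2 fun b => ⟨b + n.natAbs, fun N hN => by lia⟩
      have h2 : Tendsto (fun N : ℕ => 2 * N - (n + N).toNat) atTop atTop :=
        tendsto_atTop_atTop.2 fun b => ⟨b + n.natAbs, fun N hN => by lia⟩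
      have h3 : Tendsto (fun N : ℕ => 2 * N - (n + N).toNat - 1) atTop atTop :=
        tendsto_atTop_atTop.2 fun b => ⟨b + n.natAbs + 1, fun N hN => by lia⟩
      have h4 : Tendsto (fun N => c n * g N n) atTop (𝓝 (c n * ∏ l, (if l = i then
          (poch (w ^ 2) (w ^ 2) * poch (w ^ 2) (w ^ 2))⁻¹
          else (poch (x l / x i) (w ^ 2) * poch (w ^ 2 / (x l / x i)) (w ^ 2))⁻¹))) := by
        refine (tendsto_finsetProd _ fun l _ => ?_).const_mul _
        split_ifs with hl
        · exact tendsto_invProd hp hne hne h3 h1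
        · exact tendsto_invProd hp (hne1 l hl) (hne2 l hl) h2 h1
      refine h4.congr' ?_
      filter_upwards [eventually_gt_atTop n.natAbs] with N hN
      rw [if_pos (by rw [Finset.mem_Ico]; lia)]
    · split_ifs
      · rw [norm_mul]
        refine mul_le_mul_of_nonneg_left ?_ (norm_nonneg _)
        rw [norm_prod]
        exact Finset.prod_le_prod (fun _ _ => norm_nonneg _) fun l _ => hC' l _ _
      · rw [norm_zero]
        exact mul_nonneg (norm_nonneg _) (Finset.prod_nonneg fun l _ => (hC l).le)
  refine hlim.congr fun N => (hsum N).trans (Finset.sum_congr rfl fun r _ => ?_)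
  simp only [c, g, sub_add_cancel, Int.toNat_natCast]

/-- The partial fraction expansion of the reciprocal of a product of theta functions. -/
theorem prod_inv_poch_eq_sum :
    ∏ i, (poch (x i * y) (w ^ 2) * poch (w ^ 2 / (x i * y)) (w ^ 2))⁻¹ =
      ∑ i, (∑' n : ℤ, (∏ l, (-(x i / x l)) ^ n * w ^ (n * (n + 1))) *
        (1 - y * x i * (w ^ 2) ^ n)⁻¹) *
        ∏ l, (if l = i then (poch (w ^ 2) (w ^ 2) * poch (w ^ 2) (w ^ 2))⁻¹
          else (poch (x l / x i) (w ^ 2) * poch (w ^ 2 / (x l / x i)) (w ^ 2))⁻¹) := by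
  have hp0 : w ^ 2 ≠ 0 := pow_ne_zero _ hw0
  have hp : ‖w ^ 2‖ < 1 := by rw [norm_pow]; exact pow_lt_one₀ (norm_nonneg _) hw (by simp)
  simp only [← tsum_mul_right]
  refine tendsto_nhds_unique (f := fun N => ∏ i, invProd (x i * y) (w ^ 2 / (x i * y)) (w ^ 2) N N)
    (tendsto_finsetProd _ fun i _ => tendsto_invProd hp (fun n => ?_) (fun n h => ?_)
      tendsto_id tendsto_id)
    ((tendsto_finsetSum _ fun i _ => tendsto_partial_fraction hw0 hw hx hx' hy0 hy i).congr' ?_)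
  · simpa [mul_comm] using hy i n
  · apply hy i (-(n + 1 : ℤ))
    have hxi := hx i
    have := pow_ne_zero (n + 1) hp0
    rw [zpow_neg, show (w ^ 2) ^ (n + 1 : ℤ) = (w ^ 2) ^ (n + 1) by norm_cast]
    rw [pow_succ] at this ⊢
    field_simp at h ⊢
    linear_combination -h
  · filter_upwards [eventually_gt_atTop 0] with N hN
    exact (partial_fraction_finite hw0 hw hx hx' hy0 hy hN).symm

end

/-! ### Appell sums of level three -/

/-- The Appell-type sum `∑ₙ (-1)ⁿ u^(15n²+kn) / (1 - y u^(2r+10n))`. -/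
noncomputable def appell (u : ℂ) (k r : ℤ) (y : ℂ) : ℂ :=
  ∑' n : ℤ, (-1) ^ n * u ^ (15 * n ^ 2 + k * n) * (1 - y * u ^ (2 * r + 10 * n))⁻¹

section

variable {u Q y : ℂ} (hu0 : u ≠ 0) (hu : ‖u‖ < 1) (hQ : u ^ 2 = Q)
  (hy0 : y ≠ 0) (hy : ∀ n : ℤ, y * Q ^ n ≠ 1)
include hu0 hu hQ hy0 hy

lemma hasSum_appell (k r : ℤ) :
    HasSum (fun n : ℤ => (-1) ^ n * u ^ (15 * n ^ 2 + k * n) * (1 - y * u ^ (2 * r + 10 * n))⁻¹)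
      (appell u k r y) := by
  have hp : ‖u ^ 10‖ < 1 := by rw [norm_pow]; exact pow_lt_one₀ (norm_nonneg _) hu (by simp)
  have hp15 : ‖u ^ 15‖ < 1 := by rw [norm_pow]; exact pow_lt_one₀ (norm_nonneg _) hu (by simp)
  have key := summable_norm_appell (p := u ^ 10) (a := y * u ^ (2 * r)) (W := u ^ 15)
    (B := -u ^ k) hp (pow_ne_zero _ hu0) (mul_ne_zero hy0 (zpow_ne_zero _ hu0))
    (fun n hn => hy (r + 5 * n) (by
      rw [← hn, ← hQ, ← zpow_natCast, ← zpow_natCast, ← zpow_mul, ← zpow_mul, mul_assoc,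
        ← zpow_add₀ hu0]
      congr 2; push_cast; ring))
    (pow_ne_zero _ hu0) hp15 (neg_ne_zero.2 (zpow_ne_zero _ hu0))
  refine (Summable.of_norm (key.congr fun n => ?_)).hasSum
  congr 1
  rw [← zpow_natCast, ← zpow_natCast, ← zpow_mul, ← zpow_mul, neg_eq_neg_one_mul, mul_zpow,
    ← zpow_mul, mul_assoc y, ← zpow_add₀ hu0, zpow_add₀ hu0 (15 * n ^ 2)]
  push_cast
  ring

lemma inv_th_mul_th_mul_th {a b c : ℤ} (hab : ¬ 5 ∣ a - b) (hac : ¬ 5 ∣ a - c)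
    (hbc : ¬ 5 ∣ b - c) :
    poch (Q ^ 5) (Q ^ 5) ^ 3 *
      (th (y * Q ^ a) (Q ^ 5) * th (y * Q ^ b) (Q ^ 5) * th (y * Q ^ c) (Q ^ 5))⁻¹ =
    appell u (15 + 4 * a - 2 * b - 2 * c) a y *
        (th (Q ^ (b - a)) (Q ^ 5) * th (Q ^ (c - a)) (Q ^ 5))⁻¹ +
      appell u (15 + 4 * b - 2 * a - 2 * c) b y *
        (th (Q ^ (a - b)) (Q ^ 5) * th (Q ^ (c - b)) (Q ^ 5))⁻¹ +
      appell u (15 + 4 * c - 2 * a - 2 * b) c y *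
        (th (Q ^ (a - c)) (Q ^ 5) * th (Q ^ (b - c)) (Q ^ 5))⁻¹ := by
  have hQ0 : Q ≠ 0 := hQ ▸ pow_ne_zero _ hu0
  have hQ1 : ‖Q‖ < 1 := by
    rw [← hQ, norm_pow]; exact pow_lt_one₀ (norm_nonneg _) hu (by simp)
  have hw : ‖u ^ 5‖ < 1 := by rw [norm_pow]; exact pow_lt_one₀ (norm_nonneg _) hu (by simp)
  have hp : (u ^ 5) ^ 2 = Q ^ 5 := by rw [← hQ]; ring
  have hE : poch (Q ^ 5) (Q ^ 5) ≠ 0 :=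
    poch_ne_zero_of_norm_lt (norm_pow_five_lt_one hQ1) (norm_pow_five_lt_one hQ1)
  have hsub : ∀ d : ℤ, ¬ 5 ∣ d → ∀ n : ℤ, Q ^ d * (Q ^ 5) ^ n ≠ 1 := fun d hd n => by
    rw [← zpow_natCast, ← zpow_mul, ← zpow_add₀ hQ0]
    exact zpow_ne_one_of_ne_zero hQ1 (by push_cast; lia)
  have hneg : ∀ d e : ℤ, ¬ 5 ∣ d - e → ¬ 5 ∣ e - d := fun d e h => by lia
  have key := prod_inv_poch_eq_sum (ι := Fin 3) (w := u ^ 5) (y := y) (x := ![Q ^ a, Q ^ b, Q ^ c])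
    (pow_ne_zero _ hu0) hw (fun i => by fin_cases i <;> exact zpow_ne_zero _ hQ0)
    (fun i j hij n => by
      rw [hp]
      fin_cases i <;> fin_cases j <;> first
        | exact absurd rfl hij
        | simp only [Fin.zero_eta, Fin.mk_one, Fin.reduceFinMk, Matrix.cons_val_zero,
            Matrix.cons_val_one, Matrix.cons_val, ← zpow_sub₀ hQ0]
          exact hsub _ (by first | assumption | exact hneg _ _ (by assumption)) n)
    hy0 (fun i n hn => by
      rw [hp, mul_assoc, ← zpow_natCast, ← zpow_mul] at hn
      fin_cases i
      · exact hy (a + 5 * n) (by rw [zpow_add₀ hQ0]; exact_mod_cast hn)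
      · exact hy (b + 5 * n) (by rw [zpow_add₀ hQ0]; exact_mod_cast hn)
      · exact hy (c + 5 * n) (by rw [zpow_add₀ hQ0]; exact_mod_cast hn))
  have hap : ∀ d e f g k : ℤ, k = 15 + 2 * (e + f + g) →
      ∑' n : ℤ, (-Q ^ e) ^ n * (u ^ 5) ^ (n * (n + 1)) *
      ((-Q ^ f) ^ n * (u ^ 5) ^ (n * (n + 1))) *
      ((-Q ^ g) ^ n * (u ^ 5) ^ (n * (n + 1))) * (1 - y * Q ^ d * (Q ^ 5) ^ n)⁻¹ =
      appell u k d y := fun d e f g k hk => by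
    refine tsum_congr fun n => ?_
    rw [← hQ, neg_eq_neg_one_mul, mul_zpow, neg_eq_neg_one_mul (_ ^ f), mul_zpow,
      neg_eq_neg_one_mul (_ ^ g), mul_zpow, mul_assoc y]
    simp only [← zpow_natCast, ← zpow_mul, ← zpow_add₀ hu0]
    have h1 : ((-1 : ℂ) ^ n) * (-1) ^ n = 1 := by rw [← mul_zpow]; simp
    have h2 : u ^ (15 * n ^ 2 + k * n) = u ^ (((2 : ℕ) : ℤ) * e * n) *
        u ^ (((5 : ℕ) : ℤ) * (n * (n + 1))) * (u ^ (((2 : ℕ) : ℤ) * f * n) *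
        u ^ (((5 : ℕ) : ℤ) * (n * (n + 1)))) * (u ^ (((2 : ℕ) : ℤ) * g * n) *
        u ^ (((5 : ℕ) : ℤ) * (n * (n + 1)))) := by
      simp only [← zpow_add₀ hu0]
      congr 1; rw [hk]; push_cast; ring
    rw [h2, show ((2 : ℕ) : ℤ) * d + ((2 : ℕ) : ℤ) * ((5 : ℕ) : ℤ) * n = 2 * d + 10 * n by
      push_cast; ring]
    linear_combination (1 - y * u ^ (2 * d + 10 * n))⁻¹ * (-1) ^ n * (u ^ (((2 : ℕ) : ℤ) * e * n) *
        u ^ (((5 : ℕ) : ℤ) * (n * (n + 1))) * (u ^ (((2 : ℕ) : ℤ) * f * n) *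
        u ^ (((5 : ℕ) : ℤ) * (n * (n + 1)))) * (u ^ (((2 : ℕ) : ℤ) * g * n) *
        u ^ (((5 : ℕ) : ℤ) * (n * (n + 1))))) * h1
  have hpoch : ∀ x, (poch x (Q ^ 5) * poch (Q ^ 5 / x) (Q ^ 5))⁻¹ =
      poch (Q ^ 5) (Q ^ 5) * (th x (Q ^ 5))⁻¹ := fun x => by
    rw [th, mul_inv _ (poch (Q ^ 5) (Q ^ 5)), mul_left_comm, mul_inv_cancel₀ hE, mul_one]
  simp only [Fin.prod_univ_three, Fin.sum_univ_three, Matrix.cons_val_zero, Matrix.cons_val_one,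
    Matrix.cons_val, hp, if_true, Fin.reduceEq, if_false, ← zpow_sub₀ hQ0] at key
  rw [hap a _ _ _ (15 + 4 * a - 2 * b - 2 * c) (by ring),
    hap b _ _ _ (15 + 4 * b - 2 * a - 2 * c) (by ring),
    hap c _ _ _ (15 + 4 * c - 2 * a - 2 * b) (by ring)] at key
  simp only [hpoch, mul_comm _ y] at key
  simp only [mul_inv] at key ⊢
  have hEE : poch (Q ^ 5) (Q ^ 5) ^ 2 * ((poch (Q ^ 5) (Q ^ 5))⁻¹ * (poch (Q ^ 5) (Q ^ 5))⁻¹) =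
      1 := by
    field_simp
  linear_combination key + hEE * (
    appell u (15 + 4 * a - 2 * b - 2 * c) a y *
        ((th (Q ^ (b - a)) (Q ^ 5))⁻¹ * (th (Q ^ (c - a)) (Q ^ 5))⁻¹) +
      appell u (15 + 4 * b - 2 * a - 2 * c) b y *
        ((th (Q ^ (a - b)) (Q ^ 5))⁻¹ * (th (Q ^ (c - b)) (Q ^ 5))⁻¹) +
      appell u (15 + 4 * c - 2 * a - 2 * b) c y *
        ((th (Q ^ (a - c)) (Q ^ 5))⁻¹ * (th (Q ^ (b - c)) (Q ^ 5))⁻¹))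

omit hy0 hy in
lemma th_zpow_values :
    th (Q ^ (3 : ℤ)) (Q ^ 5) = th (Q ^ 2) (Q ^ 5) ∧ th (Q ^ (4 : ℤ)) (Q ^ 5) = th Q (Q ^ 5) ∧
    th (Q ^ (-1 : ℤ)) (Q ^ 5) = -Q⁻¹ * th Q (Q ^ 5) ∧
    th (Q ^ (-2 : ℤ)) (Q ^ 5) = -(Q ^ 2)⁻¹ * th (Q ^ 2) (Q ^ 5) ∧
    th (Q ^ (-3 : ℤ)) (Q ^ 5) = -(Q ^ 3)⁻¹ * th (Q ^ 2) (Q ^ 5) ∧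
    th (Q ^ (-4 : ℤ)) (Q ^ 5) = -(Q ^ 4)⁻¹ * th Q (Q ^ 5) ∧
    th (Q ^ (1 : ℤ)) (Q ^ 5) = th Q (Q ^ 5) ∧ th (Q ^ (2 : ℤ)) (Q ^ 5) = th (Q ^ 2) (Q ^ 5) := by
  have hQ0 : Q ≠ 0 := hQ ▸ pow_ne_zero _ hu0
  have hQ1 : ‖Q‖ < 1 := by
    rw [← hQ, norm_pow]; exact pow_lt_one₀ (norm_nonneg _) hu (by simp)
  have hp := norm_pow_five_lt_one hQ1
  have hp0 : Q ^ 5 ≠ 0 := pow_ne_zero _ hQ0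
  have hneg : ∀ k : ℕ, th (Q ^ (-k : ℤ)) (Q ^ 5) = -(Q ^ k)⁻¹ * th (Q ^ k) (Q ^ 5) := fun k => by
    rw [zpow_neg, zpow_natCast, th_inv hp hp0 (pow_ne_zero _ hQ0)]
  have h1 := hneg 1
  have h2 := hneg 2
  have h3 := hneg 3
  have h4 := hneg 4
  rw [th_pow_three hQ0] at h3
  rw [th_pow_four hQ0] at h4
  rw [pow_one] at h1
  exact ⟨by exact_mod_cast th_pow_three hQ0, by exact_mod_cast th_pow_four hQ0, h1, h2, h3, h4,
    by rw [zpow_one], by norm_cast⟩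

end

/-- `1 / (θ(y Qᵃ) θ(y Qᵇ) θ(y Qᶜ))` for the theta function of nome `Q⁵`. -/
noncomputable def invTheta (Q : ℂ) (a b c : ℤ) (y : ℂ) : ℂ :=
  (th (y * Q ^ a) (Q ^ 5) * th (y * Q ^ b) (Q ^ 5) * th (y * Q ^ c) (Q ^ 5))⁻¹

section

variable {u Q y : ℂ} (hu0 : u ≠ 0) (hu : ‖u‖ < 1) (hQ : u ^ 2 = Q)
  (hy0 : y ≠ 0) (hy : ∀ n : ℤ, y * Q ^ n ≠ 1)
include hu0 hu hQ hy0 hy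

lemma invTheta_eq_appell :
    poch (Q ^ 5) (Q ^ 5) ^ 3 * invTheta Q 0 3 4 y =
      (appell u 1 0 y - Q ^ 3 * appell u 19 3 y) / (th Q (Q ^ 5) * th (Q ^ 2) (Q ^ 5)) +
        Q ^ 5 * appell u 25 4 y / th Q (Q ^ 5) ^ 2 ∧
    poch (Q ^ 5) (Q ^ 5) ^ 3 * invTheta Q 1 2 4 y =
      (appell u 7 1 y - Q * appell u 13 2 y) / (th Q (Q ^ 5) * th (Q ^ 2) (Q ^ 5)) +
        Q ^ 5 * appell u 25 4 y / th (Q ^ 2) (Q ^ 5) ^ 2 ∧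
    poch (Q ^ 5) (Q ^ 5) ^ 3 * invTheta Q 0 2 4 y =
      (appell u 3 0 y + Q ^ 6 * appell u 27 4 y) / (th Q (Q ^ 5) * th (Q ^ 2) (Q ^ 5)) -
        Q ^ 2 * appell u 15 2 y / th (Q ^ 2) (Q ^ 5) ^ 2 ∧
    poch (Q ^ 5) (Q ^ 5) ^ 3 * invTheta Q 1 2 3 y =
      (appell u 9 1 y + Q ^ 3 * appell u 21 3 y) / (th Q (Q ^ 5) * th (Q ^ 2) (Q ^ 5)) -
        Q * appell u 15 2 y / th Q (Q ^ 5) ^ 2 := by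
  have hQ0 : Q ≠ 0 := hQ ▸ pow_ne_zero _ hu0
  have hQ1 : ‖Q‖ < 1 := by
    rw [← hQ, norm_pow]; exact pow_lt_one₀ (norm_nonneg _) hu (by simp)
  obtain ⟨e3, e4, e1', e2', e3', e4', e1, e2⟩ := th_zpow_values hu0 hu hQ
  have n1 := th_self_ne_zero hQ0 hQ1
  have n2 := th_sq_ne_zero hQ0 hQ1
  simp only [invTheta]
  rw [inv_th_mul_th_mul_th hu0 hu hQ hy0 hy (a := 0) (b := 3) (c := 4) (by norm_num) (by norm_num)
      (by norm_num),
    inv_th_mul_th_mul_th hu0 hu hQ hy0 hy (a := 1) (b := 2) (c := 4) (by norm_num) (by norm_num)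
      (by norm_num),
    inv_th_mul_th_mul_th hu0 hu hQ hy0 hy (a := 0) (b := 2) (c := 4) (by norm_num) (by norm_num)
      (by norm_num),
    inv_th_mul_th_mul_th hu0 hu hQ hy0 hy (a := 1) (b := 2) (c := 3) (by norm_num) (by norm_num)
      (by norm_num)]
  norm_num only [e3, e4, e1', e2', e3', e4', e1, e2]
  generalize th Q (Q ^ 5) = t1 at *
  generalize th (Q ^ 2) (Q ^ 5) = t2 at *
  refine ⟨?_, ?_, ?_, ?_⟩ <;> field_simp <;> ring

end

/-- `∑ₖ (-1)ᵏ q^(k(3k+1)/2) (1 - qᵏ) / (1 - y q⁵ᵏ)` with `q = s²`, up to sign. -/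
noncomputable def rankPhi (s y : ℂ) : ℂ :=
  -∑' k : ℤ, (-1) ^ k * (s ^ (3 * k ^ 2 + k) - s ^ (3 * k ^ 2 + 3 * k)) * (1 - y * s ^ (10 * k))⁻¹

section

variable {s u q Q y : ℂ} (hs0 : s ≠ 0) (hs : ‖s‖ < 1) (hq : s ^ 2 = q) (hu : s ^ 5 = u)
  (hQ : q ^ 5 = Q) (hy0 : y ≠ 0) (hy : ∀ n : ℤ, y * Q ^ n ≠ 1)
include hs0 hs hq hu hQ hy0 hy

private lemma hasSum_rankPhi_part (c : ℤ) :
    HasSum (fun k : ℤ => (-1) ^ k * s ^ (3 * k ^ 2 + c * k) * (1 - y * s ^ (10 * k))⁻¹)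
      (∑ r : Fin 5, (-1) ^ (r : ℕ) * s ^ (3 * (r : ℤ) ^ 2 + c * r) *
        appell u (6 * (r : ℕ) + c) (r : ℕ) y) := by
  have hu0 : u ≠ 0 := hu ▸ pow_ne_zero _ hs0
  have hu1 : ‖u‖ < 1 := by rw [← hu, norm_pow]; exact pow_lt_one₀ (norm_nonneg _) hs (by simp)
  have huQ : u ^ 2 = Q := by rw [← hu, ← hQ, ← hq]; ring
  refine hasSum_of_hasSum_mod_five fun r => ?_
  refine ((hasSum_appell hu0 hu1 huQ hy0 hy (6 * (r : ℕ) + c) (r : ℕ)).mul_left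
    ((-1) ^ (r : ℕ) * s ^ (3 * (r : ℤ) ^ 2 + c * r))).of_eq (fun m => ?_) rfl
  have h5 : (-1 : ℂ) ^ (5 * m) = (-1) ^ m := by rw [zpow_mul]; norm_num
  rw [← hu, ← zpow_natCast s 5, ← zpow_mul, ← zpow_mul, zpow_add₀ (by norm_num : (-1 : ℂ) ≠ 0), h5,
    zpow_natCast, show 3 * (5 * m + (r : ℕ)) ^ 2 + c * (5 * m + (r : ℕ)) =
        (3 * (r : ℤ) ^ 2 + c * r) +
      ((5 : ℕ) : ℤ) * (15 * m ^ 2 + (6 * (r : ℕ) + c) * m) by push_cast; ring, zpow_add₀ hs0,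
    show 10 * (5 * m + (r : ℕ)) = ((5 : ℕ) : ℤ) * (2 * (r : ℕ) + 10 * m) by push_cast; ring]
  ring

lemma rankPhi_eq :
    rankPhi s y = poch (Q ^ 5) (Q ^ 5) ^ 3 * th Q (Q ^ 5) * th (Q ^ 2) (Q ^ 5) *
        (invTheta Q 0 2 4 y - invTheta Q 0 3 4 y + q ^ 2 * invTheta Q 1 2 4 y -
          q ^ 3 * invTheta Q 1 2 3 y) +
      (Q ^ 5 * appell u 25 4 y - q ^ 3 * Q * appell u 15 2 y) *
        (th (Q ^ 2) (Q ^ 5) / th Q (Q ^ 5) - q - q ^ 2 * (th Q (Q ^ 5) / th (Q ^ 2) (Q ^ 5))) := by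
  have hu0 : u ≠ 0 := hu ▸ pow_ne_zero _ hs0
  have hu1 : ‖u‖ < 1 := by rw [← hu, norm_pow]; exact pow_lt_one₀ (norm_nonneg _) hs (by simp)
  have huQ : u ^ 2 = Q := by rw [← hu, ← hQ, ← hq]; ring
  have hQ0 : Q ≠ 0 := huQ ▸ pow_ne_zero _ hu0
  have hQ1 : ‖Q‖ < 1 := by
    rw [← huQ, norm_pow]; exact pow_lt_one₀ (norm_nonneg _) hu1 (by simp)
  have key := (hasSum_rankPhi_part hs0 hs hq hu hQ hy0 hy 1).sub
    (hasSum_rankPhi_part hs0 hs hq hu hQ hy0 hy 3)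
  have h1 : rankPhi s y = -_ := congrArg Neg.neg
    (key.of_eq (g := fun k : ℤ => (-1) ^ k * (s ^ (3 * k ^ 2 + k) - s ^ (3 * k ^ 2 + 3 * k)) *
      (1 - y * s ^ (10 * k))⁻¹) (fun k => by rw [one_mul]; ring) rfl).tsum_eq
  obtain ⟨e1, e2, e3, e4⟩ := invTheta_eq_appell hu0 hu1 huQ hy0 hy
  have n1 := th_self_ne_zero hQ0 hQ1
  have n2 := th_sq_ne_zero hQ0 hQ1
  have hpow : ∀ k m : ℕ, k = 2 * m → s ^ (k : ℤ) = q ^ m := fun k m h => by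
    rw [zpow_natCast, h, pow_mul, hq]
  rw [h1]
  simp only [Fin.sum_univ_five, Fin.val_zero, Fin.val_one, Fin.val_two,
    show ((3 : Fin 5) : ℕ) = 3 from rfl, show ((4 : Fin 5) : ℕ) = 4 from rfl]
  norm_num only
  have p4 := hpow 4 2 rfl
  have p14 := hpow 14 7 rfl
  have p30 := hpow 30 15 rfl
  have p52 := hpow 52 26 rfl
  have p6 := hpow 6 3 rfl
  have p18 := hpow 18 9 rfl
  have p36 := hpow 36 18 rfl
  have p60 := hpow 60 30 rfl
  norm_num only at p4 p14 p30 p52 p6 p18 p36 p60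
  simp only [p4, p14, p30, p52, p6, p18, p36, p60, zpow_zero]
  trans th Q (Q ^ 5) * th (Q ^ 2) (Q ^ 5) *
        (poch (Q ^ 5) (Q ^ 5) ^ 3 * invTheta Q 0 2 4 y - poch (Q ^ 5) (Q ^ 5) ^ 3 *
            invTheta Q 0 3 4 y +
          q ^ 2 * (poch (Q ^ 5) (Q ^ 5) ^ 3 * invTheta Q 1 2 4 y) -
          q ^ 3 * (poch (Q ^ 5) (Q ^ 5) ^ 3 * invTheta Q 1 2 3 y)) +
      (Q ^ 5 * appell u 25 4 y - q ^ 3 * Q * appell u 15 2 y) *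
        (th (Q ^ 2) (Q ^ 5) / th Q (Q ^ 5) - q - q ^ 2 * (th Q (Q ^ 5) / th (Q ^ 2) (Q ^ 5)))
  · rw [e1, e2, e3, e4]
    generalize th Q (Q ^ 5) = t1 at *
    generalize th (Q ^ 2) (Q ^ 5) = t2 at *
    rw [← hQ]
    field_simp
    ring
  · ring

end

/-! ### Fifth roots of unity and the dissection of `(q; q)_∞` -/

section

variable {ζ : ℂ} (hζ : IsPrimitiveRoot ζ 5)
include hζ

lemma one_add_zeta : 1 + ζ + ζ ^ 2 + ζ ^ 3 + ζ ^ 4 = 0 := by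
  have := hζ.geom_sum_eq_zero (by norm_num)
  simpa [Finset.sum_range_succ] using this

lemma zeta_ne_zero : ζ ≠ 0 := hζ.ne_zero (by norm_num)

lemma norm_zeta : ‖ζ‖ = 1 := hζ.norm'_eq_one (by norm_num)

lemma one_sub_zeta_ne_zero : 1 - ζ ≠ 0 := by
  simpa using sub_ne_zero.2 (hζ.pow_ne_one_of_pos_of_lt (l := 1) (by norm_num) (by norm_num)).symm

lemma one_sub_zeta_sq_ne_zero : 1 - ζ ^ 2 ≠ 0 :=
  sub_ne_zero.2 (hζ.pow_ne_one_of_pos_of_lt (l := 2) (by norm_num) (by norm_num)).symm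

lemma zeta_sq : IsPrimitiveRoot (ζ ^ 2) 5 := hζ.pow_of_coprime 2 (by norm_num)

variable {s q Q : ℂ} (hs0 : s ≠ 0) (hs : ‖s‖ < 1) (hq : s ^ 2 = q) (hQ : q ^ 5 = Q)
include hs0 hs hq hQ

lemma th_zeta : th ζ q =
    (1 - ζ) * (th (Q ^ 2) (Q ^ 5) + q * (ζ ^ 2 + ζ ^ 3) * th Q (Q ^ 5)) := by
  have hq0 : q ≠ 0 := hq ▸ pow_ne_zero _ hs0
  have hQ0 : Q ≠ 0 := hQ ▸ pow_ne_zero _ hq0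
  have hQ1 : ‖Q‖ < 1 := by
    rw [← hQ, ← hq, ← pow_mul, norm_pow]; exact pow_lt_one₀ (norm_nonneg _) hs (by simp)
  have hp := norm_pow_five_lt_one hQ1
  have hp0 : Q ^ 5 ≠ 0 := pow_ne_zero _ hQ0
  have h := th_dissect hs0 hs (zeta_ne_zero hζ)
  have e : ∀ k, s ^ (10 * k) = Q ^ k := fun k => by rw [← hQ, ← hq]; ring
  have e60 : th (Q ^ 6) (Q ^ 5) = -Q⁻¹ * th Q (Q ^ 5) := by
    rw [← th_mul hp hp0 hQ0]; congr 1
  have e50 : th (Q ^ 5) (Q ^ 5) = 0 := by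
    rw [← th_one hp, ← th_div hp0 1, div_one]
  rw [hζ.pow_eq_one, hq, show s ^ 20 = Q ^ 2 from e 2, show s ^ 30 = Q ^ 3 from e 3,
    show s ^ 40 = Q ^ 4 from e 4, show s ^ 50 = Q ^ 5 from e 5, show s ^ 60 = Q ^ 6 from e 6] at h
  simp only [one_mul] at h
  rw [th_pow_three hQ0, th_pow_four hQ0, e60, e50, show s ^ 12 = q ^ 6 by rw [← hq]; ring] at h
  rw [h, ← hQ]
  field_simp
  ring

omit hs0 hs hq in
lemma th_zeta_mul_th_zeta_sq (hq1 : ‖q‖ < 1) :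
    th ζ q * th (ζ ^ 2) q = (1 - ζ) * (1 - ζ ^ 2) * (poch q q * poch Q Q) := by
  have hz0 := zeta_ne_zero hζ
  have h5 := hζ.pow_eq_one
  have hroot := prod_poch_root hq1 q h5 (one_add_zeta hζ)
  rw [hQ] at hroot
  have a1 : th ζ q = (1 - ζ) * poch (ζ * q) q * poch (ζ ^ 4 * q) q * poch q q := by
    rw [th, poch_succ hq1, show q / ζ = ζ ^ 4 * q by
      rw [div_eq_iff hz0]; linear_combination -q * h5]
  have a2 : th (ζ ^ 2) q = (1 - ζ ^ 2) * poch (ζ ^ 2 * q) q * poch (ζ ^ 3 * q) q * poch q q := by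
    rw [th, poch_succ hq1, show q / ζ ^ 2 = ζ ^ 3 * q by
      rw [div_eq_iff (pow_ne_zero 2 hz0)]; linear_combination -q * h5]
  rw [a1, a2, ← hroot]
  ring

lemma poch_self_eq : poch q q = poch (Q ^ 5) (Q ^ 5) * (th (Q ^ 2) (Q ^ 5) / th Q (Q ^ 5) - q -
    q ^ 2 * (th Q (Q ^ 5) / th (Q ^ 2) (Q ^ 5))) := by
  have hq0 : q ≠ 0 := hq ▸ pow_ne_zero _ hs0
  have hQ0 : Q ≠ 0 := hQ ▸ pow_ne_zero _ hq0
  have hq1 : ‖q‖ < 1 := by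
    rw [← hq, norm_pow]; exact pow_lt_one₀ (norm_nonneg _) hs (by simp)
  have hQ1 : ‖Q‖ < 1 := by
    rw [← hQ, norm_pow]; exact pow_lt_one₀ (norm_nonneg _) hq1 (by simp)
  have n1 := th_self_ne_zero hQ0 hQ1
  have n2 := th_sq_ne_zero hQ0 hQ1
  have h12 := th_mul_th_sq hQ0 hQ1
  have hQQ : poch Q Q ≠ 0 := poch_ne_zero_of_norm_lt hQ1 hQ1
  have hz0 := zeta_ne_zero hζ
  have m1 := one_sub_zeta_ne_zero hζ
  have m2 := one_sub_zeta_sq_ne_zero hζ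
  have h5 := hζ.pow_eq_one
  have b1 := th_zeta hζ hs0 hs hq hQ
  have b2 := th_zeta (zeta_sq hζ) hs0 hs hq hQ
  have key : poch q q * poch Q Q = th (Q ^ 2) (Q ^ 5) ^ 2 - q * th Q (Q ^ 5) * th (Q ^ 2) (Q ^ 5) -
      q ^ 2 * th Q (Q ^ 5) ^ 2 := by
    have h := th_zeta_mul_th_zeta_sq hζ hQ hq1
    rw [b1, b2] at h
    apply mul_left_cancel₀ (mul_ne_zero m1 m2)
    have e1 : ((ζ ^ 2) ^ 2 + (ζ ^ 2) ^ 3) = -1 - (ζ ^ 2 + ζ ^ 3) := by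
      linear_combination one_add_zeta hζ + ζ * h5
    have e2 : (ζ ^ 2 + ζ ^ 3) ^ 2 = 1 - (ζ ^ 2 + ζ ^ 3) := by
      linear_combination one_add_zeta hζ + (2 + ζ) * h5
    simp only [e1] at h
    linear_combination -h + (1 - ζ) * (1 - ζ ^ 2) * (-q ^ 2 * th Q (Q ^ 5) ^ 2) * e2
  have : poch q q * (th Q (Q ^ 5) * th (Q ^ 2) (Q ^ 5)) = poch (Q ^ 5) (Q ^ 5) *
      (th (Q ^ 2) (Q ^ 5) ^ 2 - q * th Q (Q ^ 5) * th (Q ^ 2) (Q ^ 5) - q ^ 2 * th Q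
          (Q ^ 5) ^ 2) := by
    rw [← key, h12]; ring
  field_simp
  linear_combination this

end

/-- The cofactor of `t - q - q²/t` in `t⁵ - 11q⁵ - q¹⁰/t⁵`. -/
lemma quintic_cofactor {t q : ℂ} (ht : t ≠ 0) : (t - q - q ^ 2 / t) *
    (t ^ 4 + q * t ^ 3 + 2 * q ^ 2 * t ^ 2 + 3 * q ^ 3 * t + 5 * q ^ 4 - 3 * q ^ 5 / t +
      2 * q ^ 6 / t ^ 2 - q ^ 7 / t ^ 3 + q ^ 8 / t ^ 4) =
    t ^ 5 - 11 * q ^ 5 - (q ^ 5) ^ 2 / t ^ 5 := by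
  field_simp
  ring

lemma quintic_ne_zero {ζ t q : ℂ} (hζ : IsPrimitiveRoot ζ 5) (ht : t ≠ 0) (hq : q ≠ 0)
    (h : ∀ j : ℕ, t - ζ ^ j * q - (ζ ^ j * q) ^ 2 / t ≠ 0) :
    t ^ 5 - 11 * q ^ 5 - (q ^ 5) ^ 2 / t ^ 5 ≠ 0 := by
  have h5 := hζ.pow_eq_one
  have hs := one_add_zeta hζ
  have key : ∀ a : ℂ, a ^ 2 = 1 - a → q ^ 5 ≠ (a * t) ^ 5 := fun a ha e => by
    have h1 : (a * t / q) ^ 5 = 1 := by rw [div_pow, ← e, div_self (pow_ne_zero _ hq)]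
    obtain ⟨i, -, hi⟩ := hζ.eq_pow_of_pow_eq_one h1
    apply h i
    rw [hi, div_mul_cancel₀ _ hq]
    field_simp
    linear_combination -t * ha
  have e1 : (ζ + ζ ^ 4) ^ 2 = 1 - (ζ + ζ ^ 4) := by linear_combination hs + (2 + ζ ^ 3) * h5
  have e2 : (ζ ^ 2 + ζ ^ 3) ^ 2 = 1 - (ζ ^ 2 + ζ ^ 3) := by linear_combination hs + (2 + ζ) * h5
  have f1 := key _ e1
  have f2 := key _ e2
  intro h0
  field_simp at h0
  have hsum : (ζ + ζ ^ 4) + (ζ ^ 2 + ζ ^ 3) = -1 := by linear_combination hs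
  generalize ζ + ζ ^ 4 = a at *
  generalize ζ ^ 2 + ζ ^ 3 = b at *
  obtain rfl : b = -1 - a := by linear_combination hsum
  have ha5 : a ^ 5 = 5 * a - 3 := by linear_combination (a ^ 3 - a ^ 2 + 2 * a - 3) * e1
  have hb5 : (-1 - a) ^ 5 = -5 * a - 8 := by
    linear_combination (-(a ^ 3) - 4 * a ^ 2 - 7 * a - 7) * e1
  rw [mul_pow] at f1 f2
  rw [ha5] at f1
  rw [hb5] at f2
  refine mul_ne_zero (sub_ne_zero.2 f1) (sub_ne_zero.2 f2) ?_
  linear_combination -h0 - 25 * t ^ 10 * e1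

section

variable {ζ : ℂ} (hζ : IsPrimitiveRoot ζ 5)
include hζ

lemma sum_zeta_pow (k : ℕ) :
    ∑ j ∈ Finset.range 5, (ζ ^ j) ^ (k + 1) = if k % 5 = 4 then 5 else 0 := by
  simp only [← pow_mul, mul_comm _ (k + 1)]
  simp only [pow_mul]
  split_ifs with h
  · rw [show ζ ^ (k + 1) = 1 from (hζ.pow_eq_one_iff_dvd _).2 (by lia)]
    simp
  · refine (hζ.pow_of_coprime (k + 1) ?_).geom_sum_eq_zero (by norm_num)
    exact ((Nat.Prime.coprime_iff_not_dvd (by norm_num)).2 (by lia)).symm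

lemma sum_zeta_pow_mul_poly (c0 c1 c2 c3 c4 q : ℂ) :
    ∑ j ∈ Finset.range 5, ζ ^ j * (c0 + c1 * (ζ ^ j * q) + c2 * (ζ ^ j * q) ^ 2 +
      c3 * (ζ ^ j * q) ^ 3 + c4 * (ζ ^ j * q) ^ 4) = 5 * c4 * q ^ 4 := by
  have e : ∀ j ∈ Finset.range 5, ζ ^ j * (c0 + c1 * (ζ ^ j * q) + c2 * (ζ ^ j * q) ^ 2 +
      c3 * (ζ ^ j * q) ^ 3 + c4 * (ζ ^ j * q) ^ 4) = c0 * (ζ ^ j) ^ (0 + 1) +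
      c1 * q * (ζ ^ j) ^ (1 + 1) + c2 * q ^ 2 * (ζ ^ j) ^ (2 + 1) + c3 * q ^ 3 * (ζ ^ j) ^ (3 + 1) +
      c4 * q ^ 4 * (ζ ^ j) ^ (4 + 1) := fun j _ => by ring
  rw [Finset.sum_congr rfl e]
  simp only [Finset.sum_add_distrib, ← Finset.mul_sum, sum_zeta_pow hζ]
  norm_num
  ring

lemma hasSum_mod_five_eq_four {a : ℕ → ℂ} {q : ℂ} {F : ℕ → ℂ}
    (h : ∀ j < 5, HasSum (fun n => a n * (ζ ^ j * q) ^ n) (F j)) :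
    HasSum (fun n => a (5 * n + 4) * q ^ (5 * n + 4)) (5⁻¹ * ∑ j ∈ Finset.range 5, ζ ^ j *
        F j) := by
  have h1 := (hasSum_sum fun j hj => (h j (Finset.mem_range.1 hj)).mul_left (ζ ^ j)).mul_left 5⁻¹
  have h2 : ∀ n, 5⁻¹ * ∑ j ∈ Finset.range 5, ζ ^ j * (a n * (ζ ^ j * q) ^ n) =
      if n % 5 = 4 then a n * q ^ n else 0 := fun n => by
    have e : ∀ j ∈ Finset.range 5, ζ ^ j * (a n * (ζ ^ j * q) ^ n) =
      a n * q ^ n * (ζ ^ j) ^ (n + 1) := fun j _ => by ring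
    rw [Finset.sum_congr rfl e, ← Finset.mul_sum, sum_zeta_pow hζ]
    split_ifs <;> ring
  simp only [h2] at h1
  have hinj : Function.Injective fun n : ℕ => 5 * n + 4 := fun a b h => by simpa using h
  refine ((hinj.hasSum_iff fun n hn => if_neg fun h4 => hn ⟨n / 5, by dsimp only; lia⟩).2 h1).of_eq
    (fun n => ?_) rfl
  simp only [Function.comp_apply]
  rw [if_pos (by lia)]

variable {s u q Q y : ℂ} (hs0 : s ≠ 0) (hs : ‖s‖ < 1) (hq : s ^ 2 = q) (hu : s ^ 5 = u)
  (hQ : q ^ 5 = Q)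
include hs0 hs hq hQ

omit hs0 in
lemma rotate (j : ℕ) : ‖(ζ ^ (3 * j) * s)‖ < 1 ∧ (ζ ^ (3 * j) * s) ^ 2 = ζ ^ j * q ∧
    (ζ ^ (3 * j) * s) ^ 5 = s ^ 5 ∧ (ζ ^ j * q) ^ 5 = Q := by
  have h5 := hζ.pow_eq_one
  have e : ∀ k, (ζ ^ k) ^ 5 = 1 := fun k => by rw [← pow_mul, mul_comm, pow_mul, h5, one_pow]
  refine ⟨?_, ?_, ?_, ?_⟩
  · rw [norm_mul, norm_pow, norm_zeta hζ, one_pow, one_mul]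
    exact hs
  · rw [mul_pow, hq, ← pow_mul, show 3 * j * 2 = j * 5 + j by ring, pow_add, pow_mul, e, one_mul]
  · rw [mul_pow, e, one_mul]
  · rw [mul_pow, e, one_mul, hQ]

lemma quintic_theta_ne_zero : (th (Q ^ 2) (Q ^ 5) / th Q (Q ^ 5)) ^ 5 - 11 * Q -
    Q ^ 2 / (th (Q ^ 2) (Q ^ 5) / th Q (Q ^ 5)) ^ 5 ≠ 0 := by
  have hq0 : q ≠ 0 := hq ▸ pow_ne_zero _ hs0
  have hQ0 : Q ≠ 0 := hQ ▸ pow_ne_zero _ hq0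
  have hQ1 : ‖Q‖ < 1 := by
    rw [← hQ, ← hq, ← pow_mul, norm_pow]; exact pow_lt_one₀ (norm_nonneg _) hs (by simp)
  have n1 := th_self_ne_zero hQ0 hQ1
  have n2 := th_sq_ne_zero hQ0 hQ1
  have := quintic_ne_zero hζ (div_ne_zero n2 n1) hq0 fun j h0 => ?_
  · rwa [hQ] at this
  obtain ⟨r1, r2, -, r4⟩ := rotate hζ hs hq hQ j
  have h1 := poch_self_eq hζ (mul_ne_zero (pow_ne_zero _ (zeta_ne_zero hζ)) hs0) r1 r2 r4
  have hqj : ‖ζ ^ j * q‖ < 1 := by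
    rw [← r2, norm_pow]; exact pow_lt_one₀ (norm_nonneg _) r1 (by simp)
  refine poch_ne_zero_of_norm_lt hqj hqj ?_
  rw [h1]
  apply mul_eq_zero_of_right
  rw [← h0]
  field_simp

omit hζ hs0 hs hq hQ in
lemma quintic_quotient {E t c Q G F H a b : ℂ} (hE : E ≠ 0) (ht : t ≠ 0)
    (hD : t ^ 5 - 11 * Q - Q ^ 2 / t ^ 5 ≠ 0) : ∃ c0 c1 c2 c3 : ℂ, ∀ x, x ^ 5 = Q →
    (E ^ 3 * c * (G + x ^ 2 * F - x ^ 3 * H) + (a - x ^ 3 * b) * (t - x - x ^ 2 * t⁻¹)) /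
      (E * (t - x - x ^ 2 * t⁻¹)) = c0 + c1 * x + c2 * x ^ 2 + c3 * x ^ 3 +
      (E ^ 2 * c / (t ^ 5 - 11 * Q - Q ^ 2 / t ^ 5) * (5 * G + (2 * t ^ 2 - Q / t ^ 3) * F -
        (t ^ 3 + 2 * Q / t ^ 2) * H)) * x ^ 4 := by
  refine ⟨E ^ 2 * c / (t ^ 5 - 11 * Q - Q ^ 2 / t ^ 5) * ((t ^ 4 - 3 * Q / t) * G +
        Q * ((3 * t + Q / t ^ 4) * F - (2 * t ^ 2 - Q / t ^ 3) * H)) + a / E,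
      E ^ 2 * c / (t ^ 5 - 11 * Q - Q ^ 2 / t ^ 5) * ((t ^ 3 + 2 * Q / t ^ 2) * G +
        Q * (5 * F - (3 * t + Q / t ^ 4) * H)),
      E ^ 2 * c / (t ^ 5 - 11 * Q - Q ^ 2 / t ^ 5) * ((2 * t ^ 2 - Q / t ^ 3) * G +
        (t ^ 4 - 3 * Q / t) * F - Q * 5 * H),
      E ^ 2 * c / (t ^ 5 - 11 * Q - Q ^ 2 / t ^ 5) * ((3 * t + Q / t ^ 4) * G +
        (t ^ 3 + 2 * Q / t ^ 2) * F - (t ^ 4 - 3 * Q / t) * H) - b / E, fun x hx => ?_⟩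
  have key := quintic_cofactor (q := x) ht
  rw [hx] at key
  have hτ : t - x - x ^ 2 * t⁻¹ ≠ 0 := fun h => hD (by
    rw [← key, div_eq_mul_inv (x ^ 2), h, zero_mul])
  rw [← div_eq_mul_inv] at hτ ⊢
  generalize hDD : t ^ 5 - 11 * Q - Q ^ 2 / t ^ 5 = D at *
  generalize hττ : t - x - x ^ 2 / t = τ at *
  have hinv : τ⁻¹ = (t ^ 4 - 3 * Q / t + (t ^ 3 + 2 * Q / t ^ 2) * x + (2 * t ^ 2 - Q / t ^ 3) *
      x ^ 2 +
      (3 * t + Q / t ^ 4) * x ^ 3 + 5 * x ^ 4) / D := by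
    rw [inv_eq_one_div, div_eq_div_iff hτ hD, one_mul, mul_comm, ← key, ← hx]
    ring
  trans E ^ 2 * c * (G + x ^ 2 * F - x ^ 3 * H) * τ⁻¹ + (a - x ^ 3 * b) / E
  · field_simp
  · rw [hinv]
    generalize t ^ 4 - 3 * Q / t = n0
    generalize t ^ 3 + 2 * Q / t ^ 2 = n1
    generalize 2 * t ^ 2 - Q / t ^ 3 = n2
    generalize 3 * t + Q / t ^ 4 = n3
    linear_combination E ^ 2 * c / D * (n3 * F - n2 * H + x * (5 * F - n3 * H) - x ^ 2 * 5 * H) * hx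

lemma sum_zeta_rankPhi (hy0 : y ≠ 0) (hy : ∀ n : ℤ, y * Q ^ n ≠ 1) :
    ∑ j ∈ Finset.range 5, ζ ^ j *
      (rankPhi (ζ ^ (3 * j) * s) y / poch (ζ ^ j * q) (ζ ^ j * q)) =
    5 * (poch (Q ^ 5) (Q ^ 5) ^ 2 * th Q (Q ^ 5) * th (Q ^ 2) (Q ^ 5) /
      ((th (Q ^ 2) (Q ^ 5) / th Q (Q ^ 5)) ^ 5 - 11 * Q -
        Q ^ 2 / (th (Q ^ 2) (Q ^ 5) / th Q (Q ^ 5)) ^ 5) *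
      (5 * (invTheta Q 0 2 4 y - invTheta Q 0 3 4 y) +
        (2 * (th (Q ^ 2) (Q ^ 5) / th Q (Q ^ 5)) ^ 2 - Q / (th (Q ^ 2) (Q ^ 5) / th Q
            (Q ^ 5)) ^ 3) *
          invTheta Q 1 2 4 y -
        ((th (Q ^ 2) (Q ^ 5) / th Q (Q ^ 5)) ^ 3 +
          2 * Q / (th (Q ^ 2) (Q ^ 5) / th Q (Q ^ 5)) ^ 2) * invTheta Q 1 2 3 y)) * q ^ 4 := by
  have hq0 : q ≠ 0 := hq ▸ pow_ne_zero _ hs0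
  have hQ0 : Q ≠ 0 := hQ ▸ pow_ne_zero _ hq0
  have hQ1 : ‖Q‖ < 1 := by
    rw [← hQ, ← hq, ← pow_mul, norm_pow]; exact pow_lt_one₀ (norm_nonneg _) hs (by simp)
  have n1 := th_self_ne_zero hQ0 hQ1
  have n2 := th_sq_ne_zero hQ0 hQ1
  have hD := quintic_theta_ne_zero hζ hs0 hs hq hQ
  have hp := norm_pow_five_lt_one hQ1
  have hE := poch_ne_zero_of_norm_lt hp hp
  have ht := div_ne_zero n2 n1
  obtain ⟨c0, c1, c2, c3, hc⟩ := quintic_quotient (c := th Q (Q ^ 5) * th (Q ^ 2) (Q ^ 5))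
    (G := invTheta Q 0 2 4 y - invTheta Q 0 3 4 y) (F := invTheta Q 1 2 4 y)
    (H := invTheta Q 1 2 3 y) (a := Q ^ 5 * appell (s ^ 5) 25 4 y)
    (b := Q * appell (s ^ 5) 15 2 y) hE ht hD
  rw [← mul_assoc (_ ^ 3), ← mul_assoc (_ ^ 2) (th Q (Q ^ 5))] at hc
  rw [← sum_zeta_pow_mul_poly hζ c0 c1 c2 c3]
  refine Finset.sum_congr rfl fun j _ => ?_
  obtain ⟨r1, r2, r3, r4⟩ := rotate hζ hs hq hQ j
  have hs0' := mul_ne_zero (pow_ne_zero (3 * j) (zeta_ne_zero hζ)) hs0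
  rw [← hc _ r4, poch_self_eq hζ hs0' r1 r2 r4, rankPhi_eq hs0' r1 r2 r3 r4 hy0 hy, inv_div]
  ring

end

/-! ### Differentiating at `y = 1` -/

/-- The numerators in the series `rankPhi`. -/
noncomputable def rankCoeff (s : ℂ) (k : ℤ) : ℂ :=
  (-1) ^ k * (s ^ (3 * k ^ 2 + k) - s ^ (3 * k ^ 2 + 3 * k))

section

variable {s : ℂ} (hs0 : s ≠ 0) (hs : ‖s‖ < 1)
include hs0 hs

lemma summable_norm_rankCoeff_mul (m : ℤ) : Summable fun k => ‖rankCoeff s k * s ^ (m * k)‖ := by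
  have hs3 : ‖s ^ 3‖ < 1 := by rw [norm_pow]; exact pow_lt_one₀ (norm_nonneg _) hs (by simp)
  have h := fun c : ℤ => summable_norm_zpow_sq_mul (pow_ne_zero 3 hs0) hs3 (zpow_ne_zero c hs0)
  refine Summable.of_nonneg_of_le (fun _ => norm_nonneg _) (fun k => ?_)
      ((h (1 + m)).add (h (3 + m)))
  have e : rankCoeff s k * s ^ (m * k) = (-1) ^ k * ((s ^ 3) ^ (k ^ 2) * (s ^ (1 + m)) ^ k -
      (s ^ 3) ^ (k ^ 2) * (s ^ (3 + m)) ^ k) := by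
    rw [rankCoeff, mul_assoc, sub_mul, ← zpow_natCast s 3]
    simp only [← zpow_mul, ← zpow_add₀ hs0]
    congr 2 <;> · congr 1; push_cast; ring
  rw [e, norm_mul, norm_zpow, norm_neg, norm_one, one_zpow, one_mul]
  exact norm_sub_le _ _

lemma exists_le_norm_one_sub_mul_zpow : ∃ δ : ℝ, 0 < δ ∧ ∀ y ∈ Metric.ball (1 : ℂ) δ, ∀ k : ℤ,
    k ≠ 0 → δ ≤ ‖1 - y * s ^ (10 * k)‖ := by
  have hp : ‖s ^ 10‖ < 1 := by rw [norm_pow]; exact pow_lt_one₀ (norm_nonneg _) hs (by simp)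
  refine ⟨(1 - ‖s ^ 10‖) / 2, by linarith, fun y hy k hk => ?_⟩
  rw [Metric.mem_ball, dist_eq_norm] at hy
  have hp0 : 0 < ‖s ^ 10‖ := norm_pos_iff.2 (pow_ne_zero _ hs0)
  have hy1 : ‖y‖ ≤ 1 + ‖y - 1‖ := by simpa using norm_add_le (1 : ℂ) (y - 1)
  have hy2 : 1 - ‖y - 1‖ ≤ ‖y‖ := by
    have := norm_sub_norm_le (1 : ℂ) y
    rw [norm_one, norm_sub_rev] at this
    linarith
  rw [zpow_mul, show s ^ (10 : ℤ) = s ^ 10 from zpow_natCast s 10]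
  generalize s ^ 10 = z at *
  rcases lt_or_gt_of_ne hk with hk | hk
  · have hz : ‖z‖⁻¹ ≤ ‖z ^ k‖ := by
      rw [norm_zpow, ← zpow_neg_one]
      exact zpow_le_zpow_right_of_le_one₀ hp0 hp.le (by lia)
    have h1 := norm_sub_norm_le (y * z ^ k) 1
    rw [norm_one, norm_sub_rev, norm_mul] at h1
    have h2 : (1 + ‖z‖) / 2 * ‖z‖⁻¹ ≤ ‖y‖ * ‖z ^ k‖ := by gcongr; linarith
    have h3 : 1 + (1 - ‖z‖) / 2 ≤ (1 + ‖z‖) / 2 * ‖z‖⁻¹ := by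
      rw [← div_eq_mul_inv, le_div_iff₀ hp0]
      nlinarith
    linarith
  · have hz : ‖z ^ k‖ ≤ ‖z‖ := by
      rw [norm_zpow]
      simpa using zpow_le_zpow_right_of_le_one₀ hp0 hp.le (show 1 ≤ k by lia)
    have h1 := norm_sub_norm_le 1 (y * z ^ k)
    rw [norm_one, norm_mul] at h1
    have h2 : ‖y‖ * ‖z ^ k‖ ≤ (1 + (1 - ‖z‖) / 2) * ‖z‖ := by gcongr; linarith
    nlinarith

lemma hasDerivAt_rankPhi_one : HasDerivAt (rankPhi s)
    (-∑' k : ℤ, rankCoeff s k * (s ^ (10 * k) * ((1 - s ^ (10 * k))⁻¹) ^ 2)) 1 := by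
  obtain ⟨δ, hδ, h⟩ := exists_le_norm_one_sub_mul_zpow hs0 hs
  have hmem : (1 : ℂ) ∈ Metric.ball (1 : ℂ) δ := Metric.mem_ball_self hδ
  have h0 : rankCoeff s 0 = 0 := by simp [rankCoeff]
  have hinv : ∀ y ∈ Metric.ball (1 : ℂ) δ, ∀ k : ℤ, k ≠ 0 → ‖(1 - y * s ^ (10 * k))⁻¹‖ ≤ δ⁻¹ :=
    fun y hy k hk => by
      rw [norm_inv]
      exact inv_anti₀ hδ (h y hy k hk)
  have key := hasDerivAt_tsum_of_isPreconnected
    (g := fun k y => rankCoeff s k * (1 - y * s ^ (10 * k))⁻¹)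
    (g' := fun k y => rankCoeff s k * (s ^ (10 * k) * ((1 - y * s ^ (10 * k))⁻¹) ^ 2))
    ((summable_norm_rankCoeff_mul hs0 hs 10).mul_right (δ⁻¹ ^ 2)) Metric.isOpen_ball
    (convex_ball (1 : ℂ) δ).isPreconnected (fun k y hy => ?_) (fun k y hy => ?_) hmem ?_ hmem
  · have h1 := key.neg
    simp only [one_mul] at h1
    exact h1
  · rcases eq_or_ne k 0 with rfl | hk
    · simpa [h0] using hasDerivAt_const y (0 : ℂ)
    · have hne : 1 - y * s ^ (10 * k) ≠ 0 := fun e => by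
        have := h y hy k hk
        rw [e, norm_zero] at this
        linarith
      refine ((((hasDerivAt_id y).mul_const (s ^ (10 * k))).const_sub 1).inv hne).const_mul
        (rankCoeff s k) |>.congr_deriv ?_
      simp only [id]
      field_simp
  · rcases eq_or_ne k 0 with rfl | hk
    · simp [h0]
    · rw [← mul_assoc, norm_mul, norm_pow]
      gcongr
      exact hinv y hy k hk
  · refine Summable.of_norm (Summable.of_nonneg_of_le (fun _ => norm_nonneg _) (fun k => ?_)
      ((summable_norm_rankCoeff_mul hs0 hs 0).mul_right δ⁻¹))
    rcases eq_or_ne k 0 with rfl | hk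
    · simp [h0]
    · rw [norm_mul, zero_mul, zpow_zero, mul_one]
      gcongr
      exact hinv 1 hmem k hk

end

section

variable {Q : ℂ} (hQ0 : Q ≠ 0) (hQ : ‖Q‖ < 1)
include hQ0 hQ

lemma hasDerivAt_th_mul_pow_one (k : ℕ) :
    HasDerivAt (fun y => th (y * Q ^ (k : ℤ)) (Q ^ 5)) (dth (Q ^ k) (Q ^ 5)) 1 := by
  simpa using hasDerivAt_th_mul (norm_pow_five_lt_one hQ) (pow_ne_zero k hQ0) one_ne_zero

lemma hasDerivAt_invTheta_one_two_four : HasDerivAt (invTheta Q 1 2 4)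
    (-ell 2 Q / (th Q (Q ^ 5) ^ 2 * th (Q ^ 2) (Q ^ 5))) 1 := by
  have n1 := th_self_ne_zero hQ0 hQ
  have n2 := th_sq_ne_zero hQ0 hQ
  have n4 := th_pow_four hQ0
  have h1 := hasDerivAt_th_mul_pow_one hQ0 hQ 1
  have h2 := hasDerivAt_th_mul_pow_one hQ0 hQ 2
  have h4 := hasDerivAt_th_mul_pow_one hQ0 hQ 4
  rw [dth_pow_four hQ0 hQ] at h4
  have e1 : th (1 * Q ^ ((1 : ℕ) : ℤ)) (Q ^ 5) = th Q (Q ^ 5) := by simp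
  have e2 : th (1 * Q ^ ((2 : ℕ) : ℤ)) (Q ^ 5) = th (Q ^ 2) (Q ^ 5) := by
    rw [one_mul, zpow_natCast]
  have e4 : th (1 * Q ^ ((4 : ℕ) : ℤ)) (Q ^ 5) = th Q (Q ^ 5) := by
    rw [one_mul, zpow_natCast, n4]
  refine (((h1.mul h2).mul h4).inv ?_).congr_deriv ?_
  · simp only [Pi.mul_apply, e1, e2, e4]
    exact mul_ne_zero (mul_ne_zero n1 n2) n1
  · simp only [Pi.mul_apply, e1, e2, e4, ell, pow_one]
    field_simp
    ring

lemma hasDerivAt_invTheta_one_two_three : HasDerivAt (invTheta Q 1 2 3)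
    (-ell 1 Q / (th Q (Q ^ 5) * th (Q ^ 2) (Q ^ 5) ^ 2)) 1 := by
  have n1 := th_self_ne_zero hQ0 hQ
  have n2 := th_sq_ne_zero hQ0 hQ
  have n3 := th_pow_three hQ0
  have h1 := hasDerivAt_th_mul_pow_one hQ0 hQ 1
  have h2 := hasDerivAt_th_mul_pow_one hQ0 hQ 2
  have h3 := hasDerivAt_th_mul_pow_one hQ0 hQ 3
  rw [dth_pow_three hQ0 hQ] at h3
  have e1 : th (1 * Q ^ ((1 : ℕ) : ℤ)) (Q ^ 5) = th Q (Q ^ 5) := by simp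
  have e2 : th (1 * Q ^ ((2 : ℕ) : ℤ)) (Q ^ 5) = th (Q ^ 2) (Q ^ 5) := by
    rw [one_mul, zpow_natCast]
  have e3 : th (1 * Q ^ ((3 : ℕ) : ℤ)) (Q ^ 5) = th (Q ^ 2) (Q ^ 5) := by
    rw [one_mul, zpow_natCast, n3]
  refine (((h1.mul h2).mul h3).inv ?_).congr_deriv ?_
  · simp only [Pi.mul_apply, e1, e2, e3]
    exact mul_ne_zero (mul_ne_zero n1 n2) n2
  · simp only [Pi.mul_apply, e1, e2, e3, ell, pow_one]
    field_simp
    ring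

/-- Values at the removable singularity `y = 1` of a difference of products of inverse thetas. -/
lemma removable_invTheta_sub {K : ℂ → ℂ} {K' : ℂ} (hK : HasDerivAt K K' 1)
    (h : ∀ᶠ y in 𝓝[≠] (1 : ℂ), K y = invTheta Q 0 2 4 y - invTheta Q 0 3 4 y)
    (hy : ∀ᶠ y in 𝓝[≠] (1 : ℂ), ∀ n : ℤ, y * Q ^ n ≠ 1) :
    K 1 = 2 * ell 2 Q / (poch (Q ^ 5) (Q ^ 5) ^ 3 * th Q (Q ^ 5) * th (Q ^ 2) (Q ^ 5)) ∧
      K' = K 1 * (ell 1 Q - 1 / 2) := by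
  have hp := norm_pow_five_lt_one hQ
  have hp0 := pow_ne_zero 5 hQ0
  have hE := poch_ne_zero_of_norm_lt hp hp
  have n1 := th_self_ne_zero hQ0 hQ
  have n2 := th_sq_ne_zero hQ0 hQ
  have h1 := hasDerivAt_th hp one_ne_zero
  have h2 := hasDerivAt_th_mul_pow_one hQ0 hQ 2
  have h3 := hasDerivAt_th_mul_pow_one hQ0 hQ 3
  have h4 := hasDerivAt_th_mul_pow_one hQ0 hQ 4
  rw [dth_one hp, div_one] at h1
  rw [dth_pow_three hQ0 hQ] at h3
  rw [dth_pow_four hQ0 hQ] at h4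
  have e2 : th (1 * Q ^ ((2 : ℕ) : ℤ)) (Q ^ 5) = th (Q ^ 2) (Q ^ 5) := by
    rw [one_mul, zpow_natCast]
  have e3 : th (1 * Q ^ ((3 : ℕ) : ℤ)) (Q ^ 5) = th (Q ^ 2) (Q ^ 5) := by
    rw [one_mul, zpow_natCast, th_pow_three hQ0]
  have e4 : th (1 * Q ^ ((4 : ℕ) : ℤ)) (Q ^ 5) = th Q (Q ^ 5) := by
    rw [one_mul, zpow_natCast, th_pow_four hQ0]
  have hM := hK.mul ((h2.mul h3).mul h4)
  simp only [Pi.mul_apply, e2, e3, e4] at hM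
  set M : ℂ → ℂ := K * (((fun y => th (y * Q ^ ((2 : ℕ) : ℤ)) (Q ^ 5)) *
    fun y => th (y * Q ^ ((3 : ℕ) : ℤ)) (Q ^ 5)) * fun y => th (y * Q ^ ((4 : ℕ) : ℤ)) (Q ^ 5)) with
        hMdef
  have hM1 : M 1 = K 1 * (th (Q ^ 2) (Q ^ 5) * th (Q ^ 2) (Q ^ 5) * th Q (Q ^ 5)) := by
    simp only [hMdef, Pi.mul_apply, e2, e3, e4]
  have hne : ∀ᶠ y in 𝓝[≠] (1 : ℂ), y ≠ 0 :=
    (eventually_ne_nhds one_ne_zero).filter_mono nhdsWithin_le_nhds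
  have hth : ∀ᶠ y in 𝓝[≠] (1 : ℂ), ∀ k : ℤ, th (y * Q ^ k) (Q ^ 5) ≠ 0 := by
    filter_upwards [hy, hne] with y hy h0 k
    refine th_ne_zero hp hp0 (mul_ne_zero h0 (zpow_ne_zero _ hQ0)) fun n => ?_
    rw [mul_assoc, ← zpow_natCast, ← zpow_mul, ← zpow_add₀ hQ0]
    exact hy _
  have hN : ∀ᶠ y in 𝓝 (1 : ℂ), M y * th y (Q ^ 5) =
      th (y * Q ^ ((3 : ℕ) : ℤ)) (Q ^ 5) - th (y * Q ^ ((2 : ℕ) : ℤ)) (Q ^ 5) := by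
    rw [← nhdsNE_sup_pure, eventually_sup]
    refine ⟨?_, ?_⟩
    · filter_upwards [h, hth] with y hy ht
      have t0 := ht 0
      have t2 := ht 2
      have t3 := ht 3
      have t4 := ht 4
      rw [zpow_zero, mul_one] at t0
      simp only [hMdef, Pi.mul_apply, hy, invTheta, zpow_zero, mul_one, Nat.cast_ofNat]
      generalize th (y * Q ^ (2 : ℤ)) (Q ^ 5) = b2 at *
      generalize th (y * Q ^ (3 : ℤ)) (Q ^ 5) = b3 at *
      generalize th (y * Q ^ (4 : ℤ)) (Q ^ 5) = b4 at *
      field_simp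
    · rw [eventually_pure, th_one hp, e2, e3]
      ring
  have hMder : M 1 * (-poch (Q ^ 5) (Q ^ 5) ^ 3) = -2 * dth (Q ^ 2) (Q ^ 5) := by
    have := (hM.mul h1).unique ((h3.sub h2).congr_of_eventuallyEq hN)
    rw [th_one hp] at this
    linear_combination this
  have hinv : Tendsto (fun y : ℂ => y⁻¹) (𝓝 1) (𝓝 1) := by
    simpa using tendsto_inv₀ (one_ne_zero (α := ℂ))
  have hsym : ∀ᶠ y in 𝓝 (1 : ℂ), M y⁻¹ = y * M y := by
    rw [← nhdsNE_sup_pure, eventually_sup]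
    refine ⟨?_, by simp⟩
    filter_upwards [hth, hne, hN.filter_mono nhdsWithin_le_nhds,
      (hinv.eventually hN).filter_mono nhdsWithin_le_nhds] with y ht h0 hN1 hN2
    have t0 := ht 0
    rw [zpow_zero, mul_one] at t0
    rw [th_inv hp hp0 h0, ← th_div hp0 (y⁻¹ * Q ^ ((3 : ℕ) : ℤ)),
      ← th_div hp0 (y⁻¹ * Q ^ ((2 : ℕ) : ℤ)),
      show Q ^ 5 / (y⁻¹ * Q ^ ((3 : ℕ) : ℤ)) = y * Q ^ ((2 : ℕ) : ℤ) by
        simp only [zpow_natCast]; field_simp,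
      show Q ^ 5 / (y⁻¹ * Q ^ ((2 : ℕ) : ℤ)) = y * Q ^ ((3 : ℕ) : ℤ) by
        simp only [zpow_natCast]; field_simp] at hN2
    apply mul_right_cancel₀ t0
    linear_combination -y * hN1 - y * hN2 - M y⁻¹ * th y (Q ^ 5) * mul_inv_cancel₀ h0
  have hsymd := (hM.comp_of_eq 1 (hasDerivAt_inv one_ne_zero) inv_one.symm).unique
    (((hasDerivAt_id 1).mul hM).congr_of_eventuallyEq hsym)
  rw [hM1] at hMder hsymd
  have hl1 : dth Q (Q ^ 5) = ell 1 Q * th Q (Q ^ 5) := by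
    rw [ell, pow_one]; field_simp
  have hl2 : dth (Q ^ 2) (Q ^ 5) = ell 2 Q * th (Q ^ 2) (Q ^ 5) := by
    rw [ell]; field_simp
  rw [hl1, hl2] at hsymd
  rw [hl2] at hMder
  refine ⟨?_, ?_⟩
  · rw [eq_div_iff (mul_ne_zero (mul_ne_zero (pow_ne_zero 3 hE) n1) n2)]
    apply mul_right_cancel₀ n2
    linear_combination -hMder
  · apply mul_right_cancel₀ (mul_ne_zero (pow_ne_zero 2 n2) n1)
    linear_combination -1 / 2 * hsymd

end

section

variable {ζ s q Q : ℂ} (hζ : IsPrimitiveRoot ζ 5) (hs0 : s ≠ 0) (hs : ‖s‖ < 1) (hq : s ^ 2 = q)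
  (hQ : q ^ 5 = Q)
include hζ hs0 hs hq hQ

lemma sum_zeta_rankPhi_add_deriv :
    ∑ j ∈ Finset.range 5, ζ ^ j * ((rankPhi (ζ ^ (3 * j) * s) 1 +
      5 * deriv (rankPhi (ζ ^ (3 * j) * s)) 1) / poch (ζ ^ j * q) (ζ ^ j * q)) =
    5 * q ^ 4 * poch (Q ^ 5) (Q ^ 5) ^ 4 / poch Q Q := by
  have hq0 : q ≠ 0 := hq ▸ pow_ne_zero _ hs0
  have hQ0 : Q ≠ 0 := hQ ▸ pow_ne_zero _ hq0
  have hQ1 : ‖Q‖ < 1 := by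
    rw [← hQ, ← hq, ← pow_mul, norm_pow]; exact pow_lt_one₀ (norm_nonneg _) hs (by simp)
  have n1 := th_self_ne_zero hQ0 hQ1
  have n2 := th_sq_ne_zero hQ0 hQ1
  have n12 := th_mul_th_sq hQ0 hQ1
  have hQQ : poch Q Q ≠ 0 := poch_ne_zero_of_norm_lt hQ1 hQ1
  have hD := quintic_theta_ne_zero hζ hs0 hs hq hQ
  have hp := norm_pow_five_lt_one hQ1
  have hE := poch_ne_zero_of_norm_lt hp hp
  have hF := hasDerivAt_invTheta_one_two_four hQ0 hQ1
  have hG := hasDerivAt_invTheta_one_two_three hQ0 hQ1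
  have hF1 : invTheta Q 1 2 4 1 = (th Q (Q ^ 5) ^ 2 * th (Q ^ 2) (Q ^ 5))⁻¹ := by
    rw [invTheta, one_mul, one_mul, one_mul, zpow_one, show Q ^ (4 : ℤ) =
      Q ^ 4 from zpow_natCast Q 4,
      show Q ^ (2 : ℤ) = Q ^ 2 from zpow_natCast Q 2, th_pow_four hQ0]
    ring
  have hG1 : invTheta Q 1 2 3 1 = (th Q (Q ^ 5) * th (Q ^ 2) (Q ^ 5) ^ 2)⁻¹ := by
    rw [invTheta, one_mul, one_mul, one_mul, zpow_one, show Q ^ (3 : ℤ) =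
      Q ^ 3 from zpow_natCast Q 3,
      show Q ^ (2 : ℤ) = Q ^ 2 from zpow_natCast Q 2, th_pow_three hQ0]
    ring
  have hL := HasDerivAt.fun_sum (u := Finset.range 5) fun j _ => (((hasDerivAt_rankPhi_one
    (mul_ne_zero (pow_ne_zero (3 * j) (zeta_ne_zero hζ)) hs0)
    (rotate hζ hs hq hQ j).1).differentiableAt.hasDerivAt.div_const
      (poch (ζ ^ j * q) (ζ ^ j * q))).const_mul (ζ ^ j))
  have hl1 := three_mul_ell_one hQ0 hQ1
  have hl2 := three_mul_ell_two hQ0 hQ1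
  set L : ℂ → ℂ := fun y => ∑ j ∈ Finset.range 5, ζ ^ j *
    (rankPhi (ζ ^ (3 * j) * s) y / poch (ζ ^ j * q) (ζ ^ j * q)) with hLdef
  set L' : ℂ := ∑ j ∈ Finset.range 5, ζ ^ j *
    (deriv (rankPhi (ζ ^ (3 * j) * s)) 1 / poch (ζ ^ j * q) (ζ ^ j * q)) with hL'def
  have h : ∀ y, y ≠ 0 → (∀ n : ℤ, y * Q ^ n ≠ 1) → L y = _ := fun y h0 h1 =>
    sum_zeta_rankPhi hζ hs0 hs hq hQ h0 h1
  have hgoal : ∑ j ∈ Finset.range 5, ζ ^ j * ((rankPhi (ζ ^ (3 * j) * s) 1 +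
      5 * deriv (rankPhi (ζ ^ (3 * j) * s)) 1) / poch (ζ ^ j * q) (ζ ^ j * q)) = L 1 + 5 * L' := by
    rw [hLdef, hL'def, Finset.mul_sum, ← Finset.sum_add_distrib]
    exact Finset.sum_congr rfl fun j _ => by ring
  rw [hgoal]
  have hy : ∀ᶠ y in 𝓝[≠] (1 : ℂ), y ≠ 0 ∧ ∀ n : ℤ, y * Q ^ n ≠ 1 := by
    obtain ⟨δ, hδ, hδ'⟩ := exists_le_norm_one_sub_mul_zpow hs0 hs
    filter_upwards [(eventually_ne_nhds one_ne_zero).filter_mono nhdsWithin_le_nhds,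
      (Metric.ball_mem_nhds (1 : ℂ) hδ) |> mem_nhdsWithin_of_mem_nhds, self_mem_nhdsWithin]
      with y h0 hb h1
    refine ⟨h0, fun n hn => ?_⟩
    rcases eq_or_ne n 0 with rfl | hn0
    · exact h1 (by simpa using hn)
    · have := hδ' y hb n hn0
      rw [zpow_mul, show s ^ (10 : ℤ) = Q by rw [← hQ, ← hq, ← pow_mul]; exact zpow_natCast s 10,
        hn, sub_self, norm_zero] at this
      linarith
  clear_value L L'
  clear hLdef hL'def hgoal
  obtain ⟨A, hA⟩ : ∃ A, A = 2 * (th (Q ^ 2) (Q ^ 5) / th Q (Q ^ 5)) ^ 2 -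
    Q / (th (Q ^ 2) (Q ^ 5) / th Q (Q ^ 5)) ^ 3 := ⟨_, rfl⟩
  obtain ⟨B, hB⟩ : ∃ B, B = (th (Q ^ 2) (Q ^ 5) / th Q (Q ^ 5)) ^ 3 +
    2 * Q / (th (Q ^ 2) (Q ^ 5) / th Q (Q ^ 5)) ^ 2 := ⟨_, rfl⟩
  obtain ⟨C, hC⟩ : ∃ C, C = poch (Q ^ 5) (Q ^ 5) ^ 2 * th Q (Q ^ 5) * th (Q ^ 2) (Q ^ 5) /
    ((th (Q ^ 2) (Q ^ 5) / th Q (Q ^ 5)) ^ 5 - 11 * Q -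
      Q ^ 2 / (th (Q ^ 2) (Q ^ 5) / th Q (Q ^ 5)) ^ 5) := ⟨_, rfl⟩
  have hC0 : C ≠ 0 := hC ▸ div_ne_zero (mul_ne_zero (mul_ne_zero (pow_ne_zero 2 hE) n1) n2) hD
  simp only [← hA, ← hB, ← hC] at h
  have hK := (((hL.div_const (5 * C * q ^ 4)).sub (hF.const_mul A)).add (hG.const_mul B)).div_const
      5
  obtain ⟨r1, r2⟩ := removable_invTheta_sub hQ0 hQ1 hK (hy.mono fun y hy => by
    simp only [Pi.add_apply, Pi.sub_apply, h y hy.1 hy.2]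
    field_simp
    ring) (hy.mono fun y hy => hy.2)
  simp only [Pi.add_apply, Pi.sub_apply, hF1, hG1] at r1 r2
  rw [r1] at r2
  have hq4 : 5 * C * q ^ 4 ≠ 0 := mul_ne_zero (mul_ne_zero (by norm_num) hC0) (pow_ne_zero 4 hq0)
  have hLL : L 1 + 5 * L' = (L 1 / (5 * C * q ^ 4) + 5 * (L' / (5 * C * q ^ 4))) *
    (5 * C * q ^ 4) := by field_simp
  have hX : poch Q Q = th Q (Q ^ 5) * th (Q ^ 2) (Q ^ 5) / poch (Q ^ 5) (Q ^ 5) := by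
    rw [n12]; field_simp
  rw [hLL, hX]
  generalize L 1 / (5 * C * q ^ 4) = X at *
  generalize L' / (5 * C * q ^ 4) = X' at *
  generalize th Q (Q ^ 5) = a at *
  generalize th (Q ^ 2) (Q ^ 5) = b at *
  generalize poch (Q ^ 5) (Q ^ 5) = E at *
  have e2 : ell 2 Q = (1 - E ^ 3 * b ^ 2 / a ^ 3 + 3 * (Q * (E ^ 3 * a ^ 2 / b ^ 3))) / 10 := by
    linear_combination (hl1 + 3 * hl2) / 10
  have e1 : ell 1 Q = (3 - 3 * (E ^ 3 * b ^ 2 / a ^ 3) - Q * (E ^ 3 * a ^ 2 / b ^ 3)) / 10 := by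
    linear_combination (3 * hl1 - hl2) / 10
  have hX : X + 5 * X' = 5 * (2 * ell 2 Q / (E ^ 3 * a * b) * (5 * ell 1 Q - 3 / 2)) +
      A * ((1 - 5 * ell 2 Q) / (a ^ 2 * b)) - B * ((1 - 5 * ell 1 Q) / (a * b ^ 2)) := by
    linear_combination 5 * r1 + 25 * r2
  obtain ⟨D, hDD⟩ : ∃ D, D = (b / a) ^ 5 - 11 * Q - Q ^ 2 / (b / a) ^ 5 := ⟨_, rfl⟩
  have hV : X + 5 * X' = E ^ 3 * D / (a * b) ^ 2 := by
    rw [hX, e1, e2, hA, hB, hDD]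
    field_simp
    ring
  rw [← hDD] at hD hC
  rw [hV, hC]
  field_simp

end

section

/-! ### Generating functions of partitions as analytic functions -/

section

open PowerSeries Nat.Partition
open scoped PowerSeries.WithPiTopology

/-- `F` converges absolutely at `q` with value `v`. -/
def EvalsTo (F : ℂ⟦X⟧) (q v : ℂ) : Prop :=
  Summable (fun n => ‖coeff n F * q ^ n‖) ∧ HasSum (fun n => coeff n F * q ^ n) v

lemma EvalsTo.one (q : ℂ) : EvalsTo 1 q 1 := by
  have h : ∀ n ≠ 0, coeff n (1 : ℂ⟦X⟧) * q ^ n = 0 := fun n hn => by simp [coeff_one, hn]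
  refine ⟨(summable_of_ne_finset_zero (s := {0}) fun n hn => ?_), ?_⟩
  · rw [h n (by simpa using hn), norm_zero]
  · simpa using hasSum_single 0 h

lemma EvalsTo.mul {F G : ℂ⟦X⟧} {q v w : ℂ} (hF : EvalsTo F q v) (hG : EvalsTo G q w) :
    EvalsTo (F * G) q (v * w) := by
  have e : ∀ n, coeff n (F * G) * q ^ n = ∑ kl ∈ Finset.HasAntidiagonal.antidiagonal n,
      (coeff kl.1 F * q ^ kl.1) * (coeff kl.2 G * q ^ kl.2) := fun n => by
    rw [coeff_mul, Finset.sum_mul]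
    refine Finset.sum_congr rfl fun kl h => ?_
    rw [← Finset.HasAntidiagonal.mem_antidiagonal.1 h, pow_add]
    ring
  have hs := summable_norm_sum_mul_antidiagonal_of_summable_norm hF.1 hG.1
  refine ⟨by simpa only [e] using hs, ?_⟩
  have ht := tsum_mul_tsum_eq_tsum_sum_antidiagonal_of_summable_norm hF.1 hG.1
  rw [hF.2.tsum_eq, hG.2.tsum_eq] at ht
  simp only [e]
  rw [ht]
  exact hs.of_norm.hasSum

lemma EvalsTo.prod {ι : Type*} (s : Finset ι) {F : ι → ℂ⟦X⟧} {q : ℂ} {v : ι → ℂ}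
    (h : ∀ i ∈ s, EvalsTo (F i) q (v i)) : EvalsTo (∏ i ∈ s, F i) q (∏ i ∈ s, v i) := by
  classical
  induction s using Finset.induction_on with
  | empty => exact EvalsTo.one q
  | insert i s hi ih =>
    rw [Finset.prod_insert hi, Finset.prod_insert hi]
    exact (h i (by simp)).mul (ih fun j hj => h j (by simp [hj]))

variable {f : ℕ → ℕ → ℂ} (hf0 : ∀ i, f i 0 = 1) (hf1 : ∀ i j, ‖f i j‖ ≤ 1) {q : ℂ} (hq : ‖q‖ < 1)

include hf0 in
lemma coeff_genFun_factor (i d : ℕ) :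
    coeff d (1 + ∑' j, f (i + 1) (j + 1) • (X : ℂ⟦X⟧) ^ ((i + 1) * (j + 1))) =
      if i + 1 ∣ d then f (i + 1) (d / (i + 1)) else 0 := by
  rw [map_add, (summable_genFun_term f i).map_tsum _ (WithPiTopology.continuous_coeff _ _)]
  simp only [map_smul, coeff_X_pow, smul_eq_mul, mul_ite, mul_one, mul_zero, coeff_one]
  rcases Nat.eq_zero_or_pos d with rfl | hd
  · simp [hf0]
  rw [if_neg hd.ne', zero_add]
  split_ifs with h
  · obtain ⟨k, rfl⟩ := h
    obtain ⟨k, rfl⟩ : ∃ k', k = k' + 1 := Nat.exists_eq_add_one_of_ne_zero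
        (by rintro rfl; simp at hd)
    rw [tsum_eq_single k fun j hj => if_neg fun h => hj ?_]
    · simp
    · simpa using h.symm
  · rw [tsum_congr fun j => if_neg fun h' => h ⟨_, h'⟩, tsum_zero]

include hf0 hf1 hq in
lemma evalsTo_genFun_factor {i : ℕ} {v : ℂ}
    (hv : HasSum (fun j => f (i + 1) j * q ^ ((i + 1) * j)) v) :
    EvalsTo (1 + ∑' j, f (i + 1) (j + 1) • (X : ℂ⟦X⟧) ^ ((i + 1) * (j + 1))) q v := by
  constructor
  · refine Summable.of_nonneg_of_le (fun _ => norm_nonneg _) (fun n => ?_)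
      (summable_geometric_of_lt_one (norm_nonneg q) hq)
    rw [coeff_genFun_factor hf0, norm_mul, norm_pow]
    refine mul_le_of_le_one_left (by positivity) ?_
    split_ifs
    · exact hf1 _ _
    · simp
  · have hinj : Function.Injective fun j : ℕ => (i + 1) * j := fun a b h => by simpa using h
    refine (hinj.hasSum_iff fun n hn => ?_).1 (hv.of_eq (fun j => ?_) rfl)
    · rw [coeff_genFun_factor hf0, if_neg, zero_mul]
      rintro ⟨k, rfl⟩
      exact hn ⟨k, rfl⟩
    · rw [Function.comp_apply, coeff_genFun_factor hf0, if_pos (by simp)]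
      simp

include hf0 hf1 hq in
lemma evalsTo_genFun_of_le {K : ℕ} (hK : ∀ i j, K < i → j ≠ 0 → f i j = 0) {v : ℕ → ℂ}
    (hv : ∀ i, HasSum (fun j => f (i + 1) j * q ^ ((i + 1) * j)) (v i)) :
    EvalsTo (genFun f) q (∏ i ∈ Finset.range K, v i) := by
  have h := (hasProd_genFun f).unique (hasProd_prod_of_ne_finset_one (s := Finset.range K)
    fun i hi => by
      simp only [Finset.mem_range, not_lt] at hi
      rw [tsum_congr fun j => by rw [hK (i + 1) (j + 1) (by lia) (by simp), zero_smul]]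
      simp)
  rw [h]
  exact EvalsTo.prod _ fun i _ => evalsTo_genFun_factor hf0 hf1 hq (hv i)

/-- Restrict a weight on partitions to those with parts at most `K`. -/
def truncWeight (f : ℕ → ℕ → ℂ) (K i j : ℕ) : ℂ := if i ≤ K then f i j else if j = 0 then 1 else 0

include hf0 in
lemma truncWeight_zero (K i : ℕ) : truncWeight f K i 0 = 1 := by simp [truncWeight, hf0]

include hf1 in
lemma norm_truncWeight_le (K i j : ℕ) : ‖truncWeight f K i j‖ ≤ 1 := by
  unfold truncWeight
  split_ifs <;> simp [hf1]

include hf0 hf1 hq in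
lemma evalsTo_genFun_truncWeight (K : ℕ) {v : ℕ → ℂ}
    (hv : ∀ i, HasSum (fun j => f (i + 1) j * q ^ ((i + 1) * j)) (v i)) :
    EvalsTo (genFun (truncWeight f K)) q (∏ i ∈ Finset.range K, v i) := by
  have h := evalsTo_genFun_of_le (truncWeight_zero hf0 K) (norm_truncWeight_le hf1 K) hq (K := K)
    (fun i j hi hj => by simp [truncWeight, hi.not_ge, hj]) (v := fun i => if i < K then v i else 1)
    fun i => ?_
  · rwa [Finset.prod_congr rfl fun i hi => if_pos (Finset.mem_range.1 hi)] at h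
  · split_ifs with hi
    · refine (hv i).of_eq (fun j => ?_) rfl
      simp [truncWeight, Nat.succ_le_of_lt hi]
    · refine (hasSum_single 0 fun j hj => ?_).of_eq (fun _ => rfl) ?_
      · simp [truncWeight, hi, hj]
      · simp [truncWeight, hi]

lemma genFun_truncWeight_coeff {n K : ℕ} (h : n ≤ K) :
    coeff n (genFun (truncWeight f K)) = coeff n (genFun f) := by
  simp only [coeff_genFun]
  refine Finset.sum_congr rfl fun p _ => Finsupp.prod_congr fun i hi => ?_
  rw [Multiset.toFinsupp_support, Multiset.mem_toFinset] at hi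
  exact if_pos ((le_of_mem_parts hi).trans h)

include hf1 in
lemma norm_coeff_genFun_le (n : ℕ) : ‖coeff n (genFun f)‖ ≤ Fintype.card n.Partition := by
  rw [coeff_genFun]
  refine (norm_sum_le _ _).trans ?_
  rw [← nsmul_one, ← Finset.card_univ]
  refine Finset.sum_le_card_nsmul _ _ _ fun p _ => ?_
  rw [Finsupp.prod, norm_prod]
  exact Finset.prod_le_one (fun _ _ => norm_nonneg _) fun _ _ => hf1 _ _

lemma coeff_genFun_one (n : ℕ) :
    coeff n (genFun fun _ _ => (1 : ℂ)) = Fintype.card n.Partition := by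
  simp [Finsupp.prod]

include hq in
lemma hasSum_geometric_pow (i : ℕ) :
    HasSum (fun j => 1 * q ^ ((i + 1) * j)) (1 - q * q ^ i)⁻¹ := by
  have : ‖q ^ (i + 1)‖ < 1 := by
    rw [norm_pow]; exact pow_lt_one₀ (norm_nonneg _) hq (by simp)
  refine (hasSum_geometric_of_norm_lt_one this).of_eq (fun j => ?_) ?_
  · rw [one_mul, pow_mul]
  · rw [pow_succ']

include hq in
lemma summable_card_partition_mul_pow :
    Summable fun n : ℕ => (Fintype.card n.Partition : ℝ) * ‖q‖ ^ n := by
  have hq' : ‖((‖q‖ : ℝ) : ℂ)‖ < 1 := by simpa using hq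
  obtain ⟨C, hC⟩ : ∃ C : ℝ, ∀ K, ‖∏ i ∈ Finset.range K, (1 - ((‖q‖ : ℝ) : ℂ) * (‖q‖ : ℝ) ^ i)⁻¹‖ ≤
      C := by
    have h := ((tendsto_poch hq' (‖q‖ : ℝ)).inv₀ (poch_ne_zero_of_norm_lt hq' hq')).norm
    obtain ⟨C, hC⟩ := h.bddAbove_range
    refine ⟨C, fun K => ?_⟩
    rw [Finset.prod_inv_distrib]
    exact hC ⟨K, rfl⟩
  refine summable_of_sum_range_le (c := C) (fun n => by positivity) fun N => ?_
  have h := evalsTo_genFun_truncWeight (f := fun _ _ => 1) (fun _ => rfl) (fun _ _ => by simp) hq' N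
    (fun i => hasSum_geometric_pow hq' i)
  refine le_trans ?_ (hC N)
  have hre : HasSum (fun n => ‖coeff n (genFun (truncWeight (fun _ _ => 1) N))‖ * ‖q‖ ^ n)
      ‖∏ i ∈ Finset.range N, (1 - ((‖q‖ : ℝ) : ℂ) * (‖q‖ : ℝ) ^ i)⁻¹‖ := by
    have hnn : ∀ n, ∃ c : ℝ, 0 ≤ c ∧ coeff n (genFun (truncWeight (fun _ _ => 1) N)) = (c : ℂ) := by
      intro n
      refine ⟨∑ p : n.Partition, p.parts.toFinsupp.prod fun i j => if i ≤ N then 1 else if j =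
          0 then 1
        else 0, Finset.sum_nonneg fun p _ => Finset.prod_nonneg fun i _ => by
          dsimp only; split_ifs <;> norm_num, ?_⟩
      rw [coeff_genFun]
      push_cast
      refine Finset.sum_congr rfl fun p _ => ?_
      rw [Finsupp.prod, Finsupp.prod]
      push_cast
      refine Finset.prod_congr rfl fun i _ => ?_
      rw [truncWeight]
      split_ifs <;> simp
    choose c hc0 hc using hnn
    have h2 : HasSum (fun n => ((c n * ‖q‖ ^ n : ℝ) : ℂ)) _ :=
      h.2.of_eq (fun n => by rw [hc]; push_cast; rfl) rfl
    obtain ⟨x, hx⟩ : ∃ x : ℝ, (x : ℂ) = ∏ i ∈ Finset.range N,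
        (1 - ((‖q‖ : ℝ) : ℂ) * (‖q‖ : ℝ) ^ i)⁻¹ :=
      ⟨∏ i ∈ Finset.range N, (1 - ‖q‖ * ‖q‖ ^ i)⁻¹, by push_cast; rfl⟩
    rw [← hx] at h2 ⊢
    rw [Complex.hasSum_ofReal] at h2
    rw [Complex.norm_real, Real.norm_of_nonneg (h2.nonneg fun n => mul_nonneg (hc0 n)
      (by positivity))]
    simp only [hc, Complex.norm_real, Real.norm_of_nonneg (hc0 _)]
    exact h2
  refine le_trans (Finset.sum_le_sum fun n hn => ?_) (sum_le_hasSum (Finset.range N) (fun n _ => by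
      positivity) hre)
  rw [genFun_truncWeight_coeff (Finset.mem_range.1 hn).le, coeff_genFun_one]
  simp

include hf0 hf1 hq in
/-- The product formula for generating functions of partitions, as an identity of analytic
functions. -/
lemma hasSum_genFun {v : ℕ → ℂ} (hv : ∀ i, HasSum (fun j => f (i + 1) j * q ^ ((i + 1) * j)) (v i))
    {L : ℂ} (hL : Tendsto (fun K => ∏ i ∈ Finset.range K, v i) atTop (𝓝 L)) :
    HasSum (fun n => (∑ p : n.Partition, p.parts.toFinsupp.prod f) * q ^ n) L := by
  have hbd := summable_card_partition_mul_pow hq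
  have hle : ∀ {g : ℕ → ℕ → ℂ}, (∀ i j, ‖g i j‖ ≤ 1) → ∀ n, ‖coeff n (genFun g) * q ^ n‖ ≤
      Fintype.card n.Partition * ‖q‖ ^ n := fun hg n => by
    rw [norm_mul, norm_pow]
    gcongr
    exact norm_coeff_genFun_le hg n
  have h1 := tendsto_tsum_of_dominated_convergence (𝓕 := atTop)
    (f := fun K n => coeff n (genFun (truncWeight f K)) * q ^ n)
    (g := fun n => coeff n (genFun f) * q ^ n) hbd (fun n => ?_)
    (Eventually.of_forall fun K n => hle (norm_truncWeight_le hf1 K) n)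
  · simp only [(evalsTo_genFun_truncWeight hf0 hf1 hq _ hv).2.tsum_eq] at h1
    have hs : Summable fun n => coeff n (genFun f) * q ^ n :=
      Summable.of_norm (Summable.of_nonneg_of_le (fun _ => norm_nonneg _) (hle hf1) hbd)
    refine hs.hasSum.of_eq (fun n => ?_) (tendsto_nhds_unique hL h1)
    rw [coeff_genFun]
  · refine tendsto_const_nhds.congr' ?_
    filter_upwards [eventually_ge_atTop n] with K hK
    rw [genFun_truncWeight_coeff hK]

include hq in
lemma hasSum_card_partition : HasSum (fun n : ℕ => (Fintype.card n.Partition : ℂ) * q ^ n)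
    (poch q q)⁻¹ := by
  refine (hasSum_genFun (f := fun _ _ => 1) (fun _ => rfl) (fun _ _ => by simp) hq
    (fun i => hasSum_geometric_pow hq i) (L := (poch q q)⁻¹) ?_).of_eq (fun n => ?_) rfl
  · simp only [Finset.prod_inv_distrib]
    exact (tendsto_poch hq q).inv₀ (poch_ne_zero_of_norm_lt hq hq)
  · simp [Finsupp.prod]

end

end

/-! ### Conjugation of partitions -/

/-- The number of elements of `s` larger than `i`. -/
def numGT (s : Multiset ℕ) (i : ℕ) : ℕ := Multiset.card (s.filter (i < ·))

lemma numGT_antitone (s : Multiset ℕ) : Antitone (numGT s) := fun _ _ h =>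
  Multiset.card_le_card (Multiset.monotone_filter_right s fun _ hx => h.trans_lt hx)

lemma numGT_cons (a : ℕ) (s : Multiset ℕ) (i : ℕ) :
    numGT (a ::ₘ s) i = (if i < a then 1 else 0) + numGT s i := by
  rw [numGT, numGT, Multiset.filter_cons, Multiset.card_add]
  split_ifs <;> simp

lemma numGT_pos_iff {s : Multiset ℕ} {i : ℕ} : 0 < numGT s i ↔ i < s.sup := by
  induction s using Multiset.induction_on with
  | empty => simp [numGT]
  | cons a s ih =>
    rw [numGT_cons, Multiset.sup_cons, lt_sup_iff, ← ih]
    split_ifs with h <;> simp [h]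

lemma numGT_zero {s : Multiset ℕ} (hs : ∀ x ∈ s, 0 < x) : numGT s 0 = Multiset.card s := by
  rw [numGT, Multiset.filter_eq_self.2 hs]

lemma sum_range_numGT (s : Multiset ℕ) {K : ℕ} (hK : s.sup ≤ K) :
    ∑ i ∈ Finset.range K, numGT s i = s.sum := by
  induction s using Multiset.induction_on with
  | empty => simp [numGT]
  | cons a s ih =>
    rw [Multiset.sup_cons, sup_le_iff] at hK
    simp only [numGT_cons, Finset.sum_add_distrib, ih hK.2, Multiset.sum_cons]
    rw [← Finset.card_filter]
    congr 1
    rw [show (Finset.range K).filter (· < a) = Finset.range a by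
      ext i; simp only [Finset.mem_filter, Finset.mem_range]; omega, Finset.card_range]

lemma eq_of_numGT_eq {s t : Multiset ℕ} (hs : ∀ x ∈ s, 0 < x) (ht : ∀ x ∈ t, 0 < x)
    (h : numGT s = numGT t) : s = t := by
  have key : ∀ (u : Multiset ℕ) (a : ℕ), numGT u a = u.count (a + 1) + numGT u (a + 1) :=
      fun u a => by
    induction u using Multiset.induction_on with
    | empty => simp [numGT]
    | cons b u ih =>
      rw [numGT_cons, numGT_cons, Multiset.count_cons, ih]
      split_ifs <;> omega
  ext a
  cases a with
  | zero =>
    rw [Multiset.count_eq_zero.2 fun h => (hs 0 h).false,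
      Multiset.count_eq_zero.2 fun h => (ht 0 h).false]
  | succ a =>
    have h1 := key s a
    have h2 := key t a
    rw [h] at h1
    omega

/-- The conjugate of a multiset of positive integers. -/
def conjParts (s : Multiset ℕ) : Multiset ℕ := (Multiset.range s.sup).map (numGT s)

lemma lt_numGT_conjParts_iff (s : Multiset ℕ) (i j : ℕ) :
    i < numGT (conjParts s) j ↔ j < numGT s i := by
  have e : numGT (conjParts s) j = ((Finset.range s.sup).filter fun k => j < numGT s k).card := by
    rw [numGT, conjParts, Multiset.filter_map, Multiset.card_map]
    rfl
  rw [e]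
  constructor
  · intro h
    by_contra! hc
    have : ((Finset.range s.sup).filter fun k => j < numGT s k) ⊆ Finset.range i := fun k hk => by
      rw [Finset.mem_filter] at hk
      rw [Finset.mem_range]
      by_contra! hik
      exact (hk.2.trans_le ((numGT_antitone s hik).trans hc)).false
    have := Finset.card_le_card this
    rw [Finset.card_range] at this
    omega
  · intro h
    have : Finset.range (i + 1) ⊆ ((Finset.range s.sup).filter fun k => j < numGT s k) :=
        fun k hk => by
      rw [Finset.mem_range] at hk
      have h1 : j < numGT s k := h.trans_le (numGT_antitone s (Nat.lt_succ_iff.1 hk))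
      exact Finset.mem_filter.2 ⟨Finset.mem_range.2 (numGT_pos_iff.1 (by omega)), h1⟩
    have := Finset.card_le_card this
    rw [Finset.card_range] at this
    omega

lemma sup_conjParts {s : Multiset ℕ} (hs : ∀ x ∈ s, 0 < x) :
    (conjParts s).sup = Multiset.card s := by
  rw [← numGT_zero hs]
  refine eq_of_forall_lt_iff fun c => ?_
  rw [← numGT_pos_iff, lt_numGT_conjParts_iff]

lemma conjParts_pos {s : Multiset ℕ} : ∀ x ∈ conjParts s, 0 < x := fun x hx => by
  obtain ⟨i, hi, rfl⟩ := Multiset.mem_map.1 hx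
  exact numGT_pos_iff.2 (Multiset.mem_range.1 hi)

/-- The conjugate partition. -/
def conj {n : ℕ} (π : n.Partition) : n.Partition where
  parts := conjParts π.parts
  parts_pos := fun h => conjParts_pos _ h
  parts_sum := (sum_range_numGT π.parts le_rfl).trans π.parts_sum

lemma conj_injective {n : ℕ} : Function.Injective (conj (n := n)) := fun π ρ h => by
  have h' : conjParts π.parts = conjParts ρ.parts := congrArg Nat.Partition.parts h
  refine Nat.Partition.ext (eq_of_numGT_eq (fun _ => π.parts_pos) (fun _ => ρ.parts_pos) ?_)
  funext i
  refine eq_of_forall_lt_iff fun j => ?_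
  rw [← lt_numGT_conjParts_iff, h', lt_numGT_conjParts_iff]

/-- Conjugation as a bijection. -/
noncomputable def conjEquiv (n : ℕ) : n.Partition ≃ n.Partition :=
  Equiv.ofBijective conj (Finite.injective_iff_bijective.1 conj_injective)

lemma numParts_conj {n : ℕ} (π : n.Partition) : numParts (conj π) = largestPart π := by
  simp [numParts, conj, conjParts, largestPart]

lemma largestPart_conj {n : ℕ} (π : n.Partition) : largestPart (conj π) = numParts π :=
  sup_conjParts fun _ => π.parts_pos

lemma rank_conj {n : ℕ} (π : n.Partition) : rank (conj π) = -rank π := by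
  rw [rank, rank, numParts_conj, largestPart_conj, neg_sub]

lemma sum_conj {n : ℕ} {M : Type*} [AddCommMonoid M] (f : n.Partition → M) :
    ∑ π, f (conj π) = ∑ π, f π := (conjEquiv n).sum_comp f

/-- The sum of the ranks of the partitions of `n` with rank congruent to `1` modulo `5`. -/
def rankSum (n : ℕ) : ℤ := ∑ π : n.Partition, if rank π % 5 = 1 then rank π else 0

lemma NT_one_sub_NT_four (n : ℕ) : NT 1 5 n - NT 4 5 n = -rankSum n := by
  rw [NT, NT, rankSum, ← sum_conj fun π : n.Partition => if rank π % ((5 : ℕ) : ℤ) =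
    ((4 : ℕ) : ℤ) % ((5 : ℕ) : ℤ)
    then (numParts π : ℤ) else 0, ← Finset.sum_neg_distrib, ← Finset.sum_sub_distrib]
  refine Finset.sum_congr rfl fun π _ => ?_
  rw [rank_conj, numParts_conj]
  have e : rank π = (largestPart π : ℤ) - numParts π := rfl
  split_ifs <;> omega

/-- The number of partitions of `n` of rank at least `m`. -/
def numRankGE (m n : ℕ) : ℕ := (Finset.univ.filter fun π : n.Partition => (m : ℤ) ≤ rank π).card

lemma numRankGE_eq_zero {m n : ℕ} (hm : 0 < m) (h : n ≤ m) : numRankGE m n = 0 := by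
  rw [numRankGE, Finset.card_eq_zero, Finset.filter_eq_empty_iff]
  intro π _ hr
  rw [rank] at hr
  have h1 : largestPart π ≤ n := Multiset.sup_le.2 fun b hb => π.le_of_mem_parts hb
  have h2 : numParts π ≠ 0 := fun h0 => by
    have h3 : π.parts = 0 := Multiset.card_eq_zero.1 h0
    have : largestPart π = 0 := by rw [largestPart, h3]; rfl
    omega
  omega

lemma numRankGE_le (m n : ℕ) : numRankGE m n ≤ Fintype.card n.Partition := Finset.card_filter_le _ _

lemma rankSum_eq (n : ℕ) : rankSum n = ∑ j ∈ Finset.range (n + 1),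
    ((5 * j + 1 : ℤ) * (numRankGE (5 * j + 1) n - numRankGE (5 * j + 2) n) -
      (5 * j + 4 : ℤ) * (numRankGE (5 * j + 4) n - numRankGE (5 * j + 5) n)) := by
  have hN : ∀ m : ℕ, (numRankGE m n : ℤ) - numRankGE (m + 1) n =
      ∑ π : n.Partition, if rank π = m then 1 else 0 := fun m => by
    rw [numRankGE, numRankGE, Finset.card_filter, Finset.card_filter]
    push_cast
    rw [← Finset.sum_sub_distrib]
    refine Finset.sum_congr rfl fun π _ => ?_
    split_ifs <;> omega
  have h1 : ∀ j : ℕ, ((5 * j + 1 : ℤ) * (numRankGE (5 * j + 1) n - numRankGE (5 * j + 2) n) -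
      (5 * j + 4 : ℤ) * (numRankGE (5 * j + 4) n - numRankGE (5 * j + 5) n)) =
      ∑ π : n.Partition, ((if rank π = 5 * j + 1 then (5 * j + 1 : ℤ) else 0) -
        (if -rank π = 5 * j + 4 then (5 * j + 4 : ℤ) else 0)) := fun j => by
    rw [hN (5 * j + 1), hN (5 * j + 4), ← sum_conj fun π : n.Partition => if rank π =
      ((5 * j + 4 : ℕ) : ℤ)
      then (1 : ℤ) else 0, Finset.mul_sum, Finset.mul_sum, ← Finset.sum_sub_distrib]
    refine Finset.sum_congr rfl fun π _ => ?_
    rw [rank_conj]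
    push_cast
    simp only [mul_ite, mul_one, mul_zero]
  simp only [h1]
  rw [Finset.sum_comm, rankSum]
  refine Finset.sum_congr rfl fun π _ => ?_
  have hle : |rank π| ≤ n := by
    have h1 : largestPart π ≤ n := Multiset.sup_le.2 fun b hb => π.le_of_mem_parts hb
    have h2 : numParts π ≤ n := by
      rw [← largestPart_conj]
      exact Multiset.sup_le.2 fun b hb => (conj π).le_of_mem_parts hb
    rw [rank, abs_le]
    omega
  rw [abs_le] at hle
  generalize rank π = r at hle ⊢
  split_ifs with hr
  · rcases le_or_gt 0 r with h0 | h0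
    · rw [Finset.sum_eq_single (r / 5).toNat]
      · rw [if_pos (by omega), if_neg (by omega)]
        omega
      · intro j _ hj
        rw [if_neg (by omega), if_neg (by omega), sub_zero]
      · intro h
        rw [Finset.mem_range] at h
        omega
    · rw [Finset.sum_eq_single (-r / 5).toNat]
      · rw [if_neg (by omega), if_pos (by omega)]
        omega
      · intro j _ hj
        rw [if_neg (by omega), if_neg (by omega), sub_zero]
      · intro h
        rw [Finset.mem_range] at h
        omega
  · refine (Finset.sum_eq_zero fun j _ => ?_).symm
    rw [if_neg (by omega), if_neg (by omega), sub_zero]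

/-! ### Dyson's bijection -/

/-- Remove the first column and add a new largest part exceeding the number of rows by `r`. -/
def dysonParts (r : ℕ) (s : Multiset ℕ) : Multiset ℕ :=
  (Multiset.card s + r) ::ₘ ((s.map (· - 1)).filter (0 < ·))

/-- The inverse of `dysonParts`. -/
def dysonPartsInv (r : ℕ) (t : Multiset ℕ) : Multiset ℕ :=
  (t.erase t.sup).map (· + 1) + Multiset.replicate (t.sup - r - Multiset.card (t.erase t.sup)) 1

lemma sup_mem {t : Multiset ℕ} (ht : t ≠ 0) : t.sup ∈ t := by
  induction t using Multiset.induction_on with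
  | empty => exact absurd rfl ht
  | cons a t ih =>
    rw [Multiset.sup_cons]
    rcases eq_or_ne t 0 with rfl | h
    · simp
    · rcases le_total a t.sup with h' | h'
      · rw [sup_eq_right.2 h']
        exact Multiset.mem_cons_of_mem (ih h)
      · rw [sup_eq_left.2 h']
        exact Multiset.mem_cons_self _ _

lemma sum_map_pred {s : Multiset ℕ} (hs : ∀ x ∈ s, 0 < x) :
    ((s.map (· - 1)).filter (0 < ·)).sum + Multiset.card s = s.sum := by
  induction s using Multiset.induction_on with
  | empty => simp
  | cons a s ih =>
    have ha := hs a (Multiset.mem_cons_self _ _)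
    have := ih fun x hx => hs x (Multiset.mem_cons_of_mem hx)
    rw [Multiset.map_cons, Multiset.filter_cons, Multiset.sum_add, Multiset.card_cons,
      Multiset.sum_cons]
    split_ifs with h
    · rw [Multiset.sum_singleton]; omega
    · rw [Multiset.sum_zero]; omega

lemma dysonParts_inv_aux {s : Multiset ℕ} (hs : ∀ x ∈ s, 0 < x) :
    ((s.map (· - 1)).filter (0 < ·)).map (· + 1) +
      Multiset.replicate (Multiset.card s - Multiset.card ((s.map (· - 1)).filter (0 < ·))) 1 =
          s := by
  induction s using Multiset.induction_on with
  | empty => simp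
  | cons a s ih =>
    have ha := hs a (Multiset.mem_cons_self _ _)
    have h1 := ih fun x hx => hs x (Multiset.mem_cons_of_mem hx)
    have h2 : Multiset.card ((s.map (· - 1)).filter (0 < ·)) ≤ Multiset.card s :=
      (Multiset.card_le_card (Multiset.filter_le _ _)).trans (Multiset.card_map _ _).le
    rw [Multiset.map_cons, Multiset.card_cons]
    by_cases h : 0 < a - 1
    · rw [Multiset.filter_cons_of_pos _ h, Multiset.map_cons, Multiset.card_cons, Multiset.cons_add,
        Nat.add_sub_add_right, h1, Nat.sub_add_cancel ha]
    · rw [Multiset.filter_cons_of_neg _ h, Nat.sub_add_comm h2, Multiset.replicate_succ,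
        Multiset.add_cons, h1]
      congr 1
      omega

/-- Dyson's relation between the numbers of partitions with bounded rank. -/
lemma numRankGE_add {m : ℕ} (n : ℕ) :
    numRankGE m (n + (m + 1)) + numRankGE (m + 3) n = Fintype.card n.Partition := by
  have hsup : ∀ {k : ℕ} (π : n.Partition), (∀ x ∈ π.parts, x ≤ k) → π.parts.sup ≤ k := fun π h =>
    Multiset.sup_le.2 h
  have key : (Finset.univ.filter fun π : n.Partition => ¬ ((m + 3 : ℕ) : ℤ) ≤ rank π).card =
      numRankGE m (n + (m + 1)) := by
    have hS : ∀ π : n.Partition, ¬ ((m + 3 : ℕ) : ℤ) ≤ rank π →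
        (dysonParts (m + 1) π.parts).sup = Multiset.card π.parts + (m + 1) := fun π h => by
      rw [dysonParts, Multiset.sup_cons, sup_eq_left, Multiset.sup_le]
      intro b hb
      obtain ⟨a, ha, rfl⟩ := Multiset.mem_map.1 (Multiset.mem_filter.1 hb).1
      have h1 : a ≤ π.parts.sup := Multiset.le_sup ha
      rw [rank, largestPart, numParts] at h
      omega
    have hT : ∀ ρ : (n + (m + 1)).Partition, (m : ℤ) ≤ rank ρ →
        ρ.parts.sup ∈ ρ.parts ∧ Multiset.card (ρ.parts.erase ρ.parts.sup) + (m + 1) ≤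
            ρ.parts.sup := by
      intro ρ h
      have h0 : ρ.parts ≠ 0 := fun h0 => by
        have := ρ.parts_sum
        rw [h0, Multiset.sum_zero] at this
        omega
      have h1 := sup_mem h0
      refine ⟨h1, ?_⟩
      rw [Multiset.card_erase_of_mem h1]
      have := Multiset.card_pos.2 h0
      rw [rank, largestPart, numParts] at h
      rw [Nat.pred_eq_sub_one]
      omega
    refine Finset.card_bij'
      (i := fun π _ => ⟨dysonParts (m + 1) π.parts, fun {i} hi => ?_, ?_⟩)
      (j := fun ρ hρ => ⟨dysonPartsInv (m + 1) ρ.parts, fun {i} hi => ?_, ?_⟩) ?_ ?_ ?_ ?_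
    · rcases Multiset.mem_cons.1 hi with rfl | hi
      · omega
      · exact (Multiset.mem_filter.1 hi).2
    · rw [dysonParts, Multiset.sum_cons]
      have := sum_map_pred fun _ => π.parts_pos
      have := π.parts_sum
      omega
    · rcases Multiset.mem_add.1 hi with hi | hi
      · obtain ⟨a, _, rfl⟩ := Multiset.mem_map.1 hi
        omega
      · rw [Multiset.eq_of_mem_replicate hi]
        omega
    · obtain ⟨h1, h2⟩ := hT ρ (Finset.mem_filter.1 hρ).2
      have h3 := Multiset.sum_erase h1
      have h4 := ρ.parts_sum
      rw [dysonPartsInv, Multiset.sum_add, Multiset.sum_replicate, Multiset.sum_map_add,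
        Multiset.map_id', Multiset.map_const', Multiset.sum_replicate]
      simp only [smul_eq_mul, mul_one]
      omega
    · intro π hπ
      have h := (Finset.mem_filter.1 hπ).2
      refine Finset.mem_filter.2 ⟨Finset.mem_univ _, ?_⟩
      have h2 : Multiset.card ((π.parts.map (· - 1)).filter (0 < ·)) ≤ Multiset.card π.parts :=
        (Multiset.card_le_card (Multiset.filter_le _ _)).trans (Multiset.card_map _ _).le
      rw [rank, largestPart, numParts]
      dsimp only
      rw [hS π h, dysonParts, Multiset.card_cons]
      push_cast
      omega
    · intro ρ hρ
      obtain ⟨h1, h2⟩ := hT ρ (Finset.mem_filter.1 hρ).2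
      refine Finset.mem_filter.2 ⟨Finset.mem_univ _, ?_⟩
      rw [rank, largestPart, numParts]
      dsimp only
      have h3 : (dysonPartsInv (m + 1) ρ.parts).sup ≤ ρ.parts.sup + 1 := by
        rw [dysonPartsInv, Multiset.sup_add, sup_le_iff, Multiset.sup_le, Multiset.sup_le]
        refine ⟨fun b hb => ?_, fun b hb => ?_⟩
        · obtain ⟨a, ha, rfl⟩ := Multiset.mem_map.1 hb
          exact Nat.succ_le_succ (Multiset.le_sup (Multiset.mem_of_mem_erase ha))
        · rw [Multiset.eq_of_mem_replicate hb]
          omega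
      have h4 : Multiset.card (dysonPartsInv (m + 1) ρ.parts) = ρ.parts.sup - (m + 1) := by
        rw [dysonPartsInv, Multiset.card_add, Multiset.card_map, Multiset.card_replicate]
        omega
      rw [h4]
      omega
    · intro π hπ
      have h := (Finset.mem_filter.1 hπ).2
      refine Nat.Partition.ext ?_
      dsimp only
      rw [dysonPartsInv, hS π h, dysonParts, Multiset.erase_cons_head, Nat.add_sub_cancel,
        dysonParts_inv_aux fun _ => π.parts_pos]
    · intro ρ hρ
      obtain ⟨h1, h2⟩ := hT ρ (Finset.mem_filter.1 hρ).2
      refine Nat.Partition.ext ?_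
      dsimp only
      have h4 : Multiset.card (dysonPartsInv (m + 1) ρ.parts) = ρ.parts.sup - (m + 1) := by
        rw [dysonPartsInv, Multiset.card_add, Multiset.card_map, Multiset.card_replicate]
        omega
      rw [dysonParts, h4, Nat.sub_add_cancel (by omega), dysonPartsInv, Multiset.map_add,
        Multiset.map_map, Multiset.filter_add, Multiset.map_replicate]
      have e1 : ((ρ.parts.erase ρ.parts.sup).map ((· - 1) ∘ (· + 1))).filter (0 < ·) =
          ρ.parts.erase ρ.parts.sup := by
        rw [show ((· - 1) ∘ (· + 1) : ℕ → ℕ) = id from funext fun x => by simp, Multiset.map_id]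
        exact Multiset.filter_eq_self.2 fun a ha => ρ.parts_pos (Multiset.mem_of_mem_erase ha)
      rw [e1, Multiset.filter_eq_nil.2 (fun a ha => by rw [Multiset.eq_of_mem_replicate ha]; omega),
        add_zero, Multiset.cons_erase h1]
  rw [← key, numRankGE, add_comm, Finset.card_filter_add_card_filter_not]
  rfl

/-! ### The generating function of the rank sums -/

lemma exists_hasSum_swap {f : ℕ → ℕ → ℂ} (hf : Summable fun p : ℕ × ℕ => f p.1 p.2) {g h : ℕ → ℂ}
    (hg : ∀ j, HasSum (f j) (g j)) (hh : ∀ k, HasSum (fun j => f j k) (h k)) :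
    ∃ S, HasSum g S ∧ HasSum h S :=
  ⟨∑' p : ℕ × ℕ, f p.1 p.2, hf.hasSum.prod_fiberwise hg,
    ((Equiv.prodComm ℕ ℕ).hasSum_iff.2 hf.hasSum).prod_fiberwise hh⟩

lemma numRankGE_antitone (n : ℕ) : Antitone fun m => numRankGE m n := fun a b h =>
  Finset.card_le_card (Finset.monotone_filter_right _ fun π _ hb =>
    (show (a : ℤ) ≤ b by exact_mod_cast h).trans hb)

section

variable {q : ℂ} (hq : ‖q‖ < 1)

include hq in
lemma hasSum_numRankGE_norm {m : ℕ} (hm : 0 < m) :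
    ∃ c : ℝ, 0 ≤ c ∧ c ≤ ‖q‖ ^ m * ∑' n : ℕ, (Fintype.card n.Partition : ℝ) * ‖q‖ ^ n ∧
      HasSum (fun n => (numRankGE m n : ℝ) * ‖q‖ ^ n) c := by
  have hp := summable_card_partition_mul_pow hq
  have h1 : ∀ n : ℕ, (numRankGE m (n + (m + 1)) : ℝ) * ‖q‖ ^ (n + (m + 1)) ≤
      ‖q‖ ^ m * ((Fintype.card n.Partition : ℝ) * ‖q‖ ^ n) := fun n => by
    have h2 : (numRankGE m (n + (m + 1)) : ℝ) ≤ Fintype.card n.Partition := by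
      exact_mod_cast (Nat.le_add_right _ _).trans (numRankGE_add (m := m) n).le
    have h3 : ‖q‖ ^ (n + (m + 1)) ≤ ‖q‖ ^ m * ‖q‖ ^ n := by
      rw [← pow_add]
      exact pow_le_pow_of_le_one (norm_nonneg _) hq.le (by omega)
    calc (numRankGE m (n + (m + 1)) : ℝ) * ‖q‖ ^ (n + (m + 1))
        ≤ Fintype.card n.Partition * (‖q‖ ^ m * ‖q‖ ^ n) := by gcongr
      _ = _ := by ring
  have h0 : ∑ n ∈ Finset.range (m + 1), (numRankGE m n : ℝ) * ‖q‖ ^ n = 0 :=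
    Finset.sum_eq_zero fun n hn => by
      rw [numRankGE_eq_zero hm (Nat.lt_succ_iff.1 (Finset.mem_range.1 hn)), Nat.cast_zero, zero_mul]
  have hs := Summable.of_nonneg_of_le (fun n => by positivity) h1 (hp.mul_left _)
  refine ⟨_, tsum_nonneg fun n => by positivity,
    (hs.tsum_le_tsum h1 (hp.mul_left _)).trans tsum_mul_left.le, ?_⟩
  have := (hasSum_nat_add_iff (f := fun n => (numRankGE m n : ℝ) * ‖q‖ ^ n) (m + 1)).1 hs.hasSum
  rwa [h0, add_zero] at this

include hq in
lemma summable_numRankGE (m : ℕ) : Summable fun n => (numRankGE m n : ℂ) * q ^ n := by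
  refine Summable.of_norm_bounded (summable_card_partition_mul_pow hq) fun n => ?_
  rw [norm_mul, norm_pow, Complex.norm_natCast]
  gcongr
  exact numRankGE_le m n

/-- The generating function of partitions of rank at least `m`. -/
noncomputable def rankGE (q : ℂ) (m : ℕ) : ℂ := ∑' n, (numRankGE m n : ℂ) * q ^ n

include hq in
lemma norm_rankGE_le (m : ℕ) :
    ‖rankGE q m‖ ≤ ∑' n : ℕ, (Fintype.card n.Partition : ℝ) * ‖q‖ ^ n := by
  refine tsum_of_norm_bounded (summable_card_partition_mul_pow hq).hasSum fun n => ?_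
  rw [norm_mul, norm_pow, Complex.norm_natCast]
  gcongr
  exact numRankGE_le m n

include hq in
lemma rankGE_eq {m : ℕ} (hm : 0 < m) :
    rankGE q m = q ^ (m + 1) * ((poch q q)⁻¹ - rankGE q (m + 3)) := by
  have h0 : ∑ n ∈ Finset.range (m + 1), (numRankGE m n : ℂ) * q ^ n = 0 :=
    Finset.sum_eq_zero fun n hn => by
      rw [numRankGE_eq_zero hm (Nat.lt_succ_iff.1 (Finset.mem_range.1 hn)), Nat.cast_zero, zero_mul]
  rw [rankGE, ← (summable_numRankGE hq m).sum_add_tsum_nat_add (m + 1), h0, zero_add]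
  refine HasSum.tsum_eq
      ((((hasSum_card_partition hq).sub (summable_numRankGE hq (m + 3)).hasSum).mul_left
    (q ^ (m + 1))).of_eq (fun n => ?_) rfl)
  rw [← numRankGE_add (m := m) n]
  push_cast
  ring

end

section

variable {s : ℂ} (hs : ‖s‖ < 1)

/-- The `k`-th term of the expansion of `rankGE (s ^ 2) m`. -/
noncomputable def rankTerm (s : ℂ) (m k : ℕ) : ℂ :=
  (-1) ^ k * s ^ (2 * (k + 1) * m + (k + 1) * (3 * k + 2))

include hs in
lemma norm_rankTerm_le (m k : ℕ) : ‖rankTerm s m k‖ ≤ ‖s‖ ^ (m + k) := by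
  rw [rankTerm, norm_mul, norm_pow, norm_neg, norm_one, one_pow, one_mul, norm_pow]
  exact pow_le_pow_of_le_one (norm_nonneg _) hs.le (by nlinarith [Nat.zero_le (k * m)])

include hs in
lemma summable_rankTerm (m : ℕ) : Summable (rankTerm s m) :=
  Summable.of_norm_bounded (g := fun k => ‖s‖ ^ m * ‖s‖ ^ k)
    ((summable_geometric_of_lt_one (norm_nonneg _) hs).mul_left _)
    fun k => (norm_rankTerm_le hs m k).trans (pow_add _ _ _).le

include hs in
lemma tsum_rankTerm (m : ℕ) :
    ∑' k, rankTerm s m k = (s ^ 2) ^ (m + 1) * (1 - ∑' k, rankTerm s (m + 3) k) := by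
  rw [(summable_rankTerm hs m).tsum_eq_zero_add, mul_sub, mul_one, sub_eq_add_neg, ← tsum_mul_left,
    ← tsum_neg]
  congr 1
  · simp only [rankTerm]
    ring
  · refine tsum_congr fun k => ?_
    simp only [rankTerm]
    ring

include hs in
lemma norm_tsum_rankTerm_le (m : ℕ) : ‖∑' k, rankTerm s m k‖ ≤ (1 - ‖s‖)⁻¹ :=
  tsum_of_norm_bounded (hasSum_geometric_of_lt_one (norm_nonneg _) hs) fun k =>
    (norm_rankTerm_le hs m k).trans (pow_le_pow_of_le_one (norm_nonneg _) hs.le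
        (Nat.le_add_left _ _))

include hs in
lemma norm_sq_lt_one : ‖s ^ 2‖ < 1 := by
  rw [norm_pow]
  exact pow_lt_one₀ (norm_nonneg _) hs two_ne_zero

include hs in
lemma rankGE_eq_tsum {m : ℕ} (hm : 0 < m) :
    rankGE (s ^ 2) m = (poch (s ^ 2) (s ^ 2))⁻¹ * ∑' k, rankTerm s m k := by
  have hq := norm_sq_lt_one hs
  set P := (poch (s ^ 2) (s ^ 2))⁻¹
  set D : ℕ → ℂ := fun m => rankGE (s ^ 2) m - P * ∑' k, rankTerm s m k with hD
  obtain ⟨B, hB⟩ : ∃ B : ℝ, ∀ m, ‖D m‖ ≤ B := ⟨_, fun m => (norm_sub_le _ _).trans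
    (add_le_add (norm_rankGE_le hq m) ((norm_mul _ _).le.trans
      (mul_le_mul_of_nonneg_left (norm_tsum_rankTerm_le hs m) (norm_nonneg P))))⟩
  have hrec : ∀ m, 0 < m → D m = -(s ^ 2) ^ (m + 1) * D (m + 3) := fun m hm => by
    simp only [hD]
    rw [rankGE_eq hq hm, tsum_rankTerm hs m]
    ring
  have hle : ∀ K m, 0 < m → ‖D m‖ ≤ ‖s ^ 2‖ ^ K * B := fun K => by
    induction K with
    | zero => intro m _; simpa using hB m
    | succ K ih =>
      intro m hm
      rw [hrec m hm, norm_mul, norm_neg, norm_pow _ (m + 1), pow_succ' _ K, mul_assoc]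
      refine mul_le_mul ?_ (ih _ (by omega)) (norm_nonneg _) (norm_nonneg _)
      rw [pow_succ]
      exact mul_le_of_le_one_left (norm_nonneg _) (pow_le_one₀ (norm_nonneg _) hq.le)
  have hlim : Tendsto (fun K => ‖s ^ 2‖ ^ K * B) atTop (𝓝 0) := by
    simpa using (tendsto_pow_atTop_nhds_zero_of_lt_one (norm_nonneg _) hq).mul_const B
  have h0 : ‖D m‖ ≤ 0 := ge_of_tendsto' hlim fun K => hle K m hm
  exact sub_eq_zero.1 (norm_le_zero_iff.1 h0)

/-- The combination of `f` that yields rank sums. -/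
def rankComb (f : ℕ → ℂ) (j : ℕ) : ℂ :=
  (5 * j + 1) * (f (5 * j + 1) - f (5 * j + 2)) - (5 * j + 4) * (f (5 * j + 4) - f (5 * j + 5))

lemma norm_rankComb_le {f : ℕ → ℂ} {j : ℕ} {B : ℝ} (hf : ∀ m, 5 * j + 1 ≤ m → ‖f m‖ ≤ B) :
    ‖rankComb f j‖ ≤ 4 * (5 * j + 4) * B := by
  have hB : 0 ≤ B := (norm_nonneg _).trans (hf (5 * j + 1) le_rfl)
  have e1 : ‖(5 * j + 1 : ℂ)‖ ≤ 5 * j + 4 := by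
    have : (5 * j + 1 : ℂ) = ((5 * j + 1 : ℕ) : ℂ) := by push_cast; ring
    rw [this, Complex.norm_natCast]
    push_cast
    linarith
  have e4 : ‖(5 * j + 4 : ℂ)‖ ≤ 5 * j + 4 := by
    have : (5 * j + 4 : ℂ) = ((5 * j + 4 : ℕ) : ℂ) := by push_cast; ring
    rw [this, Complex.norm_natCast]
    push_cast
    linarith
  have d1 := (norm_sub_le (f (5 * j + 1)) (f (5 * j + 2))).trans
    (add_le_add (hf _ (by omega)) (hf _ (by omega)))
  have d4 := (norm_sub_le (f (5 * j + 4)) (f (5 * j + 5))).trans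
    (add_le_add (hf _ (by omega)) (hf _ (by omega)))
  calc ‖rankComb f j‖ ≤ ‖(5 * j + 1 : ℂ)‖ * ‖f (5 * j + 1) - f (5 * j + 2)‖ +
        ‖(5 * j + 4 : ℂ)‖ * ‖f (5 * j + 4) - f (5 * j + 5)‖ := by
        rw [← norm_mul, ← norm_mul]
        exact norm_sub_le _ _
    _ ≤ (5 * j + 4) * (B + B) + (5 * j + 4) * (B + B) := by gcongr
    _ = _ := by ring

lemma HasSum.rankComb {f : ℕ → ℕ → ℂ} {g : ℕ → ℂ} {j : ℕ}
    (h : ∀ m, 0 < m → HasSum (f m) (g m)) :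
    HasSum (fun n => rankComb (fun m => f m n) j) (rankComb g j) :=
  (((h _ (by omega)).sub (h _ (by omega))).mul_left _).sub
    (((h _ (by omega)).sub (h _ (by omega))).mul_left _)

lemma summable_linear_mul_pow {r : ℝ} (h0 : 0 ≤ r) (h1 : r < 1) :
    Summable fun j : ℕ => 4 * (5 * j + 4) * r ^ j := by
  have h := summable_pow_mul_geometric_of_norm_lt_one (R := ℝ) 1 (r := r)
      (by rwa [Real.norm_of_nonneg h0])
  refine ((h.mul_left 20).add ((summable_geometric_of_lt_one h0 h1).mul_left 16)).congr fun j => ?_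
  rw [pow_one]
  ring

lemma summable_prod_mul {w c : ℕ → ℝ} {F : ℕ → ℕ → ℝ} (hw : ∀ j, 0 ≤ w j) (hF : ∀ j n, 0 ≤ F j n)
    (hc : ∀ j, HasSum (F j) (c j)) (h : Summable fun j => w j * c j) :
    Summable fun p : ℕ × ℕ => w p.1 * F p.1 p.2 := by
  have h1 : ∀ j, HasSum (fun n => w j * F j n) (w j * c j) := fun j => (hc j).mul_left (w j)
  refine (summable_prod_of_nonneg (f := fun p : ℕ × ℕ => w p.1 * F p.1 p.2)
    fun p => mul_nonneg (hw p.1) (hF p.1 p.2)).2 ⟨fun j => (h1 j).summable, h.congr fun j => ?_⟩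
  exact (h1 j).tsum_eq.symm

lemma hasSum_rankSum_mul_pow {q : ℂ} (hq : ‖q‖ < 1) :
    ∃ S, HasSum (fun n => (rankSum n : ℂ) * q ^ n) S ∧ HasSum (rankComb (rankGE q)) S := by
  have hf : Summable fun p : ℕ × ℕ => rankComb (fun m => (numRankGE m p.2 : ℂ) * q ^ p.2) p.1 := by
    have hb : ∀ j n : ℕ, ‖rankComb (fun m => (numRankGE m n : ℂ) * q ^ n) j‖ ≤
        4 * (5 * j + 4) * ((numRankGE (5 * j + 1) n : ℝ) * ‖q‖ ^ n) := fun j n =>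
      norm_rankComb_le fun m hm => by
        rw [norm_mul, norm_pow, Complex.norm_natCast]
        gcongr
        exact numRankGE_antitone n hm
    choose c hc0 hc1 hc2 using fun j : ℕ => hasSum_numRankGE_norm hq (m := 5 * j + 1) (by omega)
    set C := ∑' n : ℕ, (Fintype.card n.Partition : ℝ) * ‖q‖ ^ n
    have hC : 0 ≤ C := tsum_nonneg fun n => by positivity
    refine Summable.of_norm_bounded (summable_prod_mul (w := fun j => 4 * (5 * j + 4))
      (F := fun j n => (numRankGE (5 * j + 1) n : ℝ) * ‖q‖ ^ n) (fun j => by positivity)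
      (fun j n => by positivity) hc2 ?_) fun p => hb p.1 p.2
    refine Summable.of_nonneg_of_le (fun j => mul_nonneg (by positivity) (hc0 j)) (fun j => ?_)
      ((summable_linear_mul_pow (norm_nonneg q) hq).mul_right C)
    rw [mul_assoc _ _ C]
    gcongr
    refine (hc1 j).trans ?_
    gcongr ?_ * _
    exact pow_le_pow_of_le_one (norm_nonneg _) hq.le (by omega)
  refine (exists_hasSum_swap (f := fun j n => rankComb (fun m => (numRankGE m n : ℂ) * q ^ n) j) hf
    (fun j => HasSum.rankComb fun m _ => (summable_numRankGE hq m).hasSum) fun n => ?_).imp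
      fun _ h => h.symm
  have h : ∀ j, j ∉ Finset.range (n + 1) → rankComb (fun m => (numRankGE m n : ℂ) * q ^ n) j = 0 :=
    fun j hj => by
      rw [Finset.mem_range] at hj
      simp only [rankComb]
      rw [numRankGE_eq_zero (by omega) (by omega), numRankGE_eq_zero (by omega) (by omega),
        numRankGE_eq_zero (by omega) (by omega), numRankGE_eq_zero (by omega) (by omega)]
      simp
  refine (hasSum_sum_of_ne_finset_zero h).of_eq (fun _ => rfl) ?_
  rw [rankSum_eq]
  push_cast
  rw [Finset.sum_mul]
  refine Finset.sum_congr rfl fun j _ => ?_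
  simp only [rankComb]
  ring

lemma hasSum_rankComb_pow {x : ℂ} (hx : ‖x‖ < 1) :
    HasSum (rankComb fun m => x ^ m)
        ((1 - x) * (x * ((1 - x ^ 5)⁻¹ + 5 * (x ^ 5 * ((1 - x ^ 5)⁻¹) ^ 2)) -
      x ^ 4 * (4 * (1 - x ^ 5)⁻¹ + 5 * (x ^ 5 * ((1 - x ^ 5)⁻¹) ^ 2)))) := by
  have hx5 := norm_pow_five_lt_one hx
  have h1 := hasSum_geometric_of_norm_lt_one hx5
  have h2 := hasSum_coe_mul_geometric_of_norm_lt_one hx5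
  refine ((((h2.mul_left 5).add h1).mul_left (x * (1 - x))).sub
    (((h2.mul_left 5).add (h1.mul_left 4)).mul_left (x ^ 4 * (1 - x)))).of_eq (fun j => ?_) ?_
  · simp only [rankComb]
    ring
  · rw [div_eq_mul_inv, ← inv_pow]
    ring

include hs in
lemma exists_hasSum_rankComb_rankTerm : ∃ S, HasSum (rankComb fun m => ∑' k, rankTerm s m k) S ∧
    HasSum (fun k : ℕ => (-1) ^ k * s ^ ((k + 1) * (3 * k + 2)) *
      ((1 - s ^ (2 * (k + 1))) * (s ^ (2 * (k + 1)) * ((1 - s ^ (10 * (k + 1)))⁻¹ +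
        5 * (s ^ (10 * (k + 1)) * ((1 - s ^ (10 * (k + 1)))⁻¹) ^ 2)) -
      s ^ (8 * (k + 1)) * (4 * (1 - s ^ (10 * (k + 1)))⁻¹ +
        5 * (s ^ (10 * (k + 1)) * ((1 - s ^ (10 * (k + 1)))⁻¹) ^ 2))))) S := by
  refine exists_hasSum_swap (f := fun j k => rankComb (fun m => rankTerm s m k) j) ?_
    (fun j => HasSum.rankComb fun m _ => (summable_rankTerm hs m).hasSum) fun k => ?_
  · refine Summable.of_norm_bounded (g := fun p : ℕ × ℕ => (4 * (5 * p.1 + 4) * ‖s‖ ^ p.1) *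
        ‖s‖ ^ p.2)
      (Summable.mul_of_nonneg (summable_linear_mul_pow (norm_nonneg s) hs)
        (summable_geometric_of_lt_one (norm_nonneg s) hs) (fun j => by positivity)
        fun k => by positivity) fun p => ?_
    rw [mul_assoc _ _ (‖s‖ ^ p.2), ← pow_add]
    exact norm_rankComb_le fun m hm => (norm_rankTerm_le hs m p.2).trans
      (pow_le_pow_of_le_one (norm_nonneg _) hs.le (by omega))
  · have hx : ‖s ^ (2 * (k + 1))‖ < 1 := by
      rw [norm_pow]
      exact pow_lt_one₀ (norm_nonneg _) hs (by omega)
    have e : ∀ a : ℕ, s ^ (2 * a * (k + 1)) = (s ^ (2 * (k + 1))) ^ a := fun a => by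
      rw [← pow_mul]
      congr 1
      ring
    have e4 := e 4
    have e5 := e 5
    norm_num only at e4 e5
    rw [e4, e5]
    refine ((hasSum_rankComb_pow hx).mul_left ((-1) ^ k * s ^ ((k + 1) * (3 * k + 2)))).of_eq
        (fun j => ?_) rfl
    simp only [rankComb, rankTerm, pow_add s, pow_mul s (2 * (k + 1))]
    ring

end

section

variable {s : ℂ} (hs0 : s ≠ 0) (hs : ‖s‖ < 1)

include hs0 hs in
lemma hasSum_rankPhi_one_add_deriv :
    HasSum (fun k : ℤ => -(rankCoeff s k * ((1 - s ^ (10 * k))⁻¹ +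
      5 * (s ^ (10 * k) * ((1 - s ^ (10 * k))⁻¹) ^ 2))))
          (rankPhi s 1 + 5 * deriv (rankPhi s) 1) := by
  obtain ⟨δ, hδ, h⟩ := exists_le_norm_one_sub_mul_zpow hs0 hs
  have h1 : ∀ k : ℤ, k ≠ 0 → ‖(1 - s ^ (10 * k))⁻¹‖ ≤ δ⁻¹ := fun k hk => by
    have := h 1 (Metric.mem_ball_self hδ) k hk
    rw [one_mul] at this
    rw [norm_inv]
    gcongr
  have hc0 : rankCoeff s 0 = 0 := by simp [rankCoeff]
  have hA : Summable fun k : ℤ => rankCoeff s k * (1 - s ^ (10 * k))⁻¹ := by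
    refine Summable.of_norm_bounded ((summable_norm_rankCoeff_mul hs0 hs 0).mul_right δ⁻¹)
        fun k => ?_
    rcases eq_or_ne k 0 with rfl | hk
    · simp [hc0]
    rw [norm_mul, zero_mul, zpow_zero, mul_one]
    gcongr
    exact h1 k hk
  have hB : Summable fun k : ℤ => rankCoeff s k * (s ^ (10 * k) * ((1 - s ^ (10 * k))⁻¹) ^ 2) := by
    refine Summable.of_norm_bounded ((summable_norm_rankCoeff_mul hs0 hs 10).mul_right (δ⁻¹ ^ 2))
        fun k => ?_
    rcases eq_or_ne k 0 with rfl | hk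
    · simp [hc0]
    rw [← mul_assoc, norm_mul _ (_ ^ 2), norm_pow]
    gcongr
    exact h1 k hk
  refine (hA.hasSum.add (hB.hasSum.mul_left 5)).neg.of_eq (fun k => by ring) ?_
  rw [(hasDerivAt_rankPhi_one hs0 hs).deriv, rankPhi]
  simp only [one_mul, rankCoeff]
  ring

include hs0 hs in
/-- The generating function of the rank sums. -/
lemma hasSum_rankSum : HasSum (fun n => (rankSum n : ℂ) * (s ^ 2) ^ n)
    ((rankPhi s 1 + 5 * deriv (rankPhi s) 1) / poch (s ^ 2) (s ^ 2)) := by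
  obtain ⟨S, h1, h2⟩ := hasSum_rankSum_mul_pow (norm_sq_lt_one hs)
  obtain ⟨T, h3, h4⟩ := exists_hasSum_rankComb_rankTerm hs
  have hS : S = (poch (s ^ 2) (s ^ 2))⁻¹ * T := by
    refine h2.unique ((h3.mul_left _).of_eq (fun j => ?_) rfl)
    simp only [rankComb]
    rw [rankGE_eq_tsum hs (by omega), rankGE_eq_tsum hs (by omega), rankGE_eq_tsum hs (by omega),
      rankGE_eq_tsum hs (by omega)]
    ring
  have h5 := (hasSum_rankPhi_one_add_deriv hs0 hs).nat_add_neg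
  have hc0 : rankCoeff s 0 = 0 := by simp [rankCoeff]
  have h6 := (hasSum_nat_add_iff' 1).2 h5
  rw [Finset.sum_range_one] at h6
  simp only [Nat.cast_zero, neg_zero, hc0, zero_mul, add_zero, sub_zero] at h6
  have hT : T = rankPhi s 1 + 5 * deriv (rankPhi s) 1 := by
    refine h4.unique (h6.of_eq (fun k => ?_) rfl)
    have hx0 : s ^ (2 * (k + 1)) ≠ 0 := pow_ne_zero _ hs0
    have hx5 : (s ^ (2 * (k + 1))) ^ 5 ≠ 1 := fun h => by
      have := congrArg norm h
      rw [← pow_mul, norm_pow, norm_one] at this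
      exact (pow_lt_one₀ (norm_nonneg _) hs (by omega)).ne this
    have z : ∀ (a : ℤ) (b c : ℕ), a + b = c → s ^ a = s ^ c / s ^ b := fun a b c h => by
      rw [eq_div_iff (pow_ne_zero _ hs0), ← zpow_natCast, ← zpow_natCast, ← zpow_add₀ hs0, h]
    have e8 : s ^ (8 * (k + 1)) = (s ^ (2 * (k + 1))) ^ 4 := by rw [← pow_mul]; congr 1; ring
    have e10 : s ^ (10 * (k + 1)) = (s ^ (2 * (k + 1))) ^ 5 := by rw [← pow_mul]; congr 1; ring
    have z1 : s ^ (10 * ((k + 1 : ℕ) : ℤ)) = (s ^ (2 * (k + 1))) ^ 5 := by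
      rw [← e10, ← zpow_natCast]; norm_cast
    have z2 : s ^ (10 * -((k + 1 : ℕ) : ℤ)) = ((s ^ (2 * (k + 1))) ^ 5)⁻¹ := by
      rw [mul_neg, zpow_neg, z1]
    have c1 : rankCoeff s ((k + 1 : ℕ) : ℤ) = -(-1) ^ k * (s ^ ((k + 1) * (3 * k + 2)) *
        (s ^ (2 * (k + 1)) - (s ^ (2 * (k + 1))) ^ 2)) := by
      rw [rankCoeff, zpow_natCast, pow_succ, z _ 0 ((k + 1) * (3 * k + 2) + 2 * (k + 1))
        (by push_cast; ring),
        z (3 * _ ^ 2 + 3 * _) 0 ((k + 1) * (3 * k + 2) + 2 * (k + 1) * 2) (by push_cast; ring),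
            pow_add, pow_add,
        pow_mul s (2 * (k + 1)) 2]
      simp only [pow_zero, div_one]
      ring
    have c2 : rankCoeff s (-((k + 1 : ℕ) : ℤ)) = -(-1) ^ k * (s ^ ((k + 1) * (3 * k + 2)) *
        (1 - (s ^ (2 * (k + 1)))⁻¹)) := by
      rw [rankCoeff, zpow_neg, zpow_natCast, ← inv_pow, inv_neg, inv_one, pow_succ,
        z _ 0 ((k + 1) * (3 * k + 2)) (by push_cast; ring),
        z (3 * _ ^ 2 + 3 * _) (2 * (k + 1)) ((k + 1) * (3 * k + 2)) (by push_cast; ring)]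
      simp only [pow_zero, div_one]
      ring
    rw [z1, z2, c1, c2, e8, e10]
    generalize s ^ (2 * (k + 1)) = x at hx0 hx5
    have hx5' : 1 - x ^ 5 ≠ 0 := sub_ne_zero.2 hx5.symm
    have e : (1 - (x ^ 5)⁻¹)⁻¹ = -x ^ 5 * (1 - x ^ 5)⁻¹ := by
      rw [show 1 - (x ^ 5)⁻¹ = -((1 - x ^ 5) * (x ^ 5)⁻¹) by
        rw [sub_mul, mul_inv_cancel₀ (pow_ne_zero 5 hx0)]; ring, inv_neg, mul_inv, inv_inv]
      ring
    rw [e]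
    field_simp
    ring
  exact h1.of_eq (fun _ => rfl) (by rw [hS, hT, div_eq_inv_mul])

end

/-! ### The generating function of the crank moments -/

/-- The sum of `z ^ μ(π)` over the partitions of `n` with exactly `m` ones. -/
noncomputable def onesSum (z : ℂ) (m n : ℕ) : ℂ :=
  ∑ π : n.Partition, if omegaOnes π = m then z ^ muParts π else 0

lemma prod_map_ite_one {z : ℂ} {p : ℕ → Prop} [DecidablePred p] (s : Multiset ℕ) :
    (s.map fun i => if p i then z else 1).prod = z ^ Multiset.card (s.filter p) := by
  induction s using Multiset.induction_on with
  | empty => simp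
  | cons a s ih =>
    rw [Multiset.map_cons, Multiset.prod_cons, ih, Multiset.filter_cons, Multiset.card_add, pow_add]
    split_ifs <;> simp

/-- The weight of a part in a partition, where the number of ones is weighted by `u` and each part
larger than `m` by `z`. -/
def crankWeight (u : ℕ → ℂ) (z : ℂ) (m i c : ℕ) : ℂ :=
  (if i = 1 then u c else 1) * (if m < i then z else 1) ^ c

lemma prod_crankWeight {u : ℕ → ℂ} (hu : u 0 = 1) (z : ℂ) (m : ℕ) {n : ℕ} (π : n.Partition) :
    π.parts.toFinsupp.prod (crankWeight u z m) =
      u (omegaOnes π) * z ^ Multiset.card (π.parts.filter (m < ·)) := by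
  have h1 : π.parts.toFinsupp.prod (crankWeight u z m) =
      (π.parts.toFinsupp.prod fun i c => if i = 1 then u c else 1) *
        π.parts.toFinsupp.prod fun i c => (if m < i then z else 1) ^ c := Finsupp.prod_mul
  rw [h1, Finsupp.prod_ite_eq', ← prod_map_ite_one, Finset.prod_multiset_map_count, Finsupp.prod]
  congr 1
  simp only [Multiset.toFinsupp_support, Multiset.mem_toFinset, Multiset.toFinsupp_apply, omegaOnes]
  split_ifs with h
  · rfl
  · rw [Multiset.count_eq_zero.2 h, hu]

section

variable {q : ℂ} (hq : ‖q‖ < 1)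

include hq in
lemma hasSum_crankWeight {u : ℕ → ℂ} (hu : u 0 = 1) (hu1 : ∀ c, ‖u c‖ ≤ 1) {z : ℂ} (hz : ‖z‖ ≤ 1)
    {m : ℕ} (hm : 0 < m) {U : ℂ} (hU : HasSum (fun c => u c * q ^ c) U) :
    HasSum (fun n => (∑ π : n.Partition, u (omegaOnes π) *
      z ^ Multiset.card (π.parts.filter (m < ·))) * q ^ n)
      (U * ((1 - q) / ((∏ i ∈ Finset.range m, (1 - q * q ^ i)) * poch (z * q ^ (m + 1)) q))) := by
  have hw : ∀ i, ‖(if m < i then z else 1 : ℂ)‖ ≤ 1 := fun i => by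
    split_ifs
    · exact hz
    · exact norm_one.le
  set v : ℕ → ℂ := fun i => (if i = 0 then U * (1 - q) else 1) *
    (1 - (if m < i + 1 then z else 1) * q ^ (i + 1))⁻¹ with hv
  have hq1 : (1 - q) ≠ 0 := fun h => by
    rw [← sub_eq_zero.1 h, norm_one] at hq
    exact hq.false
  have hzq : ‖z * q ^ (m + 1)‖ < 1 := by
    rw [norm_mul, norm_pow]
    exact mul_lt_one_of_nonneg_of_lt_one_right hz (by positivity)
      (pow_lt_one₀ (norm_nonneg _) hq (by omega))
  have key := hasSum_genFun (f := crankWeight u z m) (v := v) (fun i => by simp [crankWeight, hu])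
    (fun i c => ?_) hq (fun i => ?_) (L := U * ((1 - q) /
      ((∏ i ∈ Finset.range m, (1 - q * q ^ i)) * poch (z * q ^ (m + 1)) q))) ?_
  · simpa only [prod_crankWeight hu] using key
  · rw [crankWeight, norm_mul, norm_pow]
    refine mul_le_one₀ ?_ (by positivity) (pow_le_one₀ (norm_nonneg _) (hw i))
    split_ifs
    · exact hu1 c
    · exact norm_one.le
  · rcases Nat.eq_zero_or_pos i with rfl | hi
    · refine hU.of_eq (fun c => ?_) ?_
      · simp [crankWeight, show ¬ m < 1 by omega]
      · simp only [hv, zero_add, show ¬ m < 1 by omega, if_true, if_false, pow_one, one_mul]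
        rw [mul_inv_cancel_right₀ hq1]
    · have hn : ‖(if m < i + 1 then z else 1) * q ^ (i + 1)‖ < 1 := by
        rw [norm_mul, norm_pow]
        exact mul_lt_one_of_nonneg_of_lt_one_right (hw _) (by positivity)
          (pow_lt_one₀ (norm_nonneg _) hq (by omega))
      refine (hasSum_geometric_of_norm_lt_one hn).of_eq (fun c => ?_) ?_
      · rw [crankWeight, if_neg (by omega), one_mul, mul_pow, pow_mul]
      · simp only [hv]
        rw [if_neg (by omega), one_mul]
  · refine (tendsto_add_atTop_iff_nat m).1 ?_
    have h1 := ((tendsto_poch hq (z * q ^ (m + 1))).inv₀ (poch_ne_zero_of_norm_lt hq hzq)).const_mul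
      (U * ((1 - q) / ∏ i ∈ Finset.range m, (1 - q * q ^ i)))
    convert h1 using 1
    · funext K
      rw [add_comm K m, Finset.prod_range_add]
      congr 1
      · simp only [hv]
        rw [Finset.prod_mul_distrib, Finset.prod_ite_eq', if_pos (Finset.mem_range.2 hm),
          Finset.prod_congr rfl fun i hi => by
            rw [if_neg (show ¬ m < i + 1 by rw [Finset.mem_range] at hi; omega), one_mul,
              pow_succ'],
          Finset.prod_inv_distrib]
        ring
      · rw [← Finset.prod_inv_distrib]
        refine Finset.prod_congr rfl fun i _ => ?_
        simp only [hv]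
        rw [if_neg (by omega), if_pos (by omega), one_mul]
        congr 2
        ring
    · congr 1
      rw [← div_eq_mul_inv, mul_div_assoc, div_div]

include hq in
lemma hasSum_onesSum {z : ℂ} (hz : ‖z‖ ≤ 1) {m : ℕ} (hm : 0 < m) :
    HasSum (fun n => onesSum z m n * q ^ n)
      (q ^ m * ((1 - q) / ((∏ i ∈ Finset.range m, (1 - q * q ^ i)) * poch (z * q ^ (m + 1)) q)))
          := by
  have hb : HasSum (fun c => (if c = 0 then 1 else 0) * q ^ c) (1 : ℂ) := by
    refine (hasSum_single 0 fun c hc => ?_).of_eq (fun _ => rfl) ?_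
    · rw [if_neg hc, zero_mul]
    · simp
  have hd : HasSum (fun c => (if c = m then 1 else 0) * q ^ c) (q ^ m) := by
    refine (hasSum_single m fun c hc => ?_).of_eq (fun _ => rfl) ?_
    · rw [if_neg hc, zero_mul]
    · simp
  have h1 := hasSum_crankWeight hq (u := fun c => (if c = 0 then 1 else 0) + if c = m then 1 else 0)
    (by simp [hm.ne]) (fun c => by
      rcases eq_or_ne c 0 with rfl | h
      · simp [hm.ne]
      · rw [if_neg h, zero_add]
        split_ifs <;> simp) hz hm ((hb.add hd).of_eq (fun c => by ring) rfl)
  have h2 := hasSum_crankWeight hq (u := fun c => if c = 0 then 1 else 0) (by simp)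
    (fun c => by split_ifs <;> simp) hz hm hb
  refine (h1.sub h2).of_eq (fun n => ?_) (by ring)
  rw [← sub_mul, ← Finset.sum_sub_distrib, onesSum]
  congr 1
  refine Finset.sum_congr rfl fun π _ => ?_
  rw [← sub_mul, add_sub_cancel_left, ite_mul, one_mul, zero_mul]
  split_ifs with h
  · rw [muParts, h]
  · rfl

lemma omegaOnes_le {n : ℕ} (π : n.Partition) : omegaOnes π ≤ n := by
  have h := Multiset.card_nsmul_le_sum (s := π.parts) (a := 1) fun x hx => π.parts_pos hx
  rw [π.parts_sum, smul_eq_mul, mul_one] at h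
  exact (Multiset.count_le_card 1 π.parts).trans h

lemma onesSum_one (m n : ℕ) :
    onesSum 1 m n = ((Finset.univ.filter fun π : n.Partition => omegaOnes π = m).card : ℂ) := by
  simp [onesSum]

lemma norm_onesSum_le {z : ℂ} (hz : ‖z‖ ≤ 1) (m n : ℕ) : ‖onesSum z m n‖ ≤ ‖onesSum 1 m n‖ := by
  rw [onesSum_one, Complex.norm_natCast, Finset.card_filter]
  push_cast
  refine norm_sum_le_of_le _ fun π _ => ?_
  split_ifs
  · rw [norm_pow]
    exact pow_le_one₀ (norm_nonneg _) hz
  · exact norm_zero.le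

lemma norm_onesSum_one_le (m n : ℕ) : ‖onesSum 1 m n‖ ≤ Fintype.card n.Partition := by
  refine (norm_sum_le_of_le _ fun π _ => ?_).trans (by simp : ∑ π : n.Partition, (1 : ℝ) ≤ _)
  split_ifs <;> simp

include hq in
lemma exists_hasSum_norm_onesSum_le : ∃ C : ℝ, 0 ≤ C ∧ ∀ m : ℕ, ∃ c : ℝ, 0 ≤ c ∧
    HasSum (fun n => ‖onesSum 1 m n‖ * ‖q‖ ^ n) c ∧ (m : ℝ) * c ≤ (m : ℝ) * ‖q‖ ^ m * C := by
  have hr : ‖((‖q‖ : ℝ) : ℂ)‖ < 1 := by simpa using hq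
  refine ⟨‖(1 - ((‖q‖ : ℝ) : ℂ)) / poch (‖q‖ : ℝ) (‖q‖ : ℝ)‖, norm_nonneg _, fun m => ?_⟩
  have hs : Summable fun n => ‖onesSum 1 m n‖ * ‖q‖ ^ n :=
    Summable.of_nonneg_of_le (fun n => by positivity)
      (fun n => mul_le_mul_of_nonneg_right (norm_onesSum_one_le m n) (by positivity))
      (summable_card_partition_mul_pow hq)
  refine ⟨_, tsum_nonneg fun n => by positivity, hs.hasSum, ?_⟩
  rcases Nat.eq_zero_or_pos m with rfl | hm
  · simp
  rw [mul_assoc]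
  refine mul_le_mul_of_nonneg_left (le_of_eq ?_) (Nat.cast_nonneg m)
  have h1 := hasSum_onesSum hr (z := 1) (by simp) hm
  have h2 : HasSum (fun n => ((‖onesSum 1 m n‖ * ‖q‖ ^ n : ℝ) : ℂ))
      ((∑' n, ‖onesSum 1 m n‖ * ‖q‖ ^ n : ℝ) : ℂ) := Complex.hasSum_ofReal.2 hs.hasSum
  have h3 := h1.unique (h2.of_eq (fun n => ?_) rfl)
  · rw [one_mul, pow_succ', ← poch_eq_prod_mul hr] at h3
    have h4 := congrArg norm h3
    rw [norm_mul, norm_pow, Complex.norm_real, Complex.norm_real, norm_norm,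
      Real.norm_of_nonneg (tsum_nonneg fun n => by positivity)] at h4
    exact h4.symm
  · rw [onesSum_one, Complex.norm_natCast]
    push_cast
    rfl

/-- The sum of `ω(π) z ^ crank(π)` over the partitions of `n`. -/
noncomputable def crankMoment (z : ℂ) (n : ℕ) : ℂ :=
  ∑ π : n.Partition, (omegaOnes π : ℂ) * z ^ crank π

lemma crankMoment_eq {z : ℂ} (hz : z ≠ 0) (n : ℕ) :
    crankMoment z n = ∑ m ∈ Finset.range (n + 1), (m : ℂ) * z⁻¹ ^ m * onesSum z m n := by
  simp only [onesSum, Finset.mul_sum]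
  rw [Finset.sum_comm, crankMoment]
  refine Finset.sum_congr rfl fun π _ => ?_
  have hle := omegaOnes_le π
  rw [Finset.sum_eq_single (omegaOnes π)]
  · rw [if_pos rfl, mul_assoc]
    rcases Nat.eq_zero_or_pos (omegaOnes π) with h | h
    · simp [h]
    · rw [crank, if_neg h.ne', zpow_sub₀ hz, zpow_natCast, zpow_natCast, inv_pow, div_eq_mul_inv]
      ring
  · intro m _ hm
    rw [if_neg hm.symm, mul_zero]
  · intro h
    exact absurd (Finset.mem_range.2 (by omega)) h

include hq in
lemma exists_hasSum_crankMoment {z : ℂ} (hz : ‖z‖ = 1) :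
    ∃ S, HasSum (fun n => crankMoment z n * q ^ n) S ∧
      HasSum (fun m : ℕ => (m : ℂ) * z⁻¹ ^ m * (q ^ m * ((1 - q) /
        ((∏ i ∈ Finset.range m, (1 - q * q ^ i)) * poch (z * q ^ (m + 1)) q)))) S := by
  have hz0 : z ≠ 0 := fun h => by simp [h] at hz
  obtain ⟨C, hC, hc⟩ := exists_hasSum_norm_onesSum_le hq
  choose c hc0 hc1 hc2 using hc
  have hf : Summable fun p : ℕ × ℕ => (p.1 : ℂ) * z⁻¹ ^ p.1 * (onesSum z p.1 p.2 * q ^ p.2) := by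
    refine Summable.of_norm_bounded (summable_prod_mul (w := fun m => (m : ℝ))
      (F := fun m n => ‖onesSum 1 m n‖ * ‖q‖ ^ n) (fun m => by positivity)
      (fun m n => by positivity) hc1 ?_) fun p => ?_
    · refine Summable.of_nonneg_of_le (fun m => mul_nonneg (by positivity) (hc0 m)) hc2
          (Summable.mul_right C ?_)
      simpa using summable_pow_mul_geometric_of_norm_lt_one (R := ℝ) 1 (r := ‖q‖)
          (by simpa using hq)
    · rw [norm_mul, norm_mul, norm_mul, norm_pow, norm_pow, norm_inv, hz, inv_one, one_pow, mul_one,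
        Complex.norm_natCast]
      gcongr
      exact norm_onesSum_le hz.le _ _
  refine (exists_hasSum_swap (f := fun m n => (m : ℂ) * z⁻¹ ^ m * (onesSum z m n * q ^ n)) hf
    (fun m => ?_) fun n => ?_).imp fun _ h => h.symm
  · rcases Nat.eq_zero_or_pos m with rfl | hm
    · simp
    · exact (hasSum_onesSum hq hz.le hm).mul_left _
  · have h : ∀ m, m ∉ Finset.range (n + 1) → (m : ℂ) * z⁻¹ ^ m * (onesSum z m n * q ^ n) = 0 :=
        fun m hm => by
      have h0 : onesSum z m n = 0 := Finset.sum_eq_zero fun π _ => by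
        rw [if_neg]
        rintro rfl
        rw [Finset.mem_range] at hm
        have := omegaOnes_le π
        omega
      rw [h0, zero_mul, mul_zero]
    refine (hasSum_sum_of_ne_finset_zero h).of_eq (fun _ => rfl) ?_
    rw [crankMoment_eq hz0, Finset.sum_mul]
    exact Finset.sum_congr rfl fun m _ => by ring

end

/-! ### The `q`-binomial theorem and the antisymmetrised crank moments -/

section

variable {a : ℕ → ℂ} {B : ℝ} (ha : ∀ m, ‖a m‖ ≤ B) {x : ℂ} (hx : ‖x‖ < 1)

include ha hx in
lemma summable_bounded_mul_pow : Summable fun m => a m * x ^ m :=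
  Summable.of_norm_bounded ((summable_geometric_of_lt_one (norm_nonneg _) hx).mul_left B)
      fun m => by
    rw [norm_mul, norm_pow]
    gcongr
    exact ha m

include ha hx in
lemma hasDerivAt_powerSeries : DifferentiableAt ℂ (fun x => ∑' m, a m * x ^ m) x ∧
    HasSum (fun m : ℕ => m * (a m * x ^ m)) (x * deriv (fun x => ∑' m, a m * x ^ m) x) := by
  obtain ⟨r, hxr, hr⟩ := exists_between hx
  have hr0 : 0 ≤ r := (norm_nonneg _).trans hxr.le
  have hB : 0 ≤ B := (norm_nonneg _).trans (ha 0)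
  have hu : Summable fun m => B * r ^ m := (summable_geometric_of_lt_one hr0 hr).mul_left B
  have hd : ∀ m, DifferentiableOn ℂ (fun x => a m * x ^ m) (Metric.ball 0 r) := fun m =>
    (Differentiable.differentiableOn (by fun_prop))
  have hle : ∀ m, ∀ w ∈ Metric.ball (0 : ℂ) r, ‖a m * w ^ m‖ ≤ B * r ^ m := fun m w hw => by
    rw [mem_ball_zero_iff] at hw
    rw [norm_mul, norm_pow]
    gcongr
    exact ha m
  have hxm : x ∈ Metric.ball (0 : ℂ) r := mem_ball_zero_iff.2 hxr
  refine ⟨(Complex.differentiableOn_tsum_of_summable_norm hu hd Metric.isOpen_ball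
      hle).differentiableAt
    (Metric.isOpen_ball.mem_nhds hxm), ?_⟩
  refine ((Complex.hasSum_deriv_of_summable_norm hu hd Metric.isOpen_ball hle hxm).mul_left x).of_eq
    (fun m => ?_) rfl
  rw [deriv_const_mul _ (by fun_prop), deriv_pow_field]
  cases m with
  | zero => simp
  | succ m => rw [Nat.add_sub_cancel, pow_succ]; ring

end

section

variable {q : ℂ} (hq : ‖q‖ < 1)

/-- The coefficients in the `q`-binomial theorem. -/
noncomputable def qbinom (A q : ℂ) (m : ℕ) : ℂ :=
  (∏ i ∈ Finset.range m, (1 - A * q ^ i)) / ∏ i ∈ Finset.range m, (1 - q * q ^ i)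

include hq in
lemma exists_norm_qbinom_le (A : ℂ) : ∃ B : ℝ, ∀ m, ‖qbinom A q m‖ ≤ B := by
  obtain ⟨B, hB0, hB⟩ := exists_norm_prod_le hq A
  obtain ⟨C, hC0, hC⟩ := exists_norm_prod_inv_le hq (a := q) fun n h =>
    one_sub_mul_pow_ne_zero hq hq n (by rw [h, sub_self])
  refine ⟨B * C, fun m => ?_⟩
  rw [qbinom, div_eq_mul_inv, norm_mul]
  exact mul_le_mul (hB _) (hC _) (norm_nonneg _) hB0.le

include hq in
/-- The `q`-binomial theorem. -/
lemma tsum_qbinom (A : ℂ) {x : ℂ} (hx : ‖x‖ < 1) :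
    ∑' m, qbinom A q m * x ^ m = poch (A * x) q / poch x q := by
  obtain ⟨B, hB⟩ := exists_norm_qbinom_le hq A
  set f : ℂ → ℂ := fun x => ∑' m, qbinom A q m * x ^ m with hf
  have hxq : ∀ (y : ℂ), ‖y‖ < 1 → ∀ N : ℕ, ‖y * q ^ N‖ < 1 := fun y hy N => by
    rw [norm_mul, norm_pow]
    exact mul_lt_one_of_nonneg_of_lt_one_left (norm_nonneg _) hy (pow_le_one₀ (norm_nonneg _) hq.le)
  have hrec : ∀ m, qbinom A q (m + 1) * (1 - q ^ (m + 1)) = qbinom A q m * (1 - A * q ^ m) :=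
      fun m => by
    have h := one_sub_mul_pow_ne_zero hq hq m
    rw [qbinom, qbinom, Finset.prod_range_succ, Finset.prod_range_succ, ← div_mul_div_comm,
      pow_succ',
      mul_assoc, div_mul_cancel₀ _ h]
  have hfun : ∀ y : ℂ, ‖y‖ < 1 → (1 - y) * f y = (1 - A * y) * f (y * q) := fun y hy => by
    have hy' := hxq y hy 1
    rw [pow_one] at hy'
    have s1 := summable_bounded_mul_pow hB hy
    have s2 := summable_bounded_mul_pow hB hy'
    have e1 := (s1.hasSum.sub s2.hasSum)
    have e2 := ((s1.hasSum.mul_left y).sub (s2.hasSum.mul_left (A * y)))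
    have e3 := (hasSum_nat_add_iff' 1).2 e1
    rw [Finset.sum_range_one, pow_zero, pow_zero, sub_self, sub_zero] at e3
    have := e3.unique (e2.of_eq (fun m => ?_) rfl)
    · linear_combination this
    · have h := hrec m
      rw [pow_succ' q] at h
      rw [mul_pow, mul_pow, pow_succ', pow_succ']
      linear_combination y * y ^ m * h
  have hiter : ∀ N : ℕ, f x = (∏ i ∈ Finset.range N, (1 - A * x * q ^ i)) /
      (∏ i ∈ Finset.range N, (1 - x * q ^ i)) * f (x * q ^ N) := fun N => by
    induction N with
    | zero => simp
    | succ N ih =>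
      have h0 := one_sub_mul_pow_ne_zero hq hx N
      have h1 := hfun _ (hxq x hx N)
      rw [ih, Finset.prod_range_succ, Finset.prod_range_succ, ← div_mul_div_comm, mul_assoc]
      congr 1
      rw [div_mul_eq_mul_div, eq_div_iff h0, pow_succ, ← mul_assoc x]
      linear_combination h1
  have hf0 : f 0 = 1 := by
    simp only [hf]
    rw [tsum_eq_single 0 fun m hm => by rw [zero_pow hm, mul_zero]]
    simp [qbinom]
  have hcont : Tendsto (fun N : ℕ => f (x * q ^ N)) atTop (𝓝 1) := by
    have h1 : Tendsto (fun N : ℕ => x * q ^ N) atTop (𝓝 0) := by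
      simpa using (tendsto_pow_atTop_nhds_zero_of_norm_lt_one hq).const_mul x
    have h2 := (hasDerivAt_powerSeries hB (x := 0) (by simp)).1.continuousAt.tendsto.comp h1
    rw [← hf0]
    exact h2
  have hlim := ((tendsto_poch hq (A * x)).div (tendsto_poch hq x)
      (poch_ne_zero_of_norm_lt hq hx)).mul hcont
  rw [mul_one] at hlim
  exact tendsto_nhds_unique tendsto_const_nhds (hlim.congr fun N => (hiter N).symm)

/-- The logarithmic derivative of `poch`. -/
noncomputable def logPoch (q a : ℂ) : ℂ := a * deriv (fun a => poch a q) a / poch a q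

include hq in
lemma hasSum_mul_qbinom {A x : ℂ} (hx : ‖x‖ < 1) (hA : ‖A * x‖ < 1) :
    HasSum (fun m : ℕ => m * (qbinom A q m * x ^ m))
      (poch (A * x) q / poch x q * (logPoch q (A * x) - logPoch q x)) := by
  obtain ⟨B, hB⟩ := exists_norm_qbinom_le hq A
  refine (hasDerivAt_powerSeries hB hx).2.of_eq (fun _ => rfl) ?_
  have he : (fun x => ∑' m, qbinom A q m * x ^ m) =ᶠ[𝓝 x] fun x => poch (A * x) q / poch x q := by
    filter_upwards [Metric.isOpen_ball.mem_nhds (mem_ball_zero_iff.2 hx)] with y hy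
    exact tsum_qbinom hq A (mem_ball_zero_iff.1 hy)
  have h1 := ((differentiable_poch hq) (A * x)).hasDerivAt
  have h2 : HasDerivAt (fun x => poch (A * x) q) (deriv (fun a => poch a q) (A * x) * (A * 1)) x :=
    h1.comp x ((hasDerivAt_id x).const_mul A)
  have h3 := h2.div ((differentiable_poch hq) x).hasDerivAt (poch_ne_zero_of_norm_lt hq hx)
  rw [he.deriv_eq, show (fun x => poch (A * x) q / poch x q) =
    (fun x => poch (A * x) q) / fun x => poch x q from rfl, h3.deriv, logPoch, logPoch]
  have e1 := poch_ne_zero_of_norm_lt hq hx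
  have e2 := poch_ne_zero_of_norm_lt hq hA
  generalize deriv (fun a => poch a q) (A * x) = d1
  generalize deriv (fun a => poch a q) x = d2
  generalize poch (A * x) q = p1 at e2 ⊢
  generalize poch x q = p2 at e1 ⊢
  field_simp

include hq in
lemma hasSum_crankMoment {z : ℂ} (hz : ‖z‖ = 1) :
    HasSum (fun n => crankMoment z n * q ^ n) (poch q q / (poch (z * q) q * poch (z⁻¹ * q) q) *
      (logPoch q (q * q) - logPoch q (z⁻¹ * q))) := by
  have hz0 : z ≠ 0 := fun h => by simp [h] at hz
  have hzq : ‖z * q‖ < 1 := by rwa [norm_mul, hz, one_mul]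
  have hzq' : ‖z⁻¹ * q‖ < 1 := by rwa [norm_mul, norm_inv, hz, inv_one, one_mul]
  have hA : z * q * (z⁻¹ * q) = q * q := by
    rw [mul_mul_mul_comm, mul_inv_cancel₀ hz0, one_mul]
  have hqq : ‖q * q‖ < 1 := by
    rw [norm_mul]
    exact mul_lt_one_of_nonneg_of_lt_one_left (norm_nonneg _) hq hq.le
  obtain ⟨S, h1, h2⟩ := exists_hasSum_crankMoment hq hz
  have h3 := (hasSum_mul_qbinom hq hzq' (A := z * q) (by rwa [hA])).mul_left
      ((1 - q) / poch (z * q) q)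
  have h4 := h2.unique (h3.of_eq (fun m => ?_) rfl)
  · rw [h4, hA] at h1
    refine h1.of_eq (fun _ => rfl) ?_
    rw [poch_succ hq q]
    ring
  · have hm : poch (z * q ^ (m + 1)) q ≠ 0 := poch_ne_zero_of_norm_lt hq (by
      rw [norm_mul, hz, one_mul, norm_pow]; exact pow_lt_one₀ (norm_nonneg _) hq (by omega))
    have hp := poch_eq_prod_mul hq (z * q) m
    rw [mul_assoc, ← pow_succ'] at hp
    have hprod : ∏ i ∈ Finset.range m, (1 - z * q * q ^ i) ≠ 0 :=
      Finset.prod_ne_zero_iff.2 fun i _ => one_sub_mul_pow_ne_zero hq hzq i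
    have hprod' : ∏ i ∈ Finset.range m, (1 - q * q ^ i) ≠ 0 :=
      Finset.prod_ne_zero_iff.2 fun i _ => one_sub_mul_pow_ne_zero hq hq i
    rw [hp, qbinom, mul_pow]
    generalize (∏ i ∈ Finset.range m, (1 - z * q * q ^ i)) = X at hprod ⊢
    generalize (∏ i ∈ Finset.range m, (1 - q * q ^ i)) = Y at hprod' ⊢
    generalize poch (z * q ^ (m + 1)) q = Z at hm ⊢
    field_simp

include hq in
lemma hasSum_crankMoment_sub {z : ℂ} (hz : ‖z‖ = 1) (hz1 : z ≠ 1) :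
    HasSum (fun n => (crankMoment z n - crankMoment z⁻¹ n) * q ^ n)
      (poch q q ^ 2 * ((1 - z) * dth z q + z * th z q) / th z q ^ 2) := by
  have hz0 : z ≠ 0 := fun h => by simp [h] at hz
  have hzq : ‖z * q‖ < 1 := by rwa [norm_mul, hz, one_mul]
  have hzq' : ‖z⁻¹ * q‖ < 1 := by rwa [norm_mul, norm_inv, hz, inv_one, one_mul]
  have h1 := (hasSum_crankMoment hq hz).sub (hasSum_crankMoment hq (z := z⁻¹)
      (by rw [norm_inv, hz, inv_one]))
  refine h1.of_eq (fun n => by ring) ?_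
  rw [inv_inv]
  have hD : HasDerivAt (fun x => th x q) ((((-1) * poch (z * q) q +
      (1 - z) * (deriv (fun a => poch a q) (z * q) * (1 * q))) * poch (z⁻¹ * q) q +
      (1 - z) * poch (z * q) q * (deriv (fun a => poch a q) (z⁻¹ * q) * (-(z ^ 2)⁻¹ * q))) *
          poch q q) z := by
    have d1 : HasDerivAt (fun x => poch (x * q) q) (deriv (fun a => poch a q) (z * q) *
        (1 * q)) z :=
      HasDerivAt.comp (h₂ := fun a => poch a q) (h := fun x => x * q) z
        ((differentiable_poch hq) (z * q)).hasDerivAt ((hasDerivAt_id' z).mul_const q)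
    have d2 : HasDerivAt (fun x => poch (x⁻¹ * q) q)
        (deriv (fun a => poch a q) (z⁻¹ * q) * (-(z ^ 2)⁻¹ * q)) z :=
      HasDerivAt.comp (h₂ := fun a => poch a q) (h := fun x => x⁻¹ * q) z
        ((differentiable_poch hq) (z⁻¹ * q)).hasDerivAt ((hasDerivAt_inv hz0).mul_const q)
    have d3 : HasDerivAt (fun x : ℂ => 1 - x) (-1) z := (hasDerivAt_id z).const_sub 1
    refine (((d3.mul d1).mul d2).mul_const (poch q q)).congr_of_eventuallyEq
        (Eventually.of_forall fun x => ?_)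
    show th x q = (1 - x) * poch (x * q) q * poch (x⁻¹ * q) q * poch q q
    rw [th, poch_succ hq x, div_eq_inv_mul]
  have hth : th z q = (1 - z) * poch (z * q) q * poch (z⁻¹ * q) q * poch q q := by
    rw [th, poch_succ hq z, div_eq_inv_mul]
  rw [dth, hD.deriv, hth, logPoch, logPoch, logPoch]
  have e1 := poch_ne_zero_of_norm_lt hq hzq
  have e2 := poch_ne_zero_of_norm_lt hq hzq'
  have e3 := poch_ne_zero_of_norm_lt hq hq
  have e4 : 1 - z ≠ 0 := sub_ne_zero.2 hz1.symm
  generalize deriv (fun a => poch a q) (z * q) = d1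
  generalize deriv (fun a => poch a q) (z⁻¹ * q) = d2
  generalize deriv (fun a => poch a q) (q * q) = d3
  generalize poch (q * q) q = p4
  generalize poch (z * q) q = p1 at e1 ⊢
  generalize poch (z⁻¹ * q) q = p2 at e2 ⊢
  generalize poch q q = p3 at e3 ⊢
  field_simp
  ring

end

/-! ### The crank moments at fifth roots of unity -/

lemma hasDerivAt_pow_mul_th {p c x : ℂ} (hp : ‖p‖ < 1) (hc : c ≠ 0) (hx : x ≠ 0) (k : ℕ) :
    HasDerivAt (fun x => x ^ k * th (x ^ 5 * c) p)
      (x ^ k * (k * th (x ^ 5 * c) p + 5 * dth (x ^ 5 * c) p) / x) x := by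
  have h1 : HasDerivAt (fun x => th (x ^ 5 * c) p)
      (dth (x ^ 5 * c) p / x ^ 5 * ((5 : ℕ) * x ^ (5 - 1))) x :=
    HasDerivAt.comp (h₂ := fun y => th (y * c) p) (h := fun x => x ^ 5) x
      (hasDerivAt_th_mul hp hc (pow_ne_zero 5 hx)) (hasDerivAt_pow 5 x)
  refine ((hasDerivAt_pow k x).mul h1).congr_deriv ?_
  generalize dth (x ^ 5 * c) p = d
  generalize th (x ^ 5 * c) p = t
  rcases k with _ | k
  · simp
    field_simp
  · rw [Nat.add_sub_cancel, pow_succ x k]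
    push_cast
    field_simp

section

variable {ζ s q Q : ℂ} (hζ : IsPrimitiveRoot ζ 5) (hs0 : s ≠ 0) (hs : ‖s‖ < 1) (hq : s ^ 2 = q)
  (hQ : q ^ 5 = Q)
include hζ hs0 hs hq hQ

lemma dth_zeta : dth ζ q = 5 * (1 + ζ) * dth (Q ^ 2) (Q ^ 5) - ζ * th (Q ^ 2) (Q ^ 5) +
    q * (ζ ^ 2 * (2 * th Q (Q ^ 5) - 5 * dth Q (Q ^ 5)) +
      ζ ^ 4 * (th Q (Q ^ 5) - 5 * dth Q (Q ^ 5))) -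
    5 * ζ ^ 3 * q ^ 3 * poch (Q ^ 5) (Q ^ 5) ^ 3 := by
  have hq0 : q ≠ 0 := hq ▸ pow_ne_zero _ hs0
  have hQ0 : Q ≠ 0 := hQ ▸ pow_ne_zero _ hq0
  have hQ1 : ‖Q‖ < 1 := by
    rw [← hQ, ← hq, ← pow_mul, norm_pow]; exact pow_lt_one₀ (norm_nonneg _) hs (by simp)
  have hz0 := zeta_ne_zero hζ
  have hp := norm_pow_five_lt_one hQ1
  have hp0 : Q ^ 5 ≠ 0 := pow_ne_zero _ hQ0
  have e : ∀ k, s ^ (10 * k) = Q ^ k := fun k => by rw [← hQ, ← hq]; ring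
  have hd := fun c : ℕ => hasDerivAt_pow_mul_th (k := c) hp (pow_ne_zero (c + 2) hQ0) hz0
  have h := ((((hd 0).sub (hd 1)).add ((hd 2).const_mul q)).sub ((hd 3).const_mul (q ^ 3))).add
    ((hd 4).const_mul (q ^ 6))
  have e60 : th (Q ^ 6) (Q ^ 5) = -Q⁻¹ * th Q (Q ^ 5) := by
    rw [← th_mul hp hp0 hQ0]; congr 1
  have d60 : dth (Q ^ 6) (Q ^ 5) = Q⁻¹ * (th Q (Q ^ 5) - dth Q (Q ^ 5)) := by
    rw [← dth_mul hp hp0 hQ0]; congr 1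
  have e50 : th (Q ^ 5) (Q ^ 5) = 0 := by
    rw [← th_one hp, ← th_div hp0 1, div_one]
  have d50 : dth (Q ^ 5) (Q ^ 5) = poch (Q ^ 5) (Q ^ 5) ^ 3 := by
    rw [← neg_neg (_ ^ 3), ← dth_one hp, ← dth_div hp hp0 one_ne_zero, div_one]
  have h' := h.congr_of_eventuallyEq (f₁ := fun x => th x q) ?_
  · rw [dth, h'.deriv]
    simp only [hζ.pow_eq_one, one_mul, Nat.reduceAdd, pow_zero]
    rw [th_pow_three hQ0, th_pow_four hQ0, dth_pow_three hQ0 hQ1, dth_pow_four hQ0 hQ1, e60, e50,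
      d60, d50,
      ← hQ]
    generalize th (q ^ 5) _ = t1
    generalize dth (q ^ 5) _ = t2
    generalize dth ((q ^ 5) ^ 2) _ = t3
    generalize th ((q ^ 5) ^ 2) _ = t4
    generalize poch _ _ = t5
    push_cast
    field_simp
    ring
  · filter_upwards [eventually_ne_nhds hz0] with x hx
    simp only [Pi.add_apply, Pi.sub_apply, ← e, ← hq, th_dissect hs0 hs hx]
    ring

lemma hasSum_crankMoment_sub_mod_five :
    HasSum (fun n => (crankMoment ζ (5 * n + 4) - crankMoment ζ⁻¹ (5 * n + 4)) * q ^ (5 * n + 4))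
      (-10 * (ζ ^ 2 + ζ ^ 4) / (1 - ζ) * (q ^ 4 * poch (Q ^ 5) (Q ^ 5) ^ 4 / poch Q Q)) := by
  have hq0 : q ≠ 0 := hq ▸ pow_ne_zero _ hs0
  have hQ0 : Q ≠ 0 := hQ ▸ pow_ne_zero _ hq0
  have hQ1 : ‖Q‖ < 1 := by
    rw [← hQ, ← hq, ← pow_mul, norm_pow]; exact pow_lt_one₀ (norm_nonneg _) hs (by simp)
  have h5 := hζ.pow_eq_one
  have m1 := one_sub_zeta_ne_zero hζ
  have m2 := one_sub_zeta_sq_ne_zero hζ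
  have hQQ : poch Q Q ≠ 0 := poch_ne_zero_of_norm_lt hQ1 hQ1
  have h12 := th_mul_th_sq hQ0 hQ1
  have key := hasSum_mod_five_eq_four hζ (a := fun n => crankMoment ζ n - crankMoment ζ⁻¹ n)
      (q := q)
    fun j _ => by
      have r := rotate hζ hs hq hQ j
      refine hasSum_crankMoment_sub (q := ζ ^ j * q) ?_ (norm_zeta hζ) (sub_ne_zero.1 m1).symm
      rw [← r.2.1, norm_pow]
      exact pow_lt_one₀ (norm_nonneg _) r.1 (by simp)
  refine key.of_eq (fun _ => rfl) ?_
  obtain ⟨A, hA⟩ : ∃ A, A = (ζ + ζ ^ 4) * th Q (Q ^ 5) := ⟨_, rfl⟩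
  obtain ⟨B, hB⟩ : ∃ B, B = th (Q ^ 2) (Q ^ 5) := ⟨_, rfl⟩
  obtain ⟨U, hU⟩ : ∃ U, U = 5 * (1 + ζ) * dth (Q ^ 2) (Q ^ 5) / ((1 - ζ) * poch Q Q ^ 2) := ⟨_, rfl⟩
  obtain ⟨W, hW⟩ : ∃ W, W = (ζ ^ 2 * (2 * th Q (Q ^ 5) - 5 * dth Q (Q ^ 5)) +
      ζ ^ 4 * (th Q (Q ^ 5) - 5 * dth Q (Q ^ 5)) + (ζ ^ 3 + ζ ^ 4) * th Q (Q ^ 5)) /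
      ((1 - ζ) * poch Q Q ^ 2) := ⟨_, rfl⟩
  obtain ⟨V, hV⟩ : ∃ V, V = -5 * ζ ^ 3 * poch (Q ^ 5) (Q ^ 5) ^ 3 / ((1 - ζ) * poch Q Q ^ 2) :=
      ⟨_, rfl⟩
  have hpoly := sum_zeta_pow_mul_poly hζ (B ^ 2 * U + Q * A ^ 2 * V) (2 * A * B * U + B ^ 2 * W)
    (A ^ 2 * U + 2 * A * B * W) (A ^ 2 * W + B ^ 2 * V) (2 * A * B * V) q
  have hfin : -10 * (ζ ^ 2 + ζ ^ 4) / (1 - ζ) * (q ^ 4 * poch (Q ^ 5) (Q ^ 5) ^ 4 / poch Q Q) =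
      5⁻¹ * (5 * (2 * A * B * V) * q ^ 4) := by
    have : A * B = (ζ + ζ ^ 4) * (poch Q Q * poch (Q ^ 5) (Q ^ 5)) := by
      rw [hA, hB, ← h12]; ring
    rw [mul_assoc 2 A, this, hV, show ζ ^ 2 + ζ ^ 4 = ζ ^ 3 * (ζ + ζ ^ 4) by
      linear_combination -ζ ^ 2 * h5]
    generalize poch (Q ^ 5) (Q ^ 5) = E
    generalize ζ + ζ ^ 4 = a
    field_simp
    ring
  rw [hfin, ← hpoly]
  congr 1
  refine Finset.sum_congr rfl fun j _ => ?_
  obtain ⟨r1, r2, -, r4⟩ := rotate hζ hs hq hQ j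
  have hs0' := mul_ne_zero (pow_ne_zero (3 * j) (zeta_ne_zero hζ)) hs0
  have hx1 : ‖ζ ^ j * q‖ < 1 := by
    rw [← r2, norm_pow]; exact pow_lt_one₀ (norm_nonneg _) r1 (by simp)
  have hx := th_zeta_mul_th_zeta_sq hζ r4 hx1
  have t1 := th_zeta hζ hs0' r1 r2 r4
  have t2 := th_zeta (zeta_sq hζ) hs0' r1 r2 r4
  have t3 := dth_zeta hζ hs0' r1 r2 r4
  have hxx := poch_ne_zero_of_norm_lt hx1 hx1
  generalize ζ ^ j * q = x at *
  congr 1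
  have hne : th ζ x * th (ζ ^ 2) x ≠ 0 := hx ▸ by positivity
  have n1 := left_ne_zero_of_mul hne
  have n2 := right_ne_zero_of_mul hne
  have e1 : poch x x ^ 2 * ((1 - ζ) * dth ζ x + ζ * th ζ x) / th ζ x ^ 2 =
      (th (ζ ^ 2) x / (1 - ζ ^ 2)) ^ 2 * (((1 - ζ) * dth ζ x + ζ * th ζ x) / (1 - ζ)) /
        ((1 - ζ) * poch Q Q ^ 2) := by
    have hx' : poch x x = th ζ x * th (ζ ^ 2) x / ((1 - ζ) * (1 - ζ ^ 2) * poch Q Q) := by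
      rw [hx]; field_simp
    rw [hx']
    field_simp
  have e2 : th (ζ ^ 2) x / (1 - ζ ^ 2) = B + A * x := by
    rw [t2, hA, hB]
    field_simp
    linear_combination x * th Q (Q ^ 5) * ζ * h5
  have e3 : ((1 - ζ) * dth ζ x + ζ * th ζ x) / (1 - ζ) / ((1 - ζ) * poch Q Q ^ 2) =
      U + W * x + V * x ^ 3 := by
    rw [t1, t3, hU, hV, hW]
    field_simp
    ring
  rw [e1, mul_div_assoc, e2, e3]
  linear_combination -A ^ 2 * V * r4

end

section

variable {ζ : ℂ} (hζ : IsPrimitiveRoot ζ 5)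
include hζ

lemma zeta_zpow_mod (c : ℤ) : ζ ^ c = ζ ^ (c % 5) := by
  conv_lhs => rw [← Int.emod_add_mul_ediv c 5]
  rw [zpow_add₀ (zeta_ne_zero hζ), zpow_mul, show ζ ^ (5 : ℤ) = ζ ^ 5 from zpow_natCast ζ 5,
    hζ.pow_eq_one, one_zpow, mul_one]

lemma zeta_zpow_combination (c : ℤ) :
    (ζ ^ 2 - ζ ^ 3) * (ζ ^ c - ζ⁻¹ ^ c) - (ζ - ζ ^ 4) * ((ζ ^ 2) ^ c - (ζ ^ 2)⁻¹ ^ c) =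
      -5 * ((if c % 5 = 2 then 1 else 0) - if c % 5 = 3 then 1 else 0) := by
  have h5 := hζ.pow_eq_one
  have e1 : ζ⁻¹ ^ c = (ζ ^ c) ^ 4 := by
    rw [inv_zpow, eq_comm, ← mul_eq_one_iff_eq_inv₀ (zpow_ne_zero _ (zeta_ne_zero hζ)), ← pow_succ,
      ← zpow_natCast, ← zpow_mul, mul_comm, zpow_mul, zpow_natCast, h5, one_zpow]
  have e2 : (ζ ^ 2) ^ c = (ζ ^ c) ^ 2 := by
    rw [← zpow_natCast, ← zpow_natCast, ← zpow_mul, ← zpow_mul, mul_comm]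
  have e3 : (ζ ^ 2)⁻¹ ^ c = ((ζ ^ c) ^ 4) ^ 2 := by
    rw [← e1, inv_zpow, e2, inv_zpow, inv_pow]
  rw [e1, e2, e3, zeta_zpow_mod hζ c]
  have hs := one_add_zeta hζ
  have h : c % 5 = 0 ∨ c % 5 = 1 ∨ c % 5 = 2 ∨ c % 5 = 3 ∨ c % 5 = 4 := by lia
  obtain h | h | h | h | h := h <;> rw [h] <;> norm_num
  · grind
  · grind
  · grind
  · grind

lemma Mw_two_sub_Mw_three (n : ℕ) :
    (ζ ^ 2 - ζ ^ 3) * (crankMoment ζ n - crankMoment ζ⁻¹ n) -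
      (ζ - ζ ^ 4) * (crankMoment (ζ ^ 2) n - crankMoment (ζ ^ 2)⁻¹ n) =
      -5 * ((Mw 2 5 n - Mw 3 5 n : ℤ) : ℂ) := by
  simp only [crankMoment, Mw, ← Finset.sum_sub_distrib, Finset.mul_sum]
  push_cast
  rw [Finset.mul_sum]
  refine Finset.sum_congr rfl fun π _ => ?_
  have h := zeta_zpow_combination hζ (crank π)
  split_ifs at h ⊢ <;> linear_combination (omegaOnes π : ℂ) * h

end

/-- The partitions of four. -/
def partitionsFour : Finset (Nat.Partition 4) :=
  {⟨{4}, by decide, by decide⟩, ⟨{3, 1}, by decide, by decide⟩, ⟨{2, 2}, by decide, by decide⟩,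
    ⟨{2, 1, 1}, by decide, by decide⟩, ⟨{1, 1, 1, 1}, by decide, by decide⟩}

lemma univ_partition_four : (Finset.univ : Finset (Nat.Partition 4)) = partitionsFour := by
  refine (Finset.eq_univ_of_forall fun π => ?_).symm
  have hmem : ∀ i ∈ π.parts, 1 ≤ i ∧ i ≤ 4 := fun i hi =>
    ⟨π.parts_pos hi, (Multiset.le_sum_of_mem hi).trans π.parts_sum.le⟩
  have hp : π.parts = Multiset.replicate (π.parts.count 1) 1 + Multiset.replicate
      (π.parts.count 2) 2 +
      Multiset.replicate (π.parts.count 3) 3 + Multiset.replicate (π.parts.count 4) 4 := by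
    ext i
    simp only [Multiset.count_add, Multiset.count_replicate]
    by_cases hi : i ∈ π.parts
    · obtain ⟨h1, h2⟩ := hmem i hi
      interval_cases i <;> simp
    · have h0 := Multiset.count_eq_zero.2 hi
      rw [h0]
      split_ifs <;> simp_all
  have hsum := π.parts_sum
  rw [hp] at hsum
  simp only [Multiset.sum_add, Multiset.sum_replicate, smul_eq_mul] at hsum
  have h : ∃ ρ ∈ partitionsFour, π.parts = ρ.parts := by
    generalize π.parts.count 1 = a at *
    generalize π.parts.count 2 = b at *
    generalize π.parts.count 3 = c at *
    generalize π.parts.count 4 = d at *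
    rw [hp]
    have ha : a ≤ 4 := by lia
    have hb : b ≤ 2 := by lia
    have hc : c ≤ 1 := by lia
    have hd : d ≤ 1 := by lia
    clear hp hmem
    interval_cases d <;> interval_cases c <;> interval_cases b <;> interval_cases a <;>
      first | (exfalso; lia) | decide
  obtain ⟨ρ, hρ, h⟩ := h
  rwa [Nat.Partition.ext h]

lemma coeff_four : NT 1 5 4 - NT 4 5 4 + 2 * Mw 2 5 4 - 2 * Mw 3 5 4 = -5 := by
  rw [NT, NT, Mw, Mw, univ_partition_four]
  decide

section

variable {ζ s q Q : ℂ} (hζ : IsPrimitiveRoot ζ 5) (hs0 : s ≠ 0) (hs : ‖s‖ < 1) (hq : s ^ 2 = q)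
  (hQ : q ^ 5 = Q)
include hζ hs0 hs hq hQ

lemma hasSum_Mw_two_sub_Mw_three :
    HasSum (fun n => ((Mw 2 5 (5 * n + 4) - Mw 3 5 (5 * n + 4) : ℤ) : ℂ) * q ^ (5 * n + 4))
      (-2 * (q ^ 4 * poch (Q ^ 5) (Q ^ 5) ^ 4 / poch Q Q)) := by
  have h1 := hasSum_crankMoment_sub_mod_five hζ hs0 hs hq hQ
  have h2 := hasSum_crankMoment_sub_mod_five (zeta_sq hζ) hs0 hs hq hQ
  have h5 := hζ.pow_eq_one
  have h0 := one_add_zeta hζ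
  have n1 := one_sub_zeta_ne_zero hζ
  have n2 := one_sub_zeta_sq_ne_zero hζ
  refine (((h1.mul_left (ζ ^ 2 - ζ ^ 3)).sub (h2.mul_left (ζ - ζ ^ 4))).mul_left (-5⁻¹)).of_eq
    (fun n => ?_) ?_
  · linear_combination (5⁻¹ * q ^ (5 * n + 4)) * Mw_two_sub_Mw_three hζ (5 * n + 4)
  · have e1 : (ζ ^ 2 - ζ ^ 3) * (-10 * (ζ ^ 2 + ζ ^ 4) / (1 - ζ)) = -10 * (ζ + ζ ^ 4) := by
      rw [mul_div_assoc', div_eq_iff n1]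
      linear_combination -10 * (1 - ζ) * ζ * h5
    have e2 : (ζ - ζ ^ 4) * (-10 * ((ζ ^ 2) ^ 2 + (ζ ^ 2) ^ 4) / (1 - ζ ^ 2)) =
        10 * (ζ ^ 2 + ζ ^ 3) := by
      rw [mul_div_assoc', div_eq_iff n2]
      grind
    generalize q ^ 4 * poch (Q ^ 5) (Q ^ 5) ^ 4 / poch Q Q = C
    rw [← mul_assoc, ← mul_assoc, e1, e2]
    linear_combination -2 * C * h0

lemma hasSum_rankSum_mod_five :
    HasSum (fun n => (rankSum (5 * n + 4) : ℂ) * q ^ (5 * n + 4))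
      (q ^ 4 * poch (Q ^ 5) (Q ^ 5) ^ 4 / poch Q Q) := by
  refine (hasSum_mod_five_eq_four (a := fun n => (rankSum n : ℂ))
    (F := fun j => (rankPhi (ζ ^ (3 * j) * s) 1 + 5 * deriv (rankPhi (ζ ^ (3 * j) * s)) 1) /
      poch (ζ ^ j * q) (ζ ^ j * q)) hζ (fun j _ => ?_)).of_eq
    (fun _ => rfl) ?_
  · obtain ⟨r1, r2, -⟩ := rotate hζ hs hq hQ j
    have h := hasSum_rankSum (mul_ne_zero (pow_ne_zero (3 * j) (zeta_ne_zero hζ)) hs0) r1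
    rwa [r2] at h
  · rw [sum_zeta_rankPhi_add_deriv hζ hs0 hs hq hQ]
    ring

end

lemma hasSum_NT_Mw {q : ℂ} (hq0 : q ≠ 0) (hq : ‖q‖ < 1) :
    HasSum (fun n : ℕ => ((NT 1 5 (5 * n + 4) - NT 4 5 (5 * n + 4) + 2 * Mw 2 5 (5 * n + 4) -
      2 * Mw 3 5 (5 * n + 4) : ℤ) : ℂ) * q ^ n) (-5 * poch (q ^ 5) (q ^ 5) ^ 4 / poch q q) := by
  obtain ⟨s, hs⟩ := IsAlgClosed.exists_pow_nat_eq q (n := 10) (by norm_num)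
  have hs0 : s ≠ 0 := by
    rintro rfl
    exact hq0 (by simpa using hs.symm)
  have hs1 : ‖s‖ < 1 := by
    rw [← hs, norm_pow] at hq
    exact (pow_lt_one_iff_of_nonneg (norm_nonneg s) (by norm_num)).1 hq
  have hQ : (s ^ 2) ^ 5 = q := by rw [← hs, ← pow_mul]
  have hζ : IsPrimitiveRoot (Complex.exp (2 * Real.pi * Complex.I / (5 : ℕ))) 5 :=
    Complex.isPrimitiveRoot_exp 5 (by norm_num)
  have h4 : (s ^ 2) ^ 4 ≠ 0 := pow_ne_zero _ (pow_ne_zero _ hs0)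
  refine ((((hasSum_Mw_two_sub_Mw_three hζ hs0 hs1 rfl hQ).mul_left 2).sub
    (hasSum_rankSum_mod_five hζ hs0 hs1 rfl hQ)).mul_left ((s ^ 2) ^ 4)⁻¹).of_eq (fun n => ?_) ?_
  · rw [pow_add, pow_mul, hQ, NT_one_sub_NT_four]
    push_cast
    field_simp
    ring
  · field_simp
    ring

lemma poch_zero_zero : poch 0 0 = 1 := by
  simp [poch]

/-- Chan–Mao–Osburn conjecture (Theorem 1.1, (1.4)):
`∑_{n≥0} (NT(1,5,5n+4) − NT(4,5,5n+4) + 2 Mω(2,5,5n+4) − 2 Mω(3,5,5n+4)) qⁿ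
  = −5 (q⁵;q⁵)_∞⁴ / (q;q)_∞` for `|q| < 1`. -/
theorem statement_0 (q : ℂ) (hq : ‖q‖ < 1) :
    ∑' n : ℕ, ((NT 1 5 (5 * n + 4) - NT 4 5 (5 * n + 4)
        + 2 * Mw 2 5 (5 * n + 4) - 2 * Mw 3 5 (5 * n + 4) : ℤ) : ℂ) * q ^ n
      = -5 * (poch (q ^ 5) (q ^ 5)) ^ 4 / poch q q := by
  rcases eq_or_ne q 0 with rfl | hq0
  · rw [tsum_eq_single 0 fun n hn => by simp [hn]]
    simp only [mul_zero, zero_add, coeff_four]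
    norm_num [poch_zero_zero]
  · exact (hasSum_NT_Mw hq0 hq).tsum_eq

end Beck
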